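/- As a K-algebra, E = End_R(M) is isomorphic to the path algebra over K of the quiver Q̃ with vertices 1,…,m and, for each 1 ≤ a ≤ m−1, arrows g_j : a → a+1 (1 ≤ j ≤ n) and λ_i : a+1 → a (1 ≤ i ≤ m), modulo the two-sided ideal generated by the relations λ_iλ_j + λ_jλ_i = 0 = λ_i², g_ig_j + g_jg_i = 0 = g_i², λ_k(λ_ig_j + g_jλ_i) = (λ_ig_j + g_jλ_i)λ_k, and g_l(λ_ig_j + g_jλ_i) = (λ_ig_j + g_jλ_i)g_l, for all meaningful indices, where any term involving a composite of arrows leaving the vertex set {1,…,m} is silently dropped. Under this isomorphism, the classes of paths from vertex a to vertex b span Hom_R(M_a, M_b). -/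

import Mathlib

/-!
STATEMENT 5: As a `K`-algebra, `E = End_R(M)` is isomorphic to the path algebra of the doubled
Beilinson quiver `Q̃` (vertices `1, …, m`; arrows `g_j : a → a+1` and `λ_i : a+1 → a`) modulo
the relations
  `λ_iλ_j + λ_jλ_i = 0 = λ_i²`, `g_ig_j + g_jg_i = 0 = g_i²`,
  `λ_k(λ_ig_j + g_jλ_i) = (λ_ig_j + g_jλ_i)λ_k`, `g_l(λ_ig_j + g_jλ_i) = (λ_ig_j + g_jλ_i)g_l`,
with terms leaving the quiver silently dropped.  Under the isomorphism, classes of paths from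
vertex `a` to vertex `b` span `Hom_R(M_a, M_b)`.

The path algebra with relations is presented by generators and relations:  generators are the
trivial paths `e_1, …, e_m` and the total arrow symbols `λ_1, …, λ_m`, `g_1, …, g_n`, subject
to the path-algebra relations (`e_v e_w = δ_{vw} e_v`, `Σ_v e_v = 1`,
`λ_i = Σ_a e_a λ_i e_{a+1}`, `g_j = Σ_a e_{a+1} g_j e_a`) together with the four families of
relations above (silent dropping of out-of-quiver terms is then automatic).  Since `S → R` is
surjective and each `M_a` is an `R`-module, `E = End_R(M) = End_S(M)`; the `K`-algebra
structure of `E` comes from `K → S`, and the isomorphism is stated as a ring isomorphism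
compatible with the `K`-structures.
-/

noncomputable section

open scoped DirectSum

/-- `S = K[x_{ij}]`. -/
abbrev detS (K : Type) [Field K] (m n : ℕ) : Type := MvPolynomial (Fin m × Fin n) K

/-- The generic matrix `X`. -/
def genX (K : Type) [Field K] (m n : ℕ) : Matrix (Fin m) (Fin n) (detS K m n) :=
  fun i j => MvPolynomial.X (i, j)

/-- The generic map `φ : S^n → S^m`. -/
def genφ (K : Type) [Field K] (m n : ℕ) :
    (Fin n → detS K m n) →ₗ[detS K m n] (Fin m → detS K m n) :=
  Matrix.toLin' (genX K m n)

/-- `M_a = coker(Λ^a φ)`. -/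
abbrev detMa (K : Type) [Field K] (m n a : ℕ) : Type :=
  (⋀[detS K m n]^a (Fin m → detS K m n)) ⧸
    (Submodule.comap (⋀[detS K m n]^a (Fin m → detS K m n)).subtype
      (Submodule.map (ExteriorAlgebra.map (genφ K m n)).toLinearMap
        (⋀[detS K m n]^a (Fin n → detS K m n))))

/-- `M = ⊕_{a=1}^m M_a`. -/
abbrev detM (K : Type) [Field K] (m n : ℕ) : Type :=
  ⨁ (v : Fin m), detMa K m n (v.1 + 1)

/-- `E = End_R(M) = End_S(M)`. -/
abbrev detE (K : Type) [Field K] (m n : ℕ) : Type :=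
  Module.End (detS K m n) (detM K m n)

/-- Generators of the path algebra of the doubled Beilinson quiver: the trivial paths `e_v`
(`v` a vertex) and the arrow symbols `λ_i`, `g_j`. -/
inductive PGen (m n : ℕ) : Type
  | e (v : Fin m) : PGen m n
  | lam (i : Fin m) : PGen m n
  | g (j : Fin n) : PGen m n

namespace PGen

variable (K : Type) [Field K] (m n : ℕ)

/-- `e_v` as an element of the free algebra. -/
abbrev E (v : Fin m) : FreeAlgebra K (PGen m n) := FreeAlgebra.ι K (PGen.e v)
/-- `λ_i` as an element of the free algebra. -/
abbrev L (i : Fin m) : FreeAlgebra K (PGen m n) := FreeAlgebra.ι K (PGen.lam i)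
/-- `g_j` as an element of the free algebra. -/
abbrev G (j : Fin n) : FreeAlgebra K (PGen m n) := FreeAlgebra.ι K (PGen.g j)

end PGen

open PGen in
/-- The defining relations of the path algebra of the doubled Beilinson quiver modulo the
relations of STATEMENT 5.  The first three families present the path algebra itself
(orthogonal idempotents summing to `1`, and the decomposition of each total arrow symbol into
its graded components `e_a λ_i e_{a+1}` resp. `e_{a+1} g_j e_a`); the remaining families are
the quiver relations, in which out-of-quiver terms vanish automatically. -/
inductive PRel (K : Type) [Field K] (m n : ℕ) :
    FreeAlgebra K (PGen m n) → FreeAlgebra K (PGen m n) → Prop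
  | idem (v w : Fin m) :
      PRel K m n (E K m n v * E K m n w) (if v = w then E K m n v else 0)
  | sum_one : PRel K m n (∑ v : Fin m, E K m n v) 1
  | lam_decomp (i : Fin m) :
      PRel K m n (L K m n i)
        (∑ a : Fin m, ∑ b : Fin m,
          if (a : ℕ) + 1 = (b : ℕ) then E K m n a * L K m n i * E K m n b else 0)
  | g_decomp (j : Fin n) :
      PRel K m n (G K m n j)
        (∑ a : Fin m, ∑ b : Fin m,
          if (a : ℕ) = (b : ℕ) + 1 then E K m n a * G K m n j * E K m n b else 0)
  | lam_anticomm (i j : Fin m) :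
      PRel K m n (L K m n i * L K m n j + L K m n j * L K m n i) 0
  | lam_sq (i : Fin m) : PRel K m n (L K m n i * L K m n i) 0
  | g_anticomm (i j : Fin n) :
      PRel K m n (G K m n i * G K m n j + G K m n j * G K m n i) 0
  | g_sq (i : Fin n) : PRel K m n (G K m n i * G K m n i) 0
  | cubic_lam (k i : Fin m) (j : Fin n) :
      PRel K m n (L K m n k * (L K m n i * G K m n j + G K m n j * L K m n i))
        ((L K m n i * G K m n j + G K m n j * L K m n i) * L K m n k)
  | cubic_g (l : Fin n) (i : Fin m) (j : Fin n) :
      PRel K m n (G K m n l * (L K m n i * G K m n j + G K m n j * L K m n i))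
        ((L K m n i * G K m n j + G K m n j * L K m n i) * G K m n l)

/-- The path algebra of the doubled Beilinson quiver `Q̃` over `K`, modulo the relations of
STATEMENT 5. -/
abbrev PathAlg (K : Type) [Field K] (m n : ℕ) : Type := RingQuot (PRel K m n)

/-- The class of the trivial path `e_v` in the quotient path algebra. -/
def pathE (K : Type) [Field K] (m n : ℕ) (v : Fin m) : PathAlg K m n :=
  RingQuot.mkRingHom (PRel K m n) (PGen.E K m n v)

namespace DetPath

/-! ### Creation and annihilation operators -/

section CAR

variable {k : ℕ}

/-- The sign by which two distinct odd generators `i` and `j` are interchanged. -/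
def sgn (i j : Fin k) : ℤ := if j < i then -1 else 1

/-- The sign of moving the generator `i` into its place in the ordered monomial `I`. -/
def sg (i : Fin k) (I : Finset (Fin k)) : ℤ := ∏ j ∈ I, sgn i j

lemma sgn_self (i : Fin k) : sgn i i = 1 := by simp [sgn]

lemma sgn_mul_self (i j : Fin k) : sgn i j * sgn i j = 1 := by
  unfold sgn; split_ifs <;> simp

lemma sgn_swap {i j : Fin k} (h : i ≠ j) : sgn j i = - sgn i j := by
  unfold sgn
  rcases lt_or_gt_of_ne h with h | h <;> simp [h, h.not_gt]

lemma sg_empty (i : Fin k) : sg i ∅ = 1 := by simp [sg]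

lemma sg_mul_self (i : Fin k) (I : Finset (Fin k)) : sg i I * sg i I = 1 := by
  rw [sg, ← Finset.prod_mul_distrib]
  exact Finset.prod_eq_one fun j _ => sgn_mul_self i j

lemma sg_insert {i j : Fin k} {I : Finset (Fin k)} (h : j ∉ I) :
    sg i (insert j I) = sgn i j * sg i I := by
  simp [sg, Finset.prod_insert h]

lemma sg_erase {i j : Fin k} {I : Finset (Fin k)} (h : j ∈ I) :
    sg i (I.erase j) = sgn i j * sg i I := by
  have := sg_insert (i := i) (Finset.notMem_erase j I)
  rw [Finset.insert_erase h] at this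
  rw [this, ← mul_assoc, sgn_mul_self, one_mul]

lemma sg_insert_self (i : Fin k) (I : Finset (Fin k)) : sg i (insert i I) = sg i I := by
  by_cases h : i ∈ I
  · rw [Finset.insert_eq_of_mem h]
  · rw [sg_insert h, sgn_self, one_mul]

lemma sg_erase_self (i : Fin k) (I : Finset (Fin k)) : sg i (I.erase i) = sg i I := by
  by_cases h : i ∈ I
  · rw [sg_erase h, sgn_self, one_mul]
  · rw [Finset.erase_eq_of_notMem h]

lemma sg_eq_one {i : Fin k} {I : Finset (Fin k)} (h : ∀ j ∈ I, i ≤ j) : sg i I = 1 :=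
  Finset.prod_eq_one fun j hj => by simp [sgn, h j hj]

variable (R : Type*) [CommRing R] {X : Type*} [AddCommGroup X] [Module R X]

/-- The creation operator. -/
def eps (i : Fin k) : Module.End R (Finset (Fin k) → X) where
  toFun c I := if i ∈ I then sg i I • c (I.erase i) else 0
  map_add' c d := by ext I; by_cases h : i ∈ I <;> simp [h]
  map_smul' r c := by
    ext I; by_cases h : i ∈ I
    · simp [h, smul_comm r]
    · simp [h]

/-- The annihilation operator. -/
def iot (i : Fin k) : Module.End R (Finset (Fin k) → X) where
  toFun c I := if i ∈ I then 0 else sg i I • c (insert i I)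
  map_add' c d := by ext I; by_cases h : i ∈ I <;> simp [h]
  map_smul' r c := by
    ext I; by_cases h : i ∈ I
    · simp [h]
    · simp [h, smul_comm r]

variable {R}

lemma eps_apply (i : Fin k) (c : Finset (Fin k) → X) (I : Finset (Fin k)) :
    eps R i c I = if i ∈ I then sg i I • c (I.erase i) else 0 := rfl

lemma iot_apply (i : Fin k) (c : Finset (Fin k) → X) (I : Finset (Fin k)) :
    iot R i c I = if i ∈ I then 0 else sg i I • c (insert i I) := rfl

lemma eps_single (i : Fin k) (Q : Finset (Fin k)) (x : X) :
    eps R i (Pi.single Q x) = if i ∈ Q then 0 else sg i Q • Pi.single (insert i Q) x := by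
  ext I
  rw [eps_apply]
  by_cases hQ : i ∈ Q
  · have : I.erase i ≠ Q := fun h => Finset.notMem_erase i I (h ▸ hQ)
    simp [hQ, this]
  · by_cases hI : i ∈ I
    · by_cases h : I = insert i Q
      · subst h
        simp [hQ, sg_insert_self]
      · have : I.erase i ≠ Q := fun h' => h (by rw [← h', Finset.insert_erase hI])
        simp [hQ, h, this]
    · have : I ≠ insert i Q := fun h => hI (h ▸ Finset.mem_insert_self i Q)
      simp [hQ, hI, this]

lemma iot_single (i : Fin k) (Q : Finset (Fin k)) (x : X) :
    iot R i (Pi.single Q x) = if i ∈ Q then sg i Q • Pi.single (Q.erase i) x else 0 := by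
  ext I
  rw [iot_apply]
  by_cases hQ : i ∈ Q
  · by_cases hI : i ∈ I
    · have : I ≠ Q.erase i := fun h => Finset.notMem_erase i Q (h ▸ hI)
      simp [hQ, hI, this]
    · by_cases h : I = Q.erase i
      · subst h
        simp [hQ, Finset.insert_erase hQ, sg_erase_self]
      · have : insert i I ≠ Q := fun h' => h (by rw [← h', Finset.erase_insert hI])
        simp [hQ, h, hI, this]
  · have : insert i I ≠ Q := fun h => hQ (h ▸ Finset.mem_insert_self i I)
    simp [hQ, this]

lemma eps_sq (i : Fin k) : (eps R i : Module.End R (Finset (Fin k) → X)) * eps R i = 0 := by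
  refine LinearMap.ext fun c => funext fun I => ?_
  simp [eps_apply]

lemma iot_sq (i : Fin k) : (iot R i : Module.End R (Finset (Fin k) → X)) * iot R i = 0 := by
  refine LinearMap.ext fun c => funext fun I => ?_
  simp [iot_apply]

lemma eps_anticomm (i j : Fin k) :
    (eps R i : Module.End R (Finset (Fin k) → X)) * eps R j + eps R j * eps R i = 0 := by
  by_cases h : i = j
  · subst h; simp [eps_sq]
  refine LinearMap.ext fun c => funext fun I => ?_
  simp only [LinearMap.add_apply, Module.End.mul_apply, Pi.add_apply, eps_apply,
    Finset.mem_erase, LinearMap.zero_apply, Pi.zero_apply]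
  by_cases hi : i ∈ I <;> by_cases hj : j ∈ I <;> simp [hi, hj, h, Ne.symm h]
  rw [sg_erase hi, sg_erase hj, Finset.erase_right_comm, smul_smul, smul_smul, ← add_smul,
    sgn_swap h]
  convert zero_smul ℤ _
  ring

lemma iot_anticomm (i j : Fin k) :
    (iot R i : Module.End R (Finset (Fin k) → X)) * iot R j + iot R j * iot R i = 0 := by
  by_cases h : i = j
  · subst h; simp [iot_sq]
  refine LinearMap.ext fun c => funext fun I => ?_
  simp only [LinearMap.add_apply, Module.End.mul_apply, Pi.add_apply, iot_apply,
    Finset.mem_insert, LinearMap.zero_apply, Pi.zero_apply]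
  by_cases hi : i ∈ I <;> by_cases hj : j ∈ I <;> simp [hi, hj, h, Ne.symm h]
  rw [sg_insert hi, sg_insert hj, Finset.insert_comm, smul_smul, smul_smul, ← add_smul,
    sgn_swap h]
  convert zero_smul ℤ _
  ring

lemma eps_iot_self (i : Fin k) :
    (eps R i : Module.End R (Finset (Fin k) → X)) * iot R i + iot R i * eps R i = 1 := by
  refine LinearMap.ext fun c => funext fun I => ?_
  simp only [LinearMap.add_apply, Module.End.mul_apply, Pi.add_apply, iot_apply, eps_apply,
    Module.End.one_apply]
  by_cases hi : i ∈ I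
  · simp [hi, sg_erase_self, smul_smul, sg_mul_self]
  · simp [hi, sg_insert_self, smul_smul, sg_mul_self]

lemma eps_iot_ne {i j : Fin k} (h : i ≠ j) :
    (eps R i : Module.End R (Finset (Fin k) → X)) * iot R j + iot R j * eps R i = 0 := by
  refine LinearMap.ext fun c => funext fun I => ?_
  simp only [LinearMap.add_apply, Module.End.mul_apply, Pi.add_apply, iot_apply, eps_apply,
    Finset.mem_insert, Finset.mem_erase, LinearMap.zero_apply, Pi.zero_apply]
  by_cases hi : i ∈ I <;> by_cases hj : j ∈ I <;> simp [hi, hj, h, Ne.symm h]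
  rw [sg_erase hi, sg_insert hj, Finset.erase_insert_of_ne (Ne.symm h), smul_smul, smul_smul,
    ← add_smul, sgn_swap h]
  convert zero_smul ℤ _
  ring

variable {N : Type*} [AddCommGroup N] [Module R N]

/-- The ordered product of the operators indexed by `Q`. -/
def ordProd (T : Fin k → Module.End R N) (Q : Finset (Fin k)) : Module.End R N :=
  ((Q.sort (· ≤ ·)).map T).prod

lemma ordProd_empty (T : Fin k → Module.End R N) : ordProd T ∅ = 1 := by simp [ordProd]

lemma ordProd_insert (T : Fin k → Module.End R N) {q : Fin k} {Q : Finset (Fin k)}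
    (h : ∀ j ∈ Q, q < j) : ordProd T (insert q Q) = T q * ordProd T Q := by
  have hq : q ∉ Q := fun hq => lt_irrefl _ (h q hq)
  rw [ordProd, Finset.sort_insert (r := (· ≤ ·)) (fun b hb => (h b hb).le) hq]
  simp [ordProd]

/-- Pairwise anticommuting operators of square zero. -/
def AntiSq (T : Fin k → Module.End R N) : Prop :=
  (∀ i, T i * T i = 0) ∧ ∀ i j, T i * T j + T j * T i = 0

lemma antiSq_eps : AntiSq (fun i => (eps R i : Module.End R (Finset (Fin k) → X))) :=
  ⟨eps_sq, eps_anticomm⟩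

lemma antiSq_iot : AntiSq (fun i => (iot R i : Module.End R (Finset (Fin k) → X))) :=
  ⟨iot_sq, iot_anticomm⟩

lemma AntiSq.sq_apply {T : Fin k → Module.End R N} (h : AntiSq T) (i : Fin k) (x : N) :
    T i (T i x) = 0 := by
  simpa using LinearMap.congr_fun (h.1 i) x

lemma AntiSq.swap_apply {T : Fin k → Module.End R N} (h : AntiSq T) (i j : Fin k) (x : N) :
    T i (T j x) = - T j (T i x) := by
  have := LinearMap.congr_fun (h.2 i j) x
  exact eq_neg_of_add_eq_zero_left (by simpa using this)

lemma AntiSq.mul_ordProd {T : Fin k → Module.End R N} (h : AntiSq T) (i : Fin k)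
    (Q : Finset (Fin k)) :
    T i * ordProd T Q = if i ∈ Q then 0 else sg i Q • ordProd T (insert i Q) := by
  induction Q using Finset.induction_on_min with
  | empty =>
    rw [ordProd_insert T (q := i) (Q := ∅) (by simp)]
    simp [sg_empty, ordProd_empty]
  | insert q Q hq ih =>
    have hqQ : q ∉ Q := fun hqQ => lt_irrefl _ (hq q hqQ)
    rcases lt_trichotomy i q with hi | hi | hi
    · have h1 : ∀ j ∈ insert q Q, i < j := by
        intro j hj
        rcases Finset.mem_insert.1 hj with rfl | hj
        exacts [hi, hi.trans (hq j hj)]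
      have h2 : i ∉ insert q Q := fun hh => lt_irrefl _ (h1 i hh)
      rw [if_neg h2, sg_eq_one fun j hj => (h1 j hj).le, one_smul, ordProd_insert T h1]
    · subst hi
      rw [if_pos (Finset.mem_insert_self _ _), ordProd_insert T hq, ← mul_assoc, h.1, zero_mul]
    · rw [ordProd_insert T hq, ← mul_assoc, eq_neg_of_add_eq_zero_left (h.2 i q), neg_mul,
        mul_assoc, ih]
      by_cases hiQ : i ∈ Q
      · simp [hiQ]
      · have h2 : i ∉ insert q Q := by simp [hiQ, hi.ne']
        rw [if_neg hiQ, if_neg h2, sg_insert hqQ, Finset.insert_comm, ordProd_insert T (q := q)]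
        · rw [mul_smul_comm, ← neg_smul]; simp [sgn, hi]
        · intro j hj
          rcases Finset.mem_insert.1 hj with rfl | hj
          exacts [hi, hq j hj]

/-- Apply the ordered monomial `Q` in the operators `T` to the coefficient at `Q` and sum. -/
def mu (T : Fin k → Module.End R N) : (Finset (Fin k) → N) →ₗ[R] N :=
  ∑ Q, ordProd T Q ∘ₗ LinearMap.proj Q

lemma mu_apply (T : Fin k → Module.End R N) (c : Finset (Fin k) → N) :
    mu T c = ∑ Q, ordProd T Q (c Q) := by simp [mu]

lemma mu_single (T : Fin k → Module.End R N) (Q : Finset (Fin k)) (x : N) :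
    mu T (Pi.single Q x) = ordProd T Q x := by
  rw [mu_apply, Finset.sum_eq_single Q]
  · simp
  · intro P _ hP; simp [hP]
  · simp

lemma mu_single_empty (T : Fin k → Module.End R N) (x : N) : mu T (Pi.single ∅ x) = x := by
  simp [mu_single, ordProd_empty]

lemma AntiSq.mu_eps {T : Fin k → Module.End R N} (h : AntiSq T) (i : Fin k)
    (c : Finset (Fin k) → N) : mu T (eps R i c) = T i (mu T c) := by
  suffices mu T ∘ₗ eps R i = T i ∘ₗ mu T from LinearMap.congr_fun this c
  refine LinearMap.pi_ext fun Q x => ?_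
  have h1 := LinearMap.congr_fun (h.mul_ordProd i Q) x
  simp only [LinearMap.comp_apply, eps_single, mu_single]
  rw [← Module.End.mul_apply, h1]
  by_cases hQ : i ∈ Q <;> simp [hQ, mu_single]

lemma mu_natural {N' : Type*} [AddCommGroup N'] [Module R N'] {T : Fin k → Module.End R N}
    {T' : Fin k → Module.End R N'} (f : N →ₗ[R] N') (h : ∀ i x, f (T i x) = T' i (f x))
    (c : Finset (Fin k) → N) : f (mu T c) = mu T' (fun Q => f (c Q)) := by
  have key : ∀ Q x, f (ordProd T Q x) = ordProd T' Q (f x) := by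
    intro Q
    induction Q using Finset.induction_on_min with
    | empty => simp [ordProd_empty]
    | insert q Q hq ih => intro x; simp [ordProd_insert _ hq, h, ih]
  simp [mu_apply, key]

lemma AntiSq.derivation_mu {T : Fin k → Module.End R N} (h : AntiSq T) (γ : Module.End R N)
    (ξ : Fin k → Module.End R N) (hγ : ∀ i x, γ (T i x) + T i (γ x) = ξ i x)
    (hξ : ∀ i j x, ξ i (T j x) = T j (ξ i x)) (c : Finset (Fin k) → N) (hc : ∀ Q, γ (c Q) = 0) :
    γ (mu T c) = ∑ i, ξ i (mu T (iot R i c)) := by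
  have key : ∀ Q x, γ x = 0 →
      γ (ordProd T Q x) = ∑ i, ξ i (mu T (iot R i (Pi.single Q x))) := by
    intro Q x hx
    induction Q using Finset.induction_on_min with
    | empty => simp [ordProd_empty, hx, iot_single]
    | insert q Q hq ih =>
      have hqQ : q ∉ Q := fun hqQ => lt_irrefl _ (hq q hqQ)
      have e1 : (Pi.single (insert q Q) x : Finset (Fin k) → N) = eps R q (Pi.single Q x) := by
        rw [eps_single, if_neg hqQ, sg_eq_one fun j hj => (hq j hj).le, one_smul]
      have e2 : ∀ i, iot R i (eps R q (Pi.single Q x : Finset (Fin k) → N))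
          = (if i = q then Pi.single Q x else 0) - eps R q (iot R i (Pi.single Q x)) := by
        intro i
        by_cases hi : i = q
        · subst hi
          have := LinearMap.congr_fun (eps_iot_self (R := R) (X := N) i) (Pi.single Q x)
          simp only [LinearMap.add_apply, Module.End.mul_apply, Module.End.one_apply] at this
          rw [if_pos rfl, eq_sub_iff_add_eq, add_comm, this]
        · have := LinearMap.congr_fun (eps_iot_ne (R := R) (X := N) (Ne.symm hi)) (Pi.single Q x)
          simp only [LinearMap.add_apply, Module.End.mul_apply, LinearMap.zero_apply] at this
          rw [if_neg hi, eq_sub_iff_add_eq, add_comm, this]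
      rw [ordProd_insert T hq, Module.End.mul_apply, eq_sub_of_add_eq (hγ q _), ih, e1]
      simp only [e2, map_sub, h.mu_eps, map_sum, hξ, Finset.sum_sub_distrib]
      congr 1
      rw [Finset.sum_eq_single q]
      · simp [mu_single]
      · intro i _ hi; simp [hi]
      · simp
  have hcs : c = ∑ Q, Pi.single Q (c Q) := (Finset.univ_sum_single c).symm
  conv_rhs => rw [hcs]
  simp only [map_sum]
  rw [mu_apply, map_sum, Finset.sum_comm]
  exact Finset.sum_congr rfl fun Q _ => key Q _ (hc Q)

end CAR

/-! ### Polynomials with coefficients in a module and Koszul complexes -/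

section Pol

/-- Polynomials in `m` commuting variables with coefficients in `X`. -/
abbrev Pol (m : ℕ) (X : Type*) [Zero X] := (Fin m →₀ ℕ) →₀ X

variable {m : ℕ} (R : Type*) [CommRing R]
variable {X : Type*} [AddCommGroup X] [Module R X]
variable {X' : Type*} [AddCommGroup X'] [Module R X']
variable {X'' : Type*} [AddCommGroup X''] [Module R X'']

/-- The `i`-th unit exponent. -/
abbrev ex (i : Fin m) : Fin m →₀ ℕ := Finsupp.single i 1

/-- Multiplication by the `i`-th variable. -/
def yv (i : Fin m) : Module.End R (Pol m X) :=
  Finsupp.lmapDomain X R (fun ν => ν + ex i)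

/-- Division by the `i`-th variable. -/
def dv (i : Fin m) : Module.End R (Pol m X) :=
  Finsupp.lcomapDomain (fun ν : Fin m →₀ ℕ => ν + ex i) (add_left_injective _)

variable {R}

/-- Apply a linear map to all coefficients. -/
def pw (f : X →ₗ[R] X') : Pol m X →ₗ[R] Pol m X' := Finsupp.mapRange.linearMap f

@[simp] lemma pw_apply (f : X →ₗ[R] X') (z : Pol m X) (ν : Fin m →₀ ℕ) :
    pw f z ν = f (z ν) := rfl

@[simp] lemma pw_single (f : X →ₗ[R] X') (x : X) (ν : Fin m →₀ ℕ) :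
    pw f (Finsupp.single ν x) = Finsupp.single ν (f x) := by
  simp [pw]

@[simp] lemma dv_apply (i : Fin m) (z : Pol m X) (ν : Fin m →₀ ℕ) :
    dv R i z ν = z (ν + ex i) := rfl

lemma yv_add (i : Fin m) (z : Pol m X) (ν : Fin m →₀ ℕ) :
    yv R i z (ν + ex i) = z ν :=
  Finsupp.mapDomain_apply (add_left_injective _) _ _

lemma sub_add_ex {i : Fin m} {ν : Fin m →₀ ℕ} (h : ν i ≠ 0) : ν - ex i + ex i = ν :=
  tsub_add_cancel_of_le (by simpa using Nat.one_le_iff_ne_zero.2 h)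

lemma yv_apply (i : Fin m) (z : Pol m X) (ν : Fin m →₀ ℕ) :
    yv R i z ν = if ν i = 0 then 0 else z (ν - ex i) := by
  split_ifs with h
  · refine Finsupp.mapDomain_of_notMem_range _ _ ?_
    rintro ⟨μ, rfl⟩
    simp at h
  · conv_lhs => rw [← sub_add_ex h]
    exact yv_add i z _

lemma yv_single (i : Fin m) (x : X) (ν : Fin m →₀ ℕ) :
    yv R i (Finsupp.single ν x) = Finsupp.single (ν + ex i) x :=
  Finsupp.mapDomain_single

lemma pw_yv (f : X →ₗ[R] X') (i : Fin m) (z : Pol m X) : pw f (yv R i z) = yv R i (pw f z) := by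
  ext ν
  simp only [pw_apply, yv_apply]
  split_ifs <;> simp

lemma yv_comm (i j : Fin m) (z : Pol m X) : yv R i (yv R j z) = yv R j (yv R i z) := by
  induction z using Finsupp.induction_linear with
  | zero => simp
  | add => simp_all
  | single ν x => simp only [yv_single]; rw [add_right_comm]

lemma pw_comp (f : X →ₗ[R] X') (g : X' →ₗ[R] X'') (z : Pol m X) :
    pw g (pw f z) = pw (g ∘ₗ f) z := by ext; simp

/-- The differential `∑ yᵢ Tᵢ`. -/
def dif (T : Fin m → Module.End R X) : Module.End R (Pol m X) :=
  ∑ i, yv R i ∘ₗ pw (T i)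

lemma dif_eq (T : Fin m → Module.End R X) (z : Pol m X) :
    dif T z = ∑ i, yv R i (pw (T i) z) := by simp [dif]

lemma dif_apply (T : Fin m → Module.End R X) (z : Pol m X) (ν : Fin m →₀ ℕ) :
    dif T z ν = ∑ i, if ν i = 0 then 0 else T i (z (ν - ex i)) := by
  rw [dif_eq, Finsupp.finsetSum_apply]
  exact Finset.sum_congr rfl fun i _ => yv_apply i _ _

@[simp] lemma dif_zero_apply (T : Fin m → Module.End R X) (z : Pol m X) : dif T z 0 = 0 := by
  simp [dif_apply]

lemma dif_ex (T : Fin m → Module.End R X) (z : Pol m X) (i : Fin m) :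
    dif T z (ex i) = T i (z 0) := by
  rw [dif_apply, Finset.sum_eq_single i]
  · simp
  · intro j _ hj; simp [hj.symm]
  · simp

lemma pw_dif₂ (T : Fin m → Module.End R X) (T' : Fin m → Module.End R X') (f g : X →ₗ[R] X')
    (h : ∀ i x, f (T i x) = T' i (g x)) (z : Pol m X) : pw f (dif T z) = dif T' (pw g z) := by
  simp only [dif_eq, map_sum, pw_yv, pw_comp]
  refine Finset.sum_congr rfl fun i _ => ?_
  rw [LinearMap.ext (h i) (f := f ∘ₗ T i) (g := T' i ∘ₗ g)]

lemma pw_dif (T : Fin m → Module.End R X) (T' : Fin m → Module.End R X') (f : X →ₗ[R] X')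
    (h : ∀ i x, f (T i x) = T' i (f x)) (z : Pol m X) : pw f (dif T z) = dif T' (pw f z) :=
  pw_dif₂ T T' f f h z

lemma yv_dif (T : Fin m → Module.End R X) (i : Fin m) (z : Pol m X) :
    yv R i (dif T z) = dif T (yv R i z) := by
  simp only [dif_eq, map_sum, pw_yv]
  exact Finset.sum_congr rfl fun j _ => yv_comm _ _ _

lemma dif_dif (T T' : Fin m → Module.End R X) (z : Pol m X) :
    dif T (dif T' z) = ∑ i, ∑ j, yv R i (yv R j (pw (T i * T' j) z)) := by
  simp only [dif_eq, map_sum, pw_yv, pw_comp]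
  rw [Finset.sum_comm]
  rfl

lemma dif_comm {T T' : Fin m → Module.End R X} (h : ∀ i j x, T i (T' j x) = T' j (T i x))
    (z : Pol m X) : dif T (dif T' z) = dif T' (dif T z) := by
  rw [dif_dif, dif_dif, Finset.sum_comm]
  refine Finset.sum_congr rfl fun i _ => Finset.sum_congr rfl fun j _ => ?_
  rw [yv_comm]
  rw [LinearMap.ext (h j i) (f := T j * T' i) (g := T' i * T j)]

lemma sum_sum_alt {ι M : Type*} [Fintype ι] [LinearOrder ι] [AddCommGroup M] (f : ι → ι → M)
    (h0 : ∀ i, f i i = 0) (h : ∀ i j, f i j + f j i = 0) : ∑ i, ∑ j, f i j = 0 := by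
  rw [← Finset.sum_product', Finset.univ_product_univ]
  refine Finset.sum_involution (fun p _ => p.swap) (fun p _ => h _ _) ?_ (by simp) (by simp)
  rintro ⟨i, j⟩ _ hp h'
  obtain rfl : j = i := congrArg Prod.fst h'
  exact hp (h0 j)

lemma AntiSq.dif_dif {T : Fin m → Module.End R X} (h : AntiSq T) (z : Pol m X) :
    dif T (dif T z) = 0 := by
  rw [DetPath.dif_dif]
  refine sum_sum_alt _ (fun i => ?_) fun i j => ?_
  · rw [h.1]
    have : pw (0 : Module.End R X) z = 0 := by ext; simp
    rw [this, map_zero, map_zero]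
  · rw [yv_comm j i, ← map_add, ← map_add]
    have : pw (T i * T j) z + pw (T j * T i) z = 0 := by
      ext ν
      simpa using LinearMap.congr_fun (h.2 i j) (z ν)
    rw [this, map_zero, map_zero]

end Pol

section Koszul

variable {m : ℕ} {R : Type*} [CommRing R] {X : Type*} [AddCommGroup X] [Module R X]

lemma eps_iot_self_apply (i : Fin m) (c : Finset (Fin m) → X) (I : Finset (Fin m)) :
    eps R i (iot R i c) I = if i ∈ I then c I else 0 := by
  rw [eps_apply, iot_apply]
  split_ifs with h h'
  · simp at h'
  · rw [sg_erase_self, smul_smul, sg_mul_self, one_smul, Finset.insert_erase h]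
  · rfl

lemma koszul_homotopy (i : Fin m) (z : Pol m (Finset (Fin m) → X)) (ν : Fin m →₀ ℕ)
    (I : Finset (Fin m)) :
    dif (eps R) (dv R i (pw (iot R i) z)) ν I + dv R i (pw (iot R i) (dif (eps R) z)) ν I
      = z ν I - if ν i = 0 ∧ i ∈ I then z ν I else 0 := by
  have e1 : dv R i (pw (iot R i) (dif (eps R) z)) ν
      = ∑ j, iot R i (eps R j (yv R j z (ν + ex i))) := by
    rw [dv_apply, pw_apply, dif_eq, Finsupp.finsetSum_apply, map_sum]
    simp only [← pw_yv, pw_apply]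
  have e2 : dif (eps R) (dv R i (pw (iot R i) z)) ν
      = ∑ j, eps R j (iot R i (yv R j (dv R i z) ν)) := by
    rw [dif_eq, Finsupp.finsetSum_apply]
    refine Finset.sum_congr rfl fun j _ => ?_
    have : dv R i (pw (iot R i) z) = pw (iot R i) (dv R i z) := by ext; simp
    simp only [this, ← pw_yv, pw_apply]
  rw [e1, e2, ← Pi.add_apply, ← Finset.sum_add_distrib, Finset.sum_eq_single i]
  · rw [yv_add, yv_apply]
    have h1 := LinearMap.congr_fun (eps_iot_self (R := R) (X := X) i) (z ν)
    simp only [LinearMap.add_apply, Module.End.mul_apply, Module.End.one_apply] at h1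
    split_ifs with h h' h'
    · rw [map_zero, map_zero, zero_add, ← h1, Pi.add_apply, eps_iot_self_apply, if_pos h'.2, h1]
      have h2 := congrFun h1 I
      rw [Pi.add_apply, eps_iot_self_apply, if_pos h'.2] at h2
      rw [sub_self]; simpa using h2
    · have h2 := congrFun h1 I
      rw [Pi.add_apply, eps_iot_self_apply, if_neg (fun hh => h' ⟨h, hh⟩), zero_add] at h2
      simp [h2]
    · exact absurd h'.1 h
    · rw [dv_apply, sub_add_ex h, h1, sub_zero]
  · intro j _ hj
    have : yv R j z (ν + ex i) = yv R j (dv R i z) ν := by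
      rw [yv_apply, yv_apply]
      have : (ν + ex i) j = ν j := by simp [hj.symm]
      rw [this]
      split_ifs with h
      · rfl
      · rw [dv_apply]
        congr 1
        conv_lhs => rw [← sub_add_ex h]
        rw [add_right_comm, add_tsub_cancel_right]
    rw [this]
    simpa using LinearMap.congr_fun (eps_iot_ne (R := R) (X := X) hj) (yv R j (dv R i z) ν)
  · simp

theorem koszul_exact (z : Pol m (Finset (Fin m) → X)) (hz : dif (eps R) z = 0)
    (h0 : z 0 Finset.univ = 0) : ∃ w, dif (eps R) w = z := by
  suffices ∀ P : Finset (Fin m), ∃ w z' : Pol m (Finset (Fin m) → X), z = dif (eps R) w + z' ∧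
      dif (eps R) z' = 0 ∧ z' 0 Finset.univ = 0 ∧
      ∀ ν I, z' ν I ≠ 0 → ∀ i ∈ P, ν i = 0 ∧ i ∈ I by
    obtain ⟨w, z', h1, -, h3, h4⟩ := this Finset.univ
    refine ⟨w, ?_⟩
    rw [h1]
    suffices z' = 0 by rw [this, add_zero]
    ext ν I
    by_contra h
    have h5 := h4 ν I h
    have h6 : ν = 0 := by ext i; exact (h5 i (Finset.mem_univ i)).1
    have h7 : I = Finset.univ := by ext i; simpa using (h5 i (Finset.mem_univ i)).2
    subst h6 h7
    exact h h3
  intro P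
  induction P using Finset.induction_on with
  | empty => exact ⟨0, z, by simp, hz, h0, by simp⟩
  | insert i P _ ih =>
    obtain ⟨w, z', h1, h2, h3, h4⟩ := ih
    have key : ∀ ν I, (z' - dif (eps R) (dv R i (pw (iot R i) z'))) ν I
        = if ν i = 0 ∧ i ∈ I then z' ν I else 0 := by
      intro ν I
      have := koszul_homotopy (R := R) i z' ν I
      rw [h2] at this
      simp only [map_zero, Finsupp.zero_apply, Pi.zero_apply, add_zero] at this
      rw [Finsupp.sub_apply, Pi.sub_apply, this, sub_sub_cancel]
    refine ⟨w + dv R i (pw (iot R i) z'), z' - dif (eps R) (dv R i (pw (iot R i) z')), ?_, ?_, ?_,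
      ?_⟩
    · rw [map_add, h1]; abel
    · rw [map_sub, h2, antiSq_eps.dif_dif, sub_zero]
    · rw [key]; simp [h3]
    · intro ν I h j hj
      rw [key] at h
      split_ifs at h with h'
      · rcases Finset.mem_insert.1 hj with rfl | hj
        exacts [h', h4 ν I h j hj]
      · exact absurd rfl h

end Koszul

/-! ### Exactness of the complexes attached to graded systems of odd operators -/

section Sys

variable {m : ℕ} {R : Type*} [CommRing R]
variable {N : Type*} [AddCommGroup N] [Module R N]
variable {N' : Type*} [AddCommGroup N'] [Module R N']

/-- Anticommuting operators of square zero which raise a grading by one. -/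
structure IsSys (T : Fin m → Module.End R N) (E : ℕ → Module.End R N) : Prop where
  anti : AntiSq T
  idem : ∀ a x, E a (E a x) = E a x
  shift : ∀ a i x, E (a + 1) (T i x) = T i (E a x)
  zero : ∀ x, E 0 x = 0

/-- Exactness below degree `m` of the complex of a graded system. -/
def Good (T : Fin m → Module.End R N) (E : ℕ → Module.End R N) : Prop :=
  ∀ a < m, ∀ z : Pol m N, pw (E a) z = z → dif T z = 0 → ∃ w, dif T w = z

lemma mem_range_of_slices {T : Fin m → Module.End R N} {T' : Fin m → Module.End R N'} {σ : Type*}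
    (pr : σ → N' →ₗ[R] N) (inc : σ → N →ₗ[R] N')
    (hincT : ∀ s i x, inc s (T i x) = T' i (inc s x)) {z : Pol m N'}
    (hfin : ∃ F : Finset σ, z = ∑ s ∈ F, pw (inc s) (pw (pr s) z))
    (hz : ∀ s, ∃ w, dif T w = pw (pr s) z) : ∃ w, dif T' w = z := by
  choose w hw using hz
  obtain ⟨F, hF⟩ := hfin
  refine ⟨∑ s ∈ F, pw (inc s) (w s), ?_⟩
  rw [map_sum]
  conv_rhs => rw [hF]
  exact Finset.sum_congr rfl fun s _ => by rw [← hw, pw_dif _ _ _ (hincT s)]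

lemma Good.transfer {T : Fin m → Module.End R N} {E : ℕ → Module.End R N} (h : Good T E)
    {T' : Fin m → Module.End R N'} {E' : ℕ → Module.End R N'} {σ : Type*}
    (pr : σ → N' →ₗ[R] N) (inc : σ → N →ₗ[R] N')
    (hprT : ∀ s i x, pr s (T' i x) = T i (pr s x))
    (hprE : ∀ s i x, pr s (E' i x) = E i (pr s x))
    (hincT : ∀ s i x, inc s (T i x) = T' i (inc s x))
    (hfin : ∀ z : Pol m N', ∃ F : Finset σ, z = ∑ s ∈ F, pw (inc s) (pw (pr s) z)) :
    Good T' E' := by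
  intro a ha z hz hdz
  refine mem_range_of_slices pr inc hincT (hfin z) fun s => h a ha _ ?_ ?_
  · conv_rhs => rw [← hz]
    ext ν; simp [hprE]
  · rw [← pw_dif _ _ _ (hprT s), hdz, map_zero]

/-- Apply an operator componentwise to a family. -/
def cmap {ι : Type*} (f : N →ₗ[R] N') : (ι → N) →ₗ[R] (ι → N') :=
  LinearMap.pi fun I => f ∘ₗ LinearMap.proj I

@[simp] lemma cmap_apply {ι : Type*} (f : N →ₗ[R] N') (c : ι → N) (I : ι) :
    cmap f c I = f (c I) := rfl

lemma cmap_single {ι : Type*} [DecidableEq ι] (f : N →ₗ[R] N') (I : ι) (x : N) :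
    cmap f (Pi.single I x) = Pi.single I (f x) := by
  ext J
  by_cases h : J = I
  · subst h; simp
  · simp [h]

/-- The family supported at `I`. -/
abbrev sng (R : Type*) [CommRing R] {N : Type*} [AddCommGroup N] [Module R N] {ι : Type*}
    [DecidableEq ι] (I : ι) : N →ₗ[R] (ι → N) :=
  LinearMap.single R (fun _ : ι => N) I

/-- Evaluation of a family at `I`. -/
abbrev prj (R : Type*) [CommRing R] {N : Type*} [AddCommGroup N] [Module R N] {ι : Type*}
    (I : ι) : (ι → N) →ₗ[R] N :=
  LinearMap.proj (φ := fun _ : ι => N) I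

lemma sng_apply {ι : Type*} [DecidableEq ι] (I J : ι) (x : N) :
    sng R I x J = if J = I then x else 0 := by
  simp [Pi.single_apply]

lemma cmap_sng {ι : Type*} [DecidableEq ι] (f : N →ₗ[R] N') (I : ι) (x : N) :
    cmap f (sng R I x) = sng R I (f x) := cmap_single f I x

lemma eps_sng_empty {k : ℕ} (i : Fin k) (x : N) :
    eps R i (sng R ∅ x) = sng R {i} x := by
  simp [eps_single, sg_empty]

lemma Good.cmap {k : ℕ} {T : Fin m → Module.End R N} {E : ℕ → Module.End R N} (h : Good T E) :
    Good (fun i => (DetPath.cmap (T i) : Module.End R (Finset (Fin k) → N)))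
      (fun a => DetPath.cmap (E a)) := by
  refine h.transfer (σ := Finset (Fin k)) (fun I => prj R I)
    (fun I => sng R I) (by simp) (by simp) ?_ ?_
  · intro s i x; simp [cmap_single]
  · intro z
    refine ⟨Finset.univ, ?_⟩
    ext ν I
    rw [Finsupp.finsetSum_apply]
    simp only [pw_apply]
    exact congrFun (Finset.univ_sum_single (z ν)).symm I

lemma pol_slices {k : ℕ} (z : Pol m (Pol k N)) : ∃ F : Finset (Fin k →₀ ℕ),
    z = ∑ s ∈ F, pw (Finsupp.lsingle (R := R) s) (pw (Finsupp.lapply (R := R) s) z) := by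
  classical
  refine ⟨z.support.biUnion fun ν => (z ν).support, ?_⟩
  ext ν I
  rw [Finsupp.finsetSum_apply, Finsupp.finsetSum_apply]
  simp only [pw_apply, Finsupp.lapply_apply, Finsupp.lsingle_apply, Finsupp.single_apply,
    Finset.sum_ite_eq']
  split_ifs with hI
  · rfl
  · by_contra h0
    refine hI (Finset.mem_biUnion.2 ⟨ν, ?_, by simpa using h0⟩)
    rw [Finsupp.mem_support_iff]
    intro h1
    simp [h1] at h0

lemma Good.pol {k : ℕ} {T : Fin m → Module.End R N} {E : ℕ → Module.End R N} (h : Good T E) :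
    Good (fun i => (pw (T i) : Module.End R (Pol k N))) (fun a => pw (E a)) :=
  h.transfer (σ := Fin k →₀ ℕ) (fun I => Finsupp.lapply I)
    (fun I => Finsupp.lsingle I) (by simp) (by simp) (by simp) pol_slices

lemma Good.eq_zero {T : Fin m → Module.End R N} {E : ℕ → Module.End R N} (h : Good T E) {a : ℕ}
    (ha : a < m) {x : N} (hx : E a x = x) (hT : ∀ i, T i x = 0) : x = 0 := by
  obtain ⟨w, hw⟩ := h a ha (Finsupp.single 0 x) (by simp [hx])
    (by rw [dif_eq]; exact Finset.sum_eq_zero fun i _ => by simp [hT])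
  have := DFunLike.congr_fun hw 0
  simpa using this.symm

lemma ordProd_shift {T : Fin m → Module.End R N} {E : ℕ → Module.End R N}
    (hs : ∀ a i x, E (a + 1) (T i x) = T i (E a x)) (Q : Finset (Fin m)) (a : ℕ) (x : N) :
    E (a + Q.card) (ordProd T Q x) = ordProd T Q (E a x) := by
  induction Q using Finset.induction_on_min with
  | empty => simp [ordProd_empty]
  | insert q Q hq ih =>
    rw [ordProd_insert T hq, Finset.card_insert_of_notMem fun hh => lt_irrefl _ (hq q hh),
      ← add_assoc, Module.End.mul_apply, hs, ih]
    rfl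

lemma IsSys.ordProd_shift {T : Fin m → Module.End R N} {E : ℕ → Module.End R N} (hs : IsSys T E)
    (Q : Finset (Fin m)) (a : ℕ) (x : N) :
    E (a + Q.card) (ordProd T Q x) = ordProd T Q (E a x) :=
  DetPath.ordProd_shift hs.shift Q a x

lemma Good.eq_zero_of_ordProd {T : Fin m → Module.End R N} {E : ℕ → Module.End R N}
    (h : Good T E) (hs : IsSys T E) {x : N} (hx : E 1 x = x) (k : ℕ) (hk : k < m)
    (hT : ∀ Q : Finset (Fin m), Q.card = k → ordProd T Q x = 0) : x = 0 := by
  induction k with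
  | zero => simpa [ordProd_empty] using hT ∅ rfl
  | succ k ih =>
    refine ih (by omega) fun Q hQ => ?_
    refine h.eq_zero (a := 1 + Q.card) (by omega) (by rw [hs.ordProd_shift, hx]) fun i => ?_
    have := LinearMap.congr_fun (hs.anti.mul_ordProd i Q) x
    rw [Module.End.mul_apply] at this
    rw [this]
    split_ifs with hi
    · rfl
    · rw [LinearMap.smul_apply, hT _ (by rw [Finset.card_insert_of_notMem hi, hQ]), smul_zero]

/-- Projection to the part of exterior degree `r`. -/
def degp {k : ℕ} (r : ℕ) : Module.End R (Finset (Fin k) → N) where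
  toFun c I := if I.card = r then c I else 0
  map_add' c d := by
    ext I; by_cases h : I.card = r <;> simp [h]
  map_smul' t c := by
    ext I; by_cases h : I.card = r <;> simp [h]

lemma degp_apply {k : ℕ} (r : ℕ) (c : Finset (Fin k) → N) (I : Finset (Fin k)) :
    degp (R := R) r c I = if I.card = r then c I else 0 := rfl

lemma degp_idem {k : ℕ} (r : ℕ) (c : Finset (Fin k) → N) :
    degp (R := R) r (degp (R := R) r c) = degp (R := R) r c := by
  ext I; simp only [degp_apply]; split_ifs <;> rfl

lemma degp_eps {k : ℕ} (r : ℕ) (i : Fin k) (c : Finset (Fin k) → N) :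
    degp (R := R) (r + 1) (eps R i c) = eps R i (degp (R := R) r c) := by
  ext I
  simp only [degp_apply, eps_apply]
  by_cases hi : i ∈ I
  · have : (I.erase i).card + 1 = I.card := Finset.card_erase_add_one hi
    by_cases h : I.card = r + 1
    · simp [hi, h]
    · have : (I.erase i).card ≠ r := by omega
      rw [if_neg h, if_pos hi, if_neg this, smul_zero]
  · simp [hi]

lemma degp_iot {k : ℕ} (r : ℕ) (i : Fin k) (c : Finset (Fin k) → N) :
    degp (R := R) r (iot R i c) = iot R i (degp (R := R) (r + 1) c) := by
  ext I
  simp only [degp_apply, iot_apply]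
  by_cases hi : i ∈ I
  · simp [hi]
  · have : (insert i I).card = I.card + 1 := Finset.card_insert_of_notMem hi
    by_cases h : I.card = r
    · simp [hi, h]
    · simp [hi, h]

lemma cmap_eps {k : ℕ} (f : N →ₗ[R] N') (i : Fin k) (c : Finset (Fin k) → N) :
    cmap f (eps R i c) = eps R i (cmap f c) := by
  ext I
  simp only [cmap_apply, eps_apply]
  split_ifs <;> simp

lemma cmap_iot {k : ℕ} (f : N →ₗ[R] N') (i : Fin k) (c : Finset (Fin k) → N) :
    cmap f (iot R i c) = iot R i (cmap f c) := by
  ext I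
  simp only [cmap_apply, iot_apply]
  split_ifs <;> simp

lemma cmap_degp {k : ℕ} (f : N →ₗ[R] N') (r : ℕ) (c : Finset (Fin k) → N) :
    cmap f (degp (R := R) r c) = degp (R := R) r (cmap f c) := by
  ext I
  simp only [cmap_apply, degp_apply]
  split_ifs <;> simp

lemma AntiSq.cmap {ι : Type*} {T : Fin m → Module.End R N} (h : AntiSq T) :
    AntiSq (fun i => (DetPath.cmap (T i) : Module.End R (ι → N))) := by
  refine ⟨fun i => ?_, fun i j => ?_⟩
  · refine LinearMap.ext fun c => funext fun I => ?_
    simp [h.sq_apply]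
  · refine LinearMap.ext fun c => funext fun I => ?_
    simp [h.swap_apply i j]

section SF

variable {T : Fin m → Module.End R N} {E : ℕ → Module.End R N}

lemma koszul_zigzag (h : Good T E) (hs : IsSys T E) (s : ℕ) (hsm : s ≤ m)
    (V : Pol m (Finset (Fin m) → N)) (hV : pw (degp (R := R) (m - s)) V = V)
    (hE : pw (cmap (E s)) V = V)
    (hκ : ∃ V', dif (fun i => cmap (T i)) V' = dif (eps R) V) :
    ∃ U U', V = dif (eps R) U + dif (fun i => cmap (T i)) U' := by
  have hcomm : ∀ z : Pol m (Finset (Fin m) → N),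
      dif (fun i => cmap (T i)) (dif (eps R) z) = dif (eps R) (dif (fun i => cmap (T i)) z) :=
    dif_comm fun i j x => cmap_eps _ _ _
  induction s generalizing V with
  | zero =>
    refine ⟨0, 0, ?_⟩
    rw [← hE]; ext ν I; simp [hs.zero]
  | succ s ih =>
    obtain ⟨V₁, hV₁⟩ := hκ
    set V₂ := pw (cmap (E s)) (pw (degp (R := R) (m - s)) V₁) with hV₂
    have hr : m - s = m - (s + 1) + 1 := by omega
    have h1 : dif (fun i => cmap (T i)) V₂ = dif (eps R) V := by
      conv_rhs => rw [← hE]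
      rw [← pw_dif (eps R) (eps R) (cmap (E (s + 1))) (fun i x => cmap_eps _ _ _), ← hV₁]
      have e1 : dif (fun i => cmap (T i)) V₁
          = pw (degp (R := R) (m - s)) (dif (fun i => cmap (T i)) V₁) := by
        rw [hV₁, hr]
        conv_lhs => rw [← hV]
        exact (pw_dif₂ _ _ _ _ (fun i x => degp_eps _ _ _) V).symm
      rw [e1, pw_dif (fun i => cmap (T i)) (fun i => cmap (T i)) _
        (fun i x => (cmap_degp _ _ _).symm), hV₂]
      exact (pw_dif₂ _ _ _ _ (fun i x => funext fun I => hs.shift _ _ _) _).symm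
    have h2 : dif (fun i => cmap (T i)) (dif (eps R) V₂) = 0 := by
      rw [hcomm, h1, antiSq_eps.dif_dif]
    have h3 : pw (cmap (E s)) (dif (eps R) V₂) = dif (eps R) V₂ := by
      rw [pw_dif (eps R) (eps R) (cmap (E s)) (fun i x => cmap_eps _ _ _), hV₂]
      congr 1
      ext ν I; simp [hs.idem]
    obtain ⟨U, U', hU⟩ := ih (by omega) V₂
      (by
        rw [hV₂]; ext ν I
        simp only [pw_apply, cmap_apply, degp_apply]
        split_ifs <;> simp)
      (by rw [hV₂]; ext ν I; simp [hs.idem])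
      (h.cmap s (by omega) _ h3 h2)
    have h4 : dif (eps R) (V - dif (fun i => cmap (T i)) U) = 0 := by
      rw [map_sub, ← h1, ← hcomm, hU, map_add, hs.anti.cmap.dif_dif, add_zero, sub_self]
    obtain ⟨U'', hU''⟩ := koszul_exact _ h4 (by
      rw [Finsupp.sub_apply, dif_zero_apply, sub_zero, ← hV, pw_apply, degp_apply, if_neg]
      simp; omega)
    exact ⟨U'', U, by rw [hU'', sub_add_cancel]⟩

theorem Good.mem_range_of_yv (h : Good T E) (hs : IsSys T E) (w : Pol m N)
    (hw : pw (E m) w = w) (hy : ∀ i, ∃ v, dif T v = yv R i w) : ∃ v, dif T v = w := by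
  choose v hv using hy
  obtain ⟨U, U', hU⟩ := koszul_zigzag h hs m le_rfl (pw (sng R ∅) w)
    (by
      ext ν I
      simp only [pw_apply, degp_apply, tsub_self, Finset.card_eq_zero, LinearMap.single_apply]
      by_cases hI : I = ∅
      · simp [hI]
      · simp [hI])
    (by
      conv_rhs => rw [← hw]
      ext ν I
      exact congrFun (cmap_sng _ _ _) I)
    (by
      refine ⟨∑ i, pw (sng R {i}) (v i), ?_⟩
      rw [map_sum, dif_eq]
      refine Finset.sum_congr rfl fun i _ => ?_
      rw [← pw_dif T _ _ (fun j x => (cmap_sng _ _ _).symm), hv, pw_yv, pw_comp]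
      have e : eps R i ∘ₗ sng R ∅ = (sng R {i} : N →ₗ[R] Finset (Fin m) → N) :=
        LinearMap.ext fun x => eps_sng_empty i x
      rw [e])
  refine ⟨pw (prj R ∅) U', ?_⟩
  have h1 : w = pw (prj R ∅) (pw (sng R (∅ : Finset (Fin m))) w) := by
    ext ν; simp
  have h2 : pw (prj R ∅) (dif (eps R) U) = 0 := by
    ext ν
    rw [pw_apply, dif_apply, map_sum]
    refine Finset.sum_eq_zero fun i _ => ?_
    split_ifs
    · simp
    · simp [eps_apply]
  rw [h1, hU, map_add, h2, zero_add]
  exact (pw_dif _ T _ (fun i x => rfl) _).symm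

end SF

end Sys

section McCoy

variable {m : ℕ} {R : Type*} [CommRing R]
variable {V : Type*} [AddCommGroup V] [Module R V] {U : Type*} [AddCommGroup U] [Module R U]

lemma mem_of_pow_mem (P : Submodule R V) (y : Fin m → Module.End R V)
    (hyc : ∀ i j v, y i (y j v) = y j (y i v)) (hyP : ∀ i, ∀ v ∈ P, y i v ∈ P)
    (hsf : ∀ v, (∀ i, y i v ∈ P) → v ∈ P) (v : V) (h : ∀ i, ∃ k, (y i ^ k) v ∈ P) : v ∈ P := by
  choose f hf using h
  induction hn : ∑ i, f i generalizing f v with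
  | zero =>
    refine hsf v fun i => hyP i v ?_
    have : f i = 0 := by
      have := Finset.sum_eq_zero_iff.1 hn i (Finset.mem_univ i); exact this
    simpa [this] using hf i
  | succ N ih =>
    refine hsf v fun i => ?_
    by_cases hi : f i = 0
    · exact hyP i v (by simpa [hi] using hf i)
    · refine ih (y i v) (Function.update f i (f i - 1)) ?_ ?_
      · intro j
        by_cases hj : j = i
        · subst hj
          rw [Function.update_self, ← Module.End.mul_apply, ← pow_succ,
            Nat.sub_add_cancel (Nat.one_le_iff_ne_zero.2 hi)]
          exact hf j
        · rw [Function.update_of_ne hj, ← Module.End.mul_apply,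
            ((show Commute (y j) (y i) from LinearMap.ext (hyc j i)).pow_left _).eq]
          exact hyP i _ (hf j)
      · have h1 := Finset.add_sum_erase Finset.univ f (Finset.mem_univ i)
        have h2 := Finset.add_sum_erase Finset.univ (Function.update f i (f i - 1))
          (Finset.mem_univ i)
        rw [Function.update_self, Finset.sum_congr rfl (g := f)] at h2
        · have h3 : f i + (Finset.univ.erase i).sum f = N + 1 := h1.trans hn
          omega
        · intro j hj
          exact Function.update_of_ne (Finset.ne_of_mem_erase hj) _ _

theorem mccoy (P : Submodule R V) (y : Fin m → Module.End R V)
    (hyc : ∀ i j v, y i (y j v) = y j (y i v)) (hyP : ∀ i, ∀ v ∈ P, y i v ∈ P)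
    (hsf : ∀ v, (∀ i, y i v ∈ P) → v ∈ P) (τ : Fin m → U →ₗ[R] V)
    (hτ : ∀ i j u, y j (τ i u) - y i (τ j u) ∈ P) (n : (Fin m →₀ ℕ) → U)
    (hn : ∀ μ : Fin m →₀ ℕ, (∑ i, if μ i = 0 then 0 else τ i (n (μ - ex i))) ∈ P)
    (i : Fin m) (ν : Fin m →₀ ℕ) : τ i (n ν) ∈ P := by
  have hpow : ∀ (i : Fin m) (k : ℕ), ∀ v ∈ P, (y i ^ k) v ∈ P := by
    intro i k
    induction k with
    | zero => simp
    | succ k ih => intro v hv; rw [pow_succ, Module.End.mul_apply]; exact ih _ (hyP i v hv)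
  have hsw : ∀ (i j : Fin m) (k : ℕ) (v : V), y j ((y i ^ k) v) = (y i ^ k) (y j v) := by
    intro i j k v
    simpa using LinearMap.congr_fun
      ((show Commute (y j) (y i) from LinearMap.ext (hyc j i)).pow_right k).eq v
  have claim : ∀ (i : Fin m) (k : ℕ) (ν : Fin m →₀ ℕ), ν.degree ≤ ν i + k →
      (y i ^ k) (τ i (n ν)) ∈ P := by
    have hdeg : ∀ ν : Fin m →₀ ℕ, ν.degree = ∑ j, ν j := fun ν => Finsupp.degree_eq_sum ν
    have rel : ∀ (i : Fin m) (ν : Fin m →₀ ℕ), τ i (n ν)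
        + ∑ j ∈ Finset.univ.erase i, (if ν j = 0 then 0 else τ j (n (ν + ex i - ex j))) ∈ P := by
      intro i ν
      have := hn (ν + ex i)
      rw [← Finset.add_sum_erase _ _ (Finset.mem_univ i)] at this
      convert this using 2
      · simp
      · refine Finset.sum_congr rfl fun j hj => ?_
        have hji : i ≠ j := (Finset.ne_of_mem_erase hj).symm
        simp [hji]
    intro i k
    induction k with
    | zero =>
      intro ν hν
      have h1 := rel i ν
      rw [Finset.sum_eq_zero, add_zero] at h1
      · simpa using h1
      · intro j hj
        rw [if_pos]
        have h2 := hdeg ν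
        rw [← Finset.add_sum_erase _ _ (Finset.mem_univ i)] at h2
        have h3 := Finset.single_le_sum (f := fun j => ν j) (fun _ _ => Nat.zero_le _) hj
        omega
    | succ k ih =>
      intro ν hν
      have h1 := hpow i (k + 1) _ (rel i ν)
      rw [map_add, map_sum] at h1
      refine (P.add_mem_iff_left (P.sum_mem fun j hj => ?_)).1 h1
      split_ifs with h0
      · simp
      · have hji : i ≠ j := (Finset.ne_of_mem_erase hj).symm
        set ν' := ν + ex i - ex j with hν'
        have e : ν' + ex j = ν + ex i := sub_add_ex (by simp [h0])
        have h2 : ν' i = ν i + 1 := by simp [hν', hji]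
        have h3 : ν'.degree = ν.degree := by
          have := congrArg Finsupp.degree e
          simpa using this
        have h4 := ih ν' (by omega)
        have h5 : (y i ^ (k + 1)) (τ j (n ν'))
            = y j ((y i ^ k) (τ i (n ν'))) - (y i ^ k) (y j (τ i (n ν')) - y i (τ j (n ν'))) := by
          rw [pow_succ, Module.End.mul_apply, map_sub, hsw, sub_sub_cancel]
        rw [h5]
        exact P.sub_mem (hyP _ _ h4) (hpow _ _ _ (hτ _ _ _))
  refine mem_of_pow_mem P y hyc hyP hsf _ fun j => ⟨ν.degree + 1, ?_⟩
  have h := P.add_mem (hpow j ν.degree _ (hτ i j (n ν)))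
    (hyP i _ (claim j ν.degree ν (Nat.le_add_left _ _)))
  rwa [hsw, ← map_add, sub_add_cancel, ← Module.End.mul_apply, ← pow_succ] at h

end McCoy

section SFSub

variable {m : ℕ} {R : Type*} [CommRing R] {N : Type*} [AddCommGroup N] [Module R N]

/-- Polynomials whose top degree part is a boundary. -/
def bdry (T : Fin m → Module.End R N) (E : ℕ → Module.End R N) : Submodule R (Pol m N) :=
  (LinearMap.range (dif T)).comap (pw (E m))

variable {T : Fin m → Module.End R N} {E : ℕ → Module.End R N}

lemma mem_bdry {z : Pol m N} : z ∈ bdry T E ↔ ∃ w, dif T w = pw (E m) z := Iff.rfl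

lemma yv_mem_bdry (i : Fin m) (z : Pol m N) (hz : z ∈ bdry T E) : yv R i z ∈ bdry T E := by
  obtain ⟨w, hw⟩ := hz
  exact ⟨yv R i w, by rw [← yv_dif, hw, pw_yv]⟩

lemma Good.sf (h : Good T E) (hs : IsSys T E) (z : Pol m N) (hz : ∀ i, yv R i z ∈ bdry T E) :
    z ∈ bdry T E := by
  refine h.mem_range_of_yv hs _ ?_ fun i => ?_
  · ext ν; simp [hs.idem]
  · rw [← pw_yv]; exact hz i

lemma IsSys.dif_mem_bdry (hs : IsSys T E) (hm : m ≠ 0) (z : Pol m N) : dif T z ∈ bdry T E := by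
  obtain ⟨k, rfl⟩ := Nat.exists_eq_succ_of_ne_zero hm
  exact ⟨pw (E k) z, (pw_dif₂ _ _ _ _ (fun i x => hs.shift _ _ _) z).symm⟩

end SFSub

/-! ### Representations of the doubled Beilinson quiver with relations -/

section Rep

variable {K : Type} [Field K] {m n : ℕ}

/-- Elements of a ring satisfying the relations of the doubled quiver. -/
structure Rep {A : Type*} [Ring A] (ev : ℕ → A) (l : Fin m → A) (g : Fin n → A) : Prop where
  ev_zero : ev 0 = 0
  ev_gt : ∀ a, m < a → ev a = 0
  ev_mul : ∀ a b, ev a * ev b = if a = b then ev a else 0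
  sum_ev : ∑ a ∈ Finset.range (m + 1), ev a = 1
  l_ev : ∀ i a, l i * ev (a + 1) = ev a * l i
  g_ev : ∀ j a, g j * ev a = ev (a + 1) * g j
  l_sq : ∀ i, l i * l i = 0
  l_anti : ∀ i j, l i * l j + l j * l i = 0
  g_sq : ∀ i, g i * g i = 0
  g_anti : ∀ i j, g i * g j + g j * g i = 0
  x_l : ∀ k i j, l k * (l i * g j + g j * l i) = (l i * g j + g j * l i) * l k
  x_g : ∀ k i j, g k * (l i * g j + g j * l i) = (l i * g j + g j * l i) * g k

/-- The universal property of the path algebra with relations. -/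
structure IsPA (K : Type) [Field K] {m n : ℕ} {A : Type} [Ring A] [Algebra K A] (ev : ℕ → A)
    (l : Fin m → A) (g : Fin n → A) : Prop where
  rep : Rep ev l g
  lift : ∀ (B : Type) [Ring B] [Algebra K B] (ev' : ℕ → B) (l' : Fin m → B) (g' : Fin n → B),
    Rep ev' l' g' → ∃ f : A →ₐ[K] B, (∀ a, f (ev a) = ev' a) ∧ (∀ i, f (l i) = l' i) ∧
      ∀ j, f (g j) = g' j
  gen : ∀ U : Subalgebra K A, (∀ a, ev a ∈ U) → (∀ i, l i ∈ U) → (∀ j, g j ∈ U) → U = ⊤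

variable {A : Type} [Ring A] [Algebra K A] {ev : ℕ → A} {l : Fin m → A} {g : Fin n → A}

theorem IsPA.left_induction (h : IsPA K ev l g) (P : Submodule K A) (h1 : 1 ∈ P)
    (hev : ∀ a, ∀ w ∈ P, ev a * w ∈ P) (hl : ∀ i, ∀ w ∈ P, l i * w ∈ P)
    (hg : ∀ j, ∀ w ∈ P, g j * w ∈ P) (w : A) : w ∈ P := by
  let U : Subalgebra K A :=
    { carrier := {a | ∀ w ∈ P, a * w ∈ P}
      mul_mem' := fun {a b} ha hb w hw => by rw [mul_assoc]; exact ha _ (hb _ hw)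
      add_mem' := fun {a b} ha hb w hw => by rw [add_mul]; exact P.add_mem (ha _ hw) (hb _ hw)
      algebraMap_mem' := fun k w hw => by rw [← Algebra.smul_def]; exact P.smul_mem _ hw }
  have hU : U = ⊤ := h.gen U hev hl hg
  have : w ∈ U := by rw [hU]; trivial
  simpa using this 1 h1

theorem IsPA.right_induction (h : IsPA K ev l g) (P : Submodule K A) (h1 : 1 ∈ P)
    (hev : ∀ a, ∀ w ∈ P, w * ev a ∈ P) (hl : ∀ i, ∀ w ∈ P, w * l i ∈ P)
    (hg : ∀ j, ∀ w ∈ P, w * g j ∈ P) (w : A) : w ∈ P := by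
  let U : Subalgebra K A :=
    { carrier := {a | ∀ w ∈ P, w * a ∈ P}
      mul_mem' := fun {a b} ha hb w hw => by rw [← mul_assoc]; exact hb _ (ha _ hw)
      add_mem' := fun {a b} ha hb w hw => by rw [mul_add]; exact P.add_mem (ha _ hw) (hb _ hw)
      algebraMap_mem' := fun k w hw => by
        rw [← Algebra.commutes, ← Algebra.smul_def]; exact P.smul_mem _ hw }
  have hU : U = ⊤ := h.gen U hev hl hg
  have : w ∈ U := by rw [hU]; trivial
  simpa using this 1 h1

/-- Operators which define a right module over the path algebra modulo a submodule. -/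
structure RRep {X : Type*} [AddCommGroup X] [Module K X] (Rel : Submodule K X)
    (E : ℕ → Module.End K X) (T : Fin m → Module.End K X) (G : Fin n → Module.End K X) : Prop where
  E_rel : ∀ a, ∀ x ∈ Rel, E a x ∈ Rel
  T_rel : ∀ i, ∀ x ∈ Rel, T i x ∈ Rel
  G_rel : ∀ j, ∀ x ∈ Rel, G j x ∈ Rel
  E_zero : ∀ x, E 0 x ∈ Rel
  E_gt : ∀ a, m < a → ∀ x, E a x ∈ Rel
  E_mul : ∀ a b x, E a (E b x) = if a = b then E a x else 0
  sum_E : ∀ x, ∑ a ∈ Finset.range (m + 1), E a x - x ∈ Rel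
  T_E : ∀ i a x, E (a + 1) (T i x) = T i (E a x)
  G_E : ∀ j a x, E a (G j x) = G j (E (a + 1) x)
  antiT : AntiSq T
  antiG : AntiSq G
  x_T : ∀ k i j x, T k (T i (G j x) + G j (T i x)) = T i (G j (T k x)) + G j (T i (T k x))
  x_G : ∀ k i j x, G k (T i (G j x) + G j (T i x)) = T i (G j (G k x)) + G j (T i (G k x))

lemma RRep.rep {X : Type} [AddCommGroup X] [Module K X] {Rel : Submodule K X}
    {E : ℕ → Module.End K X} {T : Fin m → Module.End K X} {G : Fin n → Module.End K X}
    (h : RRep Rel E T G) :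
    Rep (A := (Module.End K (X ⧸ Rel))ᵐᵒᵖ)
      (fun a => MulOpposite.op (Rel.mapQ Rel (E a) (h.E_rel a)))
      (fun i => MulOpposite.op (Rel.mapQ Rel (T i) (h.T_rel i)))
      (fun j => MulOpposite.op (Rel.mapQ Rel (G j) (h.G_rel j))) where
  ev_zero := by
    refine MulOpposite.unop_injective (Submodule.linearMap_qext _ (LinearMap.ext fun x => ?_))
    simpa using h.E_zero x
  ev_gt a ha := by
    refine MulOpposite.unop_injective (Submodule.linearMap_qext _ (LinearMap.ext fun x => ?_))
    simpa using h.E_gt a ha x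
  ev_mul a b := by
    refine MulOpposite.unop_injective (Submodule.linearMap_qext _ (LinearMap.ext fun x => ?_))
    have := congrArg Rel.mkQ (h.E_mul b a x)
    by_cases hab : a = b
    · subst hab; simpa using this
    · simpa [hab, Ne.symm hab] using this
  sum_ev := by
    refine MulOpposite.unop_injective (Submodule.linearMap_qext _ (LinearMap.ext fun x => ?_))
    rw [← Finset.op_sum]
    have := (Submodule.Quotient.eq Rel).2 (h.sum_E x)
    rw [← Submodule.mkQ_apply, map_sum] at this
    simpa [LinearMap.sum_apply] using this
  l_ev i a := by
    refine MulOpposite.unop_injective (Submodule.linearMap_qext _ (LinearMap.ext fun x => ?_))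
    simpa using congrArg Rel.mkQ (h.T_E i a x)
  g_ev j a := by
    refine MulOpposite.unop_injective (Submodule.linearMap_qext _ (LinearMap.ext fun x => ?_))
    simpa using congrArg Rel.mkQ (h.G_E j a x)
  l_sq i := by
    refine MulOpposite.unop_injective (Submodule.linearMap_qext _ (LinearMap.ext fun x => ?_))
    simpa using congrArg Rel.mkQ (h.antiT.sq_apply i x)
  l_anti i j := by
    refine MulOpposite.unop_injective (Submodule.linearMap_qext _ (LinearMap.ext fun x => ?_))
    have := congrArg Rel.mkQ (h.antiT.swap_apply j i x)
    simp only [map_neg, Submodule.mkQ_apply] at this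
    simp [this]
  g_sq i := by
    refine MulOpposite.unop_injective (Submodule.linearMap_qext _ (LinearMap.ext fun x => ?_))
    simpa using congrArg Rel.mkQ (h.antiG.sq_apply i x)
  g_anti i j := by
    refine MulOpposite.unop_injective (Submodule.linearMap_qext _ (LinearMap.ext fun x => ?_))
    have := congrArg Rel.mkQ (h.antiG.swap_apply j i x)
    simp only [map_neg, Submodule.mkQ_apply] at this
    simp [this]
  x_l k i j := by
    refine MulOpposite.unop_injective (Submodule.linearMap_qext _ (LinearMap.ext fun x => ?_))
    have := congrArg Rel.mkQ (h.x_T k i j x)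
    simp only [map_add, Submodule.mkQ_apply] at this
    simp only [MulOpposite.unop_mul, MulOpposite.unop_add, MulOpposite.unop_op,
      LinearMap.comp_apply, Module.End.mul_apply, LinearMap.add_apply, Submodule.mkQ_apply,
      Submodule.mapQ_apply, map_add]
    rw [add_comm, ← this, add_comm]
  x_g k i j := by
    refine MulOpposite.unop_injective (Submodule.linearMap_qext _ (LinearMap.ext fun x => ?_))
    have := congrArg Rel.mkQ (h.x_G k i j x)
    simp only [map_add, Submodule.mkQ_apply] at this
    simp only [MulOpposite.unop_mul, MulOpposite.unop_add, MulOpposite.unop_op,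
      LinearMap.comp_apply, Module.End.mul_apply, LinearMap.add_apply, Submodule.mkQ_apply,
      Submodule.mapQ_apply, map_add]
    rw [add_comm, ← this, add_comm]

theorem IsPA.presentation (h : IsPA K ev l g) {X : Type} [AddCommGroup X] [Module K X]
    {Rel : Submodule K X} {E : ℕ → Module.End K X} {T : Fin m → Module.End K X}
    {G : Fin n → Module.End K X} (hX : RRep Rel E T G) (q : X →ₗ[K] A) (one : X)
    (hqE : ∀ a x, q (E a x) = q x * ev a) (hqT : ∀ i x, q (T i x) = q x * l i)
    (hqG : ∀ j x, q (G j x) = q x * g j) (hq : ∀ x ∈ Rel, q x = 0) (hone : q one = 1)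
    (hgen : ∀ P : Submodule K X, Rel ≤ P → one ∈ P → (∀ a, ∀ x ∈ P, E a x ∈ P) →
      (∀ i, ∀ x ∈ P, T i x ∈ P) → (∀ j, ∀ x ∈ P, G j x ∈ P) → P = ⊤) :
    (∀ x, q x = 0 → x ∈ Rel) ∧ Function.Surjective q := by
  obtain ⟨f, hfe, hfl, hfg⟩ := h.lift _ _ _ _ hX.rep
  constructor
  · let Φ : A →ₗ[K] X ⧸ Rel :=
      { toFun := fun a => (f a).unop (Rel.mkQ one)
        map_add' := by simp
        map_smul' := by simp }
    have hΦ : ∀ a b, Φ (a * b) = (f b).unop (Φ a) := by intro a b; simp [Φ]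
    have key : ∀ x, Φ (q x) = Rel.mkQ x := by
      let P : Submodule K X := LinearMap.eqLocus (Φ ∘ₗ q) Rel.mkQ
      have : P = ⊤ := by
        refine hgen P ?_ ?_ ?_ ?_ ?_
        · intro x hx
          simp only [P, LinearMap.mem_eqLocus, LinearMap.comp_apply, hq x hx, map_zero]
          exact ((Submodule.Quotient.mk_eq_zero Rel).2 hx).symm
        · simp only [P, LinearMap.mem_eqLocus, LinearMap.comp_apply, hone]
          simp [Φ]
        · intro a x hx
          simp only [P, LinearMap.mem_eqLocus, LinearMap.comp_apply] at hx ⊢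
          rw [hqE, hΦ, hx, hfe]; rfl
        · intro a x hx
          simp only [P, LinearMap.mem_eqLocus, LinearMap.comp_apply] at hx ⊢
          rw [hqT, hΦ, hx, hfl]; rfl
        · intro a x hx
          simp only [P, LinearMap.mem_eqLocus, LinearMap.comp_apply] at hx ⊢
          rw [hqG, hΦ, hx, hfg]; rfl
      intro x
      have hx : x ∈ P := by rw [this]; trivial
      exact hx
    intro x hx
    have := key x
    rw [hx, map_zero] at this
    exact (Submodule.Quotient.mk_eq_zero Rel).1 this.symm
  · intro w
    refine h.right_induction (LinearMap.range q) ⟨one, hone⟩ ?_ ?_ ?_ w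
    · rintro a _ ⟨x, rfl⟩; exact ⟨_, hqE a x⟩
    · rintro a _ ⟨x, rfl⟩; exact ⟨_, hqT a x⟩
    · rintro a _ ⟨x, rfl⟩; exact ⟨_, hqG a x⟩

/-- Right multiplication operators. -/
abbrev mr (R : Type*) [CommRing R] {A : Type*} [Ring A] [Algebra R A] (w : A) : Module.End R A :=
  LinearMap.mulRight R w

lemma Rep.isSys {R : Type*} [CommRing R] {A : Type*} [Ring A] [Algebra R A] {ev : ℕ → A}
    {l : Fin m → A} {g : Fin n → A} (h : Rep ev l g) :
    IsSys (fun i => mr R (l i)) (fun a => mr R (ev a)) where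
  anti := by
    refine ⟨fun i => LinearMap.ext fun x => ?_, fun i j => LinearMap.ext fun x => ?_⟩
    · simp [mul_assoc, h.l_sq]
    · simp [mul_assoc, ← mul_add, h.l_anti]
  idem a x := by simp [mul_assoc, h.ev_mul]
  shift a i x := by simp [mul_assoc, h.l_ev]
  zero x := by simp [h.ev_zero]

lemma Rep.sum_mul (h : Rep ev l g) (x : A) : ∑ a ∈ Finset.range (m + 1), x * ev a = x := by
  rw [← Finset.mul_sum, h.sum_ev, mul_one]

lemma Rep.x_ev (h : Rep ev l g) (a : ℕ) (i : Fin m) (j : Fin n) :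
    ev a * (l i * g j + g j * l i) = (l i * g j + g j * l i) * ev a := by
  have e1 : l i * g j * ev a = ev a * (l i * g j) := by
    rw [mul_assoc, h.g_ev, ← mul_assoc, h.l_ev, mul_assoc]
  cases a with
  | zero => simp [h.ev_zero]
  | succ a => rw [mul_add, add_mul, e1, mul_assoc (g j), h.l_ev, ← mul_assoc (g j), h.g_ev,
      mul_assoc]

lemma IsPA.x_central (h : IsPA K ev l g) (i : Fin m) (j : Fin n) (w : A) :
    w * (l i * g j + g j * l i) = (l i * g j + g j * l i) * w := by
  have : w ∈ (Subalgebra.centralizer K {l i * g j + g j * l i}) := by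
    rw [h.gen (Subalgebra.centralizer K {l i * g j + g j * l i})]
    · trivial
    all_goals
      intro a
      rw [Subalgebra.mem_centralizer_iff]
      rintro _ rfl
    · exact (h.rep.x_ev a i j).symm
    · exact (h.rep.x_l a i j).symm
    · exact (h.rep.x_g a i j).symm
  rw [Subalgebra.mem_centralizer_iff] at this
  exact (this _ rfl).symm

end Rep

section PathAlg

variable (K : Type) [Field K] (m n : ℕ)

/-- The class of a generator in the path algebra. -/
def pgen (x : PGen m n) : PathAlg K m n :=
  RingQuot.mkAlgHom K (PRel K m n) (FreeAlgebra.ι K x)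

/-- The trivial paths, indexed by the natural numbers. -/
def pev (a : ℕ) : PathAlg K m n :=
  if h : a - 1 < m ∧ a ≠ 0 then pgen K m n (PGen.e ⟨a - 1, h.1⟩) else 0

lemma pgen_rel {x y : FreeAlgebra K (PGen m n)} (h : PRel K m n x y) :
    RingQuot.mkAlgHom K (PRel K m n) x = RingQuot.mkAlgHom K (PRel K m n) y :=
  RingQuot.mkAlgHom_rel K h

lemma pev_succ (v : Fin m) : pev K m n (v + 1) = pgen K m n (PGen.e v) := by
  simp [pev]

lemma pev_succ_eq_pathE (v : Fin m) : pev K m n (v + 1) = pathE K m n v := by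
  rw [pev_succ, pgen, pathE, ← RingQuot.mkAlgHom_coe K]
  rfl

lemma pev_cases (a : ℕ) : (∃ v : Fin m, a = v + 1) ∨ ((a = 0 ∨ m < a) ∧ pev K m n a = 0) := by
  by_cases h : a - 1 < m ∧ a ≠ 0
  · exact Or.inl ⟨⟨a - 1, h.1⟩, by simp; omega⟩
  · exact Or.inr ⟨by omega, by simp [pev, h]⟩

lemma pgen_e_mul (v w : Fin m) : pgen K m n (PGen.e v) * pgen K m n (PGen.e w)
    = if v = w then pgen K m n (PGen.e v) else 0 := by
  have := pgen_rel K m n (PRel.idem v w)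
  rw [map_mul] at this
  rw [pgen, pgen, this]
  split_ifs <;> simp

lemma pgen_lam (i : Fin m) : pgen K m n (PGen.lam i)
    = ∑ a : Fin m, ∑ b : Fin m, if (a : ℕ) + 1 = (b : ℕ) then
      pgen K m n (PGen.e a) * pgen K m n (PGen.lam i) * pgen K m n (PGen.e b) else 0 := by
  have := pgen_rel K m n (PRel.lam_decomp i)
  rw [map_sum] at this
  simp only [map_sum, apply_ite (RingQuot.mkAlgHom K (PRel K m n)), map_mul, map_zero] at this
  exact this

lemma pgen_g (j : Fin n) : pgen K m n (PGen.g j)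
    = ∑ a : Fin m, ∑ b : Fin m, if (a : ℕ) = (b : ℕ) + 1 then
      pgen K m n (PGen.e a) * pgen K m n (PGen.g j) * pgen K m n (PGen.e b) else 0 := by
  have := pgen_rel K m n (PRel.g_decomp j)
  rw [map_sum] at this
  simp only [map_sum, apply_ite (RingQuot.mkAlgHom K (PRel K m n)), map_mul, map_zero] at this
  exact this

lemma sum_ite_rel_mul {A : Type*} [Ring A] (e : Fin m → A)
    (he : ∀ v w, e v * e w = if v = w then e v else 0) (r : Fin m → Fin m → Prop)
    [∀ a b, Decidable (r a b)] (t : A)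
    (ht : t = ∑ a, ∑ b, if r a b then e a * t * e b else 0) (v : Fin m) :
    t * e v = (∑ a, if r a v then e a * t * e v else 0) ∧
    e v * t = (∑ b, if r v b then e v * t * e b else 0) := by
  constructor
  · conv_lhs => rw [ht]
    simp only [Finset.sum_mul, ite_mul, zero_mul, mul_assoc, he, mul_ite, mul_zero]
    refine Finset.sum_congr rfl fun a _ => ?_
    rw [Finset.sum_eq_single v]
    · simp
    · intro b _ hb; simp [hb]
    · simp
  · conv_lhs => rw [ht]
    simp only [Finset.mul_sum, mul_ite, mul_zero]
    rw [Finset.sum_eq_single v]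
    · refine Finset.sum_congr rfl fun b _ => ?_
      rw [← mul_assoc, ← mul_assoc, he, if_pos rfl]
    · intro a _ ha
      refine Finset.sum_eq_zero fun b _ => ?_
      rw [← mul_assoc, ← mul_assoc, he, if_neg ha.symm]
      simp
    · simp

lemma rep_path : Rep (pev K m n) (fun i => pgen K m n (PGen.lam i))
    (fun j => pgen K m n (PGen.g j)) where
  ev_zero := by simp [pev]
  ev_gt a ha := by
    have : ¬ (a - 1 < m ∧ a ≠ 0) := by omega
    simp [pev, this]
  ev_mul a b := by
    rcases pev_cases K m n a with ⟨v, rfl⟩ | ha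
    · rcases pev_cases K m n b with ⟨w, rfl⟩ | hb
      · rw [pev_succ, pev_succ, pgen_e_mul]
        simp [Fin.ext_iff]
      · rw [hb.2, mul_zero]
        split_ifs with h
        · rw [h, hb.2]
        · rfl
    · rw [ha.2, zero_mul]; simp
  sum_ev := by
    rw [Finset.sum_range_succ', Finset.sum_range]
    have := pgen_rel K m n PRel.sum_one
    rw [map_sum, map_one] at this
    simp only [pev_succ]
    rw [show pev K m n 0 = 0 by simp [pev], add_zero]
    exact this
  l_ev i a := by
    have key := sum_ite_rel_mul m _ (pgen_e_mul K m n) _ _ (pgen_lam K m n i)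
    rcases pev_cases K m n (a + 1) with ⟨v, hv⟩ | ⟨ha, ha0⟩
    · rcases pev_cases K m n a with ⟨w, rfl⟩ | ⟨hb, hb0⟩
      · rw [hv, pev_succ, pev_succ, (key v).1, (key w).2]
        rw [Finset.sum_eq_single w, Finset.sum_eq_single v]
        · intro b _ hb
          rw [if_neg]
          intro h; exact hb (Fin.ext (by omega))
        · simp
        · intro b _ hb
          rw [if_neg]
          intro h; exact hb (Fin.ext (by omega))
        · simp
      · rw [hv, pev_succ, (key v).1, hb0, zero_mul]
        exact Finset.sum_eq_zero fun b _ => if_neg (by have := v.2; omega)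
    · rw [ha0, mul_zero]
      rcases pev_cases K m n a with ⟨w, rfl⟩ | ⟨hb, hb0⟩
      · rw [pev_succ, (key w).2]
        exact (Finset.sum_eq_zero fun b _ => if_neg (by have := b.2; omega)).symm
      · rw [hb0, zero_mul]
  g_ev j a := by
    have key := sum_ite_rel_mul m _ (pgen_e_mul K m n) _ _ (pgen_g K m n j)
    rcases pev_cases K m n a with ⟨v, rfl⟩ | ⟨ha, ha0⟩
    · rcases pev_cases K m n (v + 1 + 1) with ⟨w, hw⟩ | ⟨hb, hb0⟩
      · rw [hw, pev_succ, pev_succ, (key v).1, (key w).2]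
        rw [Finset.sum_eq_single w, Finset.sum_eq_single v]
        · intro b _ hb
          rw [if_neg]
          intro h; exact hb (Fin.ext (by omega))
        · simp
        · intro b _ hb
          rw [if_neg]
          intro h; exact hb (Fin.ext (by omega))
        · simp
      · rw [hb0, pev_succ, (key v).1, zero_mul]
        exact Finset.sum_eq_zero fun b _ => if_neg (by have := b.2; omega)
    · rw [ha0, mul_zero]
      rcases pev_cases K m n (a + 1) with ⟨w, hw⟩ | ⟨hb, hb0⟩
      · rw [hw, pev_succ, (key w).2]
        exact (Finset.sum_eq_zero fun b _ => if_neg (by have := w.2; omega)).symm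
      · rw [hb0, zero_mul]
  l_sq i := by
    have := pgen_rel K m n (PRel.lam_sq i)
    rwa [map_mul, map_zero] at this
  l_anti i j := by
    have := pgen_rel K m n (PRel.lam_anticomm i j)
    rwa [map_add, map_mul, map_mul, map_zero] at this
  g_sq i := by
    have := pgen_rel K m n (PRel.g_sq i)
    rwa [map_mul, map_zero] at this
  g_anti i j := by
    have := pgen_rel K m n (PRel.g_anticomm i j)
    rwa [map_add, map_mul, map_mul, map_zero] at this
  x_l k i j := by
    have := pgen_rel K m n (PRel.cubic_lam k i j)
    rwa [map_mul, map_add, map_mul, map_mul, map_mul, map_add, map_mul, map_mul] at this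
  x_g k i j := by
    have := pgen_rel K m n (PRel.cubic_g k i j)
    rwa [map_mul, map_add, map_mul, map_mul, map_mul, map_add, map_mul, map_mul] at this

/-- The images of the generators in a representation. -/
def repGen {B : Type} (ev : ℕ → B) (l : Fin m → B) (g : Fin n → B) : PGen m n → B
  | PGen.e v => ev (v + 1)
  | PGen.lam i => l i
  | PGen.g j => g j

lemma Rep.path_rel {K : Type} [Field K] {m n : ℕ} {B : Type} [Ring B] [Algebra K B] {ev : ℕ → B}
    {l : Fin m → B} {g : Fin n → B} (h : Rep ev l g) {x y : FreeAlgebra K (PGen m n)}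
    (hxy : PRel K m n x y) : FreeAlgebra.lift K (repGen m n ev l g) x
      = FreeAlgebra.lift K (repGen m n ev l g) y := by
  have hsum : ∀ w : B, w = ∑ v : Fin m, w * ev (v + 1) := by
    intro w
    have := h.sum_ev
    rw [Finset.sum_range_succ', h.ev_zero, add_zero, Finset.sum_range] at this
    rw [← Finset.mul_sum, this, mul_one]
  have hsum' : ∀ w : B, w = ∑ v : Fin m, ev (v + 1) * w := by
    intro w
    have := h.sum_ev
    rw [Finset.sum_range_succ', h.ev_zero, add_zero, Finset.sum_range] at this
    rw [← Finset.sum_mul, this, one_mul]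
  induction hxy with
  | idem v w =>
    rw [apply_ite (FreeAlgebra.lift K (repGen m n ev l g))]
    simp [repGen, h.ev_mul, Fin.ext_iff]
  | sum_one =>
    simpa [repGen] using (hsum 1).symm
  | lam_decomp i =>
    simp only [map_sum, apply_ite (FreeAlgebra.lift K (repGen m n ev l g)), map_mul, map_zero,
      FreeAlgebra.lift_ι_apply, repGen]
    conv_lhs => rw [hsum' (l i)]
    refine Finset.sum_congr rfl fun a _ => ?_
    conv_lhs => rw [hsum (ev (a + 1) * l i)]
    refine Finset.sum_congr rfl fun b _ => ?_
    split_ifs with hab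
    · rfl
    · rw [mul_assoc, h.l_ev, ← mul_assoc, h.ev_mul, if_neg hab, zero_mul]
  | g_decomp i =>
    simp only [map_sum, apply_ite (FreeAlgebra.lift K (repGen m n ev l g)), map_mul, map_zero,
      FreeAlgebra.lift_ι_apply, repGen]
    conv_lhs => rw [hsum' (g i)]
    refine Finset.sum_congr rfl fun a _ => ?_
    conv_lhs => rw [hsum (ev (a + 1) * g i)]
    refine Finset.sum_congr rfl fun b _ => ?_
    split_ifs with hab
    · rfl
    · rw [mul_assoc, h.g_ev, ← mul_assoc, h.ev_mul, if_neg (by omega), zero_mul]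
  | lam_anticomm i j => simpa [repGen] using h.l_anti i j
  | lam_sq i => simpa [repGen] using h.l_sq i
  | g_anticomm i j => simpa [repGen] using h.g_anti i j
  | g_sq i => simpa [repGen] using h.g_sq i
  | cubic_lam k i j => simpa [repGen] using h.x_l k i j
  | cubic_g k i j => simpa [repGen] using h.x_g k i j

theorem isPA_path : IsPA K (pev K m n) (fun i => pgen K m n (PGen.lam i))
    (fun j => pgen K m n (PGen.g j)) where
  rep := rep_path K m n
  lift B _ _ ev l g h := by
    let f : PathAlg K m n →ₐ[K] B :=
      RingQuot.liftAlgHom K ⟨FreeAlgebra.lift K (repGen m n ev l g), fun _ _ hxy => h.path_rel hxy⟩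
    have hf : ∀ x, f (pgen K m n x) = repGen m n ev l g x := by
      intro x
      rw [pgen, RingQuot.liftAlgHom_mkAlgHom_apply, FreeAlgebra.lift_ι_apply]
    refine ⟨f, fun a => ?_, fun i => hf _, fun j => hf _⟩
    rcases pev_cases K m n a with ⟨v, rfl⟩ | ⟨ha, ha0⟩
    · rw [pev_succ, hf, repGen]
    · rw [ha0, map_zero]
      rcases ha with rfl | ha
      · exact h.ev_zero.symm
      · exact (h.ev_gt a ha).symm
  gen U he hl hg := by
    have hgen : ∀ x, pgen K m n x ∈ U := by
      rintro (v | i | j)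
      · rw [← pev_succ]; exact he _
      · exact hl i
      · exact hg j
    refine eq_top_iff.2 fun w _ => ?_
    obtain ⟨w, rfl⟩ := RingQuot.mkAlgHom_surjective K (PRel K m n) w
    induction w using FreeAlgebra.induction with
    | grade0 r => rw [AlgHom.commutes]; exact U.algebraMap_mem r
    | grade1 x => exact hgen x
    | mul a b ha hb => rw [map_mul]; exact U.mul_mem (ha trivial) (hb trivial)
    | add a b ha hb => rw [map_add]; exact U.add_mem (ha trivial) (hb trivial)

end PathAlg

section GoodBase

variable {K : Type} [Field K] {m n : ℕ}

lemma exists_pol_lift {X A : Type*} [AddCommGroup X] [Module K X] [AddCommGroup A] [Module K A]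
    (q : X →ₗ[K] A) (hq : Function.Surjective q) (e : Module.End K X) (e' : Module.End K A)
    (hidem : ∀ x, e (e x) = e x) (he : ∀ x, q (e x) = e' (q x)) (z : Pol m A) (hz : pw e' z = z) :
    ∃ s, pw q s = z ∧ pw e s = s := by
  obtain ⟨s, hs⟩ := Finsupp.mapRange_surjective q (map_zero q) hq z
  replace hs : pw q s = z := hs
  refine ⟨pw e s, ?_, ?_⟩
  · conv_rhs => rw [← hz, ← hs]
    ext ν; simp [he]
  · ext ν; simp [hidem]

/-- The projection to the part of total degree `a`. -/
def baseE (K : Type) [Field K] (m a : ℕ) : Module.End K (Finset (Fin m) → Fin m → K) where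
  toFun c I b := if (b : ℕ) + 1 + I.card = a then c I b else 0
  map_add' c d := by ext I b; by_cases h : (b : ℕ) + 1 + I.card = a <;> simp [h]
  map_smul' r c := by ext I b; by_cases h : (b : ℕ) + 1 + I.card = a <;> simp [h]

lemma baseE_apply (a : ℕ) (c : Finset (Fin m) → Fin m → K) (I : Finset (Fin m)) (b : Fin m) :
    baseE K m a c I b = if (b : ℕ) + 1 + I.card = a then c I b else 0 := rfl

/-- The part of total degree greater than `m`. -/
def baseRel (K : Type) [Field K] (m : ℕ) : Submodule K (Finset (Fin m) → Fin m → K) where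
  carrier := {c | ∀ I (b : Fin m), (b : ℕ) + 1 + I.card ≤ m → c I b = 0}
  add_mem' {c d} hc hd I b h := by simp [hc I b h, hd I b h]
  zero_mem' := by simp
  smul_mem' r c hc I b h := by simp [hc I b h]

lemma baseE_eps (a : ℕ) (i : Fin m) (c : Finset (Fin m) → Fin m → K) :
    baseE K m (a + 1) (eps K i c) = eps K i (baseE K m a c) := by
  ext I b
  simp only [baseE_apply, eps_apply]
  by_cases hi : i ∈ I
  · have : (I.erase i).card + 1 = I.card := Finset.card_erase_add_one hi
    simp only [hi, if_true, Pi.smul_apply, baseE_apply]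
    by_cases h : (b : ℕ) + 1 + I.card = a + 1
    · rw [if_pos h, if_pos (by omega)]
    · rw [if_neg h, if_neg (by omega), smul_zero]
  · simp [hi]

lemma baseRRep (G : Fin 0 → Module.End K (Finset (Fin m) → Fin m → K)) :
    RRep (baseRel K m) (baseE K m) (fun i => eps K i) G where
  E_rel a c hc I b h := by rw [baseE_apply, hc I b h, ite_self]
  T_rel i c hc I b h := by
    rw [eps_apply]
    split_ifs with hi
    · have : (I.erase i).card + 1 = I.card := Finset.card_erase_add_one hi
      rw [Pi.smul_apply, hc _ b (by omega), smul_zero]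
    · rfl
  G_rel j := j.elim0
  E_zero c := by
    intro I b h
    rw [baseE_apply, if_neg (by omega)]
  E_gt a ha c I b h := by rw [baseE_apply, if_neg (by omega)]
  E_mul a b c := by
    ext I x
    split_ifs with h
    · subst h; simp only [baseE_apply]; split_ifs <;> rfl
    · simp only [baseE_apply, Pi.zero_apply]
      split_ifs with h1 h2
      · omega
      · rfl
      · rfl
  sum_E c I b h := by
    rw [Pi.sub_apply, Pi.sub_apply, Finset.sum_apply, Finset.sum_apply,
      Finset.sum_eq_single ((b : ℕ) + 1 + I.card)]
    · simp [baseE_apply]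
    · intro a _ ha; rw [baseE_apply, if_neg (Ne.symm ha)]
    · intro ha; exact absurd (Finset.mem_range.2 (by omega)) ha
  T_E i a c := baseE_eps a i c
  G_E j := j.elim0
  antiT := antiSq_eps
  antiG := ⟨fun j => j.elim0, fun j => j.elim0⟩
  x_T k i j := j.elim0
  x_G k i j := j.elim0

lemma ordProd_eps_single {k : ℕ} {R X : Type*} [CommRing R] [AddCommGroup X] [Module R X]
    (I : Finset (Fin k)) (x : X) :
    ordProd (fun i => (eps R i : Module.End R (Finset (Fin k) → X))) I (Pi.single ∅ x)
      = Pi.single I x := by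
  induction I using Finset.induction_on_min with
  | empty => simp [ordProd_empty]
  | insert q Q hq ih =>
    rw [ordProd_insert _ hq, Module.End.mul_apply, ih, eps_single,
      if_neg fun hh => lt_irrefl _ (hq q hh), sg_eq_one fun j hj => (hq j hj).le, one_smul]

lemma ordProd_mem {k : ℕ} {R X : Type*} [CommRing R] [AddCommGroup X] [Module R X]
    (P : Submodule R X) (T : Fin k → Module.End R X) (hT : ∀ i, ∀ x ∈ P, T i x ∈ P)
    (I : Finset (Fin k)) (x : X) (hx : x ∈ P) : ordProd T I x ∈ P := by
  induction I using Finset.induction_on_min with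
  | empty => simpa [ordProd_empty]
  | insert q Q hq ih => rw [ordProd_insert _ hq, Module.End.mul_apply]; exact hT _ _ ih

variable {A : Type} [Ring A] [Algebra K A] {ev : ℕ → A} {l : Fin m → A} {g : Fin 0 → A}

lemma base_generation (P : Submodule K (Finset (Fin m) → Fin m → K))
    (h1 : Pi.single ∅ 1 ∈ P) (hE : ∀ a, ∀ x ∈ P, baseE K m a x ∈ P)
    (hT : ∀ i, ∀ x ∈ P, eps K i x ∈ P) : P = ⊤ := by
  have h2 : ∀ I (b : Fin m) (r : K), Pi.single I (Pi.single b r) ∈ P := by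
    intro I b r
    have h3 : Pi.single ∅ (Pi.single b 1) ∈ P := by
      convert hE (b + 1) _ h1 using 1
      ext J b'
      rw [baseE_apply]
      by_cases hJ : J = ∅
      · subst hJ
        by_cases hb : b' = b
        · subst hb; simp
        · have : ¬ ((b' : ℕ) = b) := fun hh => hb (Fin.ext hh)
          simp [hb, this]
      · simp [hJ]
    have h4 := P.smul_mem r (ordProd_mem P _ hT I _ h3)
    rw [ordProd_eps_single, ← Pi.single_smul, ← Pi.single_smul] at h4
    simpa using h4
  refine eq_top_iff.2 fun c _ => ?_
  rw [← Finset.univ_sum_single c]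
  refine P.sum_mem fun I _ => ?_
  rw [← Finset.univ_sum_single (c I)]
  have := map_sum (LinearMap.single K (fun _ : Finset (Fin m) => Fin m → K) I)
    (fun b => Pi.single b (c I b)) Finset.univ
  rw [LinearMap.coe_single] at this
  rw [this]
  exact P.sum_mem fun b _ => h2 _ _ _

/-- The map from ordered monomials to the path algebra. -/
def baseQ (K : Type) [Field K] {A : Type} [Ring A] [Algebra K A] (ev : ℕ → A) (l : Fin m → A) :
    (Finset (Fin m) → Fin m → K) →ₗ[K] A :=
  mu (fun i => mr K (l i)) ∘ₗ
    cmap (Fintype.linearCombination K (fun b : Fin m => ev (b + 1)))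

lemma baseQ_apply (h : Rep ev l g) (c : Finset (Fin m) → Fin m → K) :
    baseQ K ev l c = ∑ I, ∑ b : Fin m, c I b •
        (ordProd (fun i => mr K (l i)) I (ev (b + 1)) * ev (b + 1 + I.card)) := by
  simp only [baseQ, LinearMap.comp_apply, mu_apply, cmap_apply,
    Fintype.linearCombination_apply, map_sum, map_smul]
  refine Finset.sum_congr rfl fun I _ => Finset.sum_congr rfl fun b _ => ?_
  have := (h.isSys (R := K)).ordProd_shift I (b + 1) (ev (b + 1))
  simp only [LinearMap.mulRight_apply, h.ev_mul, if_true] at this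
  rw [this]

lemma baseQ_eps (h : Rep ev l g) (i : Fin m) (c : Finset (Fin m) → Fin m → K) :
    baseQ K ev l (eps K i c) = baseQ K ev l c * l i := by
  simp only [baseQ, LinearMap.comp_apply, cmap_eps]
  rw [(h.isSys (R := K)).anti.mu_eps]
  rfl

lemma baseQ_baseE (h : Rep ev l g) (a : ℕ) (c : Finset (Fin m) → Fin m → K) :
    baseQ K ev l (baseE K m a c) = baseQ K ev l c * ev a := by
  rw [baseQ_apply h, baseQ_apply h, Finset.sum_mul]
  refine Finset.sum_congr rfl fun I _ => ?_
  rw [Finset.sum_mul]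
  refine Finset.sum_congr rfl fun b _ => ?_
  rw [smul_mul_assoc, mul_assoc, h.ev_mul, baseE_apply]
  split_ifs <;> simp

lemma baseQ_rel (h : Rep ev l g) (c : Finset (Fin m) → Fin m → K) (hc : c ∈ baseRel K m) :
    baseQ K ev l c = 0 := by
  rw [baseQ_apply h]
  refine Finset.sum_eq_zero fun I _ => Finset.sum_eq_zero fun b _ => ?_
  by_cases hb : (b : ℕ) + 1 + I.card ≤ m
  · rw [hc I b hb, zero_smul]
  · rw [h.ev_gt (b + 1 + I.card) (by omega), mul_zero, smul_zero]

lemma baseQ_one (h : Rep ev l g) : baseQ K ev l (Pi.single ∅ 1) = 1 := by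
  simp only [baseQ, LinearMap.comp_apply, cmap_single, mu_single_empty,
    Fintype.linearCombination_apply, Pi.one_apply, one_smul]
  rw [← h.sum_ev, Finset.sum_range_succ', h.ev_zero, add_zero, Finset.sum_range]

theorem IsPA.good_base (h : IsPA K ev l g) :
    Good (fun i => mr K (l i)) (fun a => mr K (ev a)) := by
  have hqT := baseQ_eps (K := K) h.rep
  have hqE := baseQ_baseE (K := K) h.rep
  obtain ⟨hker, hsurj⟩ := h.presentation (baseRRep fun j => j.elim0) (baseQ K ev l)
    (Pi.single ∅ 1) hqE hqT (fun j => j.elim0) (baseQ_rel h.rep) (baseQ_one h.rep)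
    (fun P _ h1 hE hT _ => base_generation P h1 hE hT)
  generalize baseQ K ev l = q at *
  intro a ha z hz hdz
  obtain ⟨s, hs, hEs⟩ := exists_pol_lift q hsurj (baseE K m a) (mr K (ev a))
    (fun x => by rw [(baseRRep (K := K) (m := m) fun j => j.elim0).E_mul, if_pos rfl])
    (fun x => hqE a x) z hz
  have hds : dif (eps K) s = 0 := by
    have h1 : ∀ ν, dif (eps K) s ν ∈ baseRel K m := by
      intro ν
      refine hker _ ?_
      have := DFunLike.congr_fun (pw_dif (fun i => eps K i) (fun i => mr K (l i)) q
        (fun i x => hqT i x) s) ν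
      rw [hs, hdz] at this
      simpa using this
    have h2 : pw (baseE K m (a + 1)) (dif (eps K) s) = dif (eps K) s := by
      rw [pw_dif₂ _ _ _ _ (fun i x => baseE_eps a i x), hEs]
    ext ν I b
    by_cases hb : (b : ℕ) + 1 + I.card ≤ m
    · exact h1 ν I b hb
    · have := congrFun (congrFun (DFunLike.congr_fun h2 ν) I) b
      rw [← this, pw_apply, baseE_apply, if_neg (by omega)]
      rfl
  have h0 : s 0 Finset.univ = 0 := by
    ext b
    rw [← hEs, pw_apply, baseE_apply, if_neg (by rw [Finset.card_univ, Fintype.card_fin]; omega)]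
    rfl
  obtain ⟨w, hw⟩ := koszul_exact s hds h0
  refine ⟨pw q w, ?_⟩
  rw [← pw_dif (fun i => eps K i) (fun i => mr K (l i)) q (fun i x => hqT i x) w]
  exact (congrArg _ hw).trans hs

end GoodBase

section Step

variable {K : Type} [Field K] {m n : ℕ} {B : Type} [AddCommGroup B] [Module K B]
variable (E : ℕ → Module.End K B) (T : Fin m → Module.End K B) (G : Fin n → Module.End K B)
variable (X : Fin m → Module.End K B)

/-- Right multiplication by `l i` on `B ⊕ B g`. -/
def stepT (i : Fin m) : Module.End K (B × B) :=
  LinearMap.prod (T i ∘ₗ LinearMap.fst K B B + X i ∘ₗ LinearMap.snd K B B)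
    (-(T i ∘ₗ LinearMap.snd K B B))

/-- Right multiplication by the idempotents on `B ⊕ B g`. -/
def stepE (a : ℕ) : Module.End K (B × B) := LinearMap.prodMap (E a) (E (a + 1))

/-- Right multiplication by the arrows `g` on `B ⊕ B g`. -/
def stepG : Fin (n + 1) → Module.End K (B × B) :=
  Fin.cons (LinearMap.inr K B B ∘ₗ LinearMap.fst K B B)
    (fun j => LinearMap.prodMap (G j) (-(G j)))

/-- The parametrization of the relations of `B ⊕ B g`. -/
def stepRho : (Finset (Fin m) → B) →ₗ[K] B × B :=
  mu (stepT T X) ∘ₗ cmap (LinearMap.inr K B B ∘ₗ E 1)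

variable {E T G X}

@[simp] lemma stepT_apply (i : Fin m) (x : B × B) :
    stepT T X i x = (T i x.1 + X i x.2, -(T i x.2)) := rfl

@[simp] lemma stepE_apply (a : ℕ) (x : B × B) : stepE E a x = (E a x.1, E (a + 1) x.2) := rfl

@[simp] lemma stepG_zero (x : B × B) : stepG G 0 x = (0, x.1) := rfl

@[simp] lemma stepG_succ (j : Fin n) (x : B × B) : stepG G j.succ x = (G j x.1, -(G j x.2)) := rfl

lemma stepRho_apply (c : Finset (Fin m) → B) :
    stepRho E T X c = mu (stepT T X) (cmap (LinearMap.inr K B B ∘ₗ E 1) c) := rfl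

/-- Operators commuting with a right module structure without relations. -/
structure StepData (E : ℕ → Module.End K B) (T : Fin m → Module.End K B)
    (G : Fin n → Module.End K B) (X : Fin m → Module.End K B) : Prop where
  rr : RRep (⊥ : Submodule K B) E T G
  X_E : ∀ i a x, X i (E a x) = E a (X i x)
  X_T : ∀ i j x, X i (T j x) = T j (X i x)
  X_G : ∀ i j x, X i (G j x) = G j (X i x)
  X_X : ∀ i j x, X i (X j x) = X j (X i x)

variable (h : StepData E T G X)
include h

lemma StepData.antiT : AntiSq (stepT T X) := by
  have key : ∀ i j x, stepT T X i (stepT T X j x) = - stepT T X j (stepT T X i x) := by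
    intro i j x
    simp only [stepT_apply, map_add, map_neg, h.X_T, Prod.neg_mk, h.rr.antiT.swap_apply i j]
    refine Prod.ext ?_ ?_
    · simp only; abel
    · simp only
  constructor
  · intro i
    refine LinearMap.ext fun x => ?_
    simp only [Module.End.mul_apply, stepT_apply, map_add, map_neg, h.X_T, h.rr.antiT.sq_apply]
    simp
  · intro i j
    refine LinearMap.ext fun x => ?_
    rw [LinearMap.add_apply, Module.End.mul_apply, Module.End.mul_apply, key i j]
    exact neg_add_cancel _

lemma StepData.T_E (i : Fin m) (a : ℕ) (x : B × B) :
    stepE E (a + 1) (stepT T X i x) = stepT T X i (stepE E a x) := by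
  simp [h.rr.T_E, h.X_E]

lemma StepData.E_mul (a b : ℕ) (x : B × B) :
    stepE E a (stepE E b x) = if a = b then stepE E a x else 0 := by
  simp only [stepE_apply, h.rr.E_mul, add_left_inj]
  split_ifs <;> rfl

lemma StepData.stepE_ordProd (a : ℕ) (I : Finset (Fin m)) (x : B) :
    stepE E a (ordProd (stepT T X) I (0, E 1 x))
      = if a = I.card then ordProd (stepT T X) I (0, E 1 x) else 0 := by
  have h1 : ordProd (stepT T X) I (0, E 1 x) =
      stepE E I.card (ordProd (stepT T X) I (0, E 1 x)) := by
    have := ordProd_shift (E := stepE E) (T := stepT T X) (fun a i x => h.T_E i a x) I 0 (0, E 1 x)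
    rw [zero_add] at this
    rw [this]
    simp [h.rr.E_mul]
  rw [h1, h.E_mul]
  split_ifs with hh
  · rw [hh, ← h1]
  · rfl

lemma StepData.stepE_rho (a : ℕ) (c : Finset (Fin m) → B) :
    stepE E a (stepRho E T X c) = stepRho E T X (degp (R := K) a c) := by
  rw [stepRho_apply, stepRho_apply, mu_apply, mu_apply, map_sum]
  refine Finset.sum_congr rfl fun I _ => ?_
  simp only [cmap_apply, LinearMap.comp_apply, LinearMap.inr_apply, degp_apply]
  rw [h.stepE_ordProd]
  by_cases ha : I.card = a
  · rw [if_pos ha, if_pos ha.symm]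
  · rw [if_neg ha, if_neg (Ne.symm ha), map_zero, ← Prod.zero_eq_mk, map_zero]

lemma StepData.rho_eps (i : Fin m) (c : Finset (Fin m) → B) :
    stepRho E T X (eps K i c) = stepT T X i (stepRho E T X c) := by
  rw [stepRho_apply, stepRho_apply, cmap_eps, h.antiT.mu_eps]

omit h in
lemma stepRho_comm (ξ : Module.End K B) (hT : ∀ i x, ξ (T i x) = T i (ξ x))
    (hX : ∀ i x, ξ (X i x) = X i (ξ x)) (hE : ∀ x, ξ (E 1 x) = E 1 (ξ x))
    (c : Finset (Fin m) → B) :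
    LinearMap.prodMap ξ ξ (stepRho E T X c) = stepRho E T X (cmap ξ c) := by
  rw [stepRho_apply, mu_natural (T' := stepT T X) (LinearMap.prodMap ξ ξ)]
  · rw [stepRho_apply]
    congr 1
    funext I
    simp [hE]
  · intro i x; simp [hT, hX]

omit h in
lemma stepTG_zero (i : Fin m) (x : B × B) :
    stepT T X i (stepG G 0 x) + stepG G 0 (stepT T X i x) = (X i x.1, X i x.2) := by
  simp

lemma StepData.TG_succ (i : Fin m) (j : Fin n) (x : B × B) :
    stepT T X i (stepG G j.succ x) + stepG G j.succ (stepT T X i x)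
      = (T i (G j x.1) + G j (T i x.1), T i (G j x.2) + G j (T i x.2)) := by
  simp only [stepT_apply, stepG_succ, map_add, map_neg, h.X_G, Prod.mk_add_mk]
  refine Prod.ext ?_ ?_
  · simp only; abel
  · simp only; abel

lemma StepData.E_zero (x : B) : E 0 x = 0 := by simpa using h.rr.E_zero x

lemma StepData.xE (i : Fin m) (j : Fin n) (a : ℕ) (x : B) :
    E a (T i (G j x) + G j (T i x)) = T i (G j (E a x)) + G j (T i (E a x)) := by
  cases a with
  | zero => simp [h.E_zero]
  | succ a => rw [map_add, h.rr.T_E, h.rr.G_E, h.rr.G_E, h.rr.T_E]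

lemma StepData.G_rel (j : Fin (n + 1)) (c : Finset (Fin m) → B) :
    stepG G j (stepRho E T X c) ∈ LinearMap.range (stepRho E T X) := by
  have main : ∀ ξ : Fin m → Module.End K B,
      (∀ i x, stepT T X i (stepG G j x) + stepG G j (stepT T X i x) = (ξ i x.1, ξ i x.2)) →
      (∀ i k x, ξ i (T k x) = T k (ξ i x)) → (∀ i k x, ξ i (X k x) = X k (ξ i x)) →
      (∀ i x, ξ i (E 1 x) = E 1 (ξ i x)) → (∀ x, stepG G j (0, E 1 x) = 0) →
      stepG G j (stepRho E T X c) ∈ LinearMap.range (stepRho E T X) := by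
    intro ξ hξ hT hX hE h0
    rw [stepRho_apply, h.antiT.derivation_mu (stepG G j) (fun i => LinearMap.prodMap (ξ i) (ξ i))
      (fun i x => by rw [add_comm, hξ]; rfl) (fun i k x => by simp [hT, hX])
      _ (fun Q => by simpa using h0 (c Q))]
    refine Submodule.sum_mem _ fun i _ => ⟨cmap (ξ i) (iot K i c), ?_⟩
    rw [← stepRho_comm (ξ i) (hT i) (hX i) (hE i), stepRho_apply, cmap_iot]
  refine Fin.cases ?_ (fun j => ?_) j
    (motive := fun j => (∀ ξ : Fin m → Module.End K B,
      (∀ i x, stepT T X i (stepG G j x) + stepG G j (stepT T X i x) = (ξ i x.1, ξ i x.2)) →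
      (∀ i k x, ξ i (T k x) = T k (ξ i x)) → (∀ i k x, ξ i (X k x) = X k (ξ i x)) →
      (∀ i x, ξ i (E 1 x) = E 1 (ξ i x)) → (∀ x, stepG G j (0, E 1 x) = 0) →
      stepG G j (stepRho E T X c) ∈ LinearMap.range (stepRho E T X)) →
      stepG G j (stepRho E T X c) ∈ LinearMap.range (stepRho E T X)) main
  · intro main
    exact main X (fun i x => stepTG_zero i x) h.X_T h.X_X (fun i x => h.X_E i 1 x) (by simp)
  · intro main
    refine main (fun i => T i * G j + G j * T i) (fun i x => ?_) ?_ ?_ ?_ ?_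
    · rw [h.TG_succ]; rfl
    · intro i k x
      simpa using (h.rr.x_T k i j x).symm
    · intro i k x
      simp [h.X_T, h.X_G]
    · intro i x
      simpa using (h.xE i j 1 x).symm
    · intro x
      have := h.rr.G_E j 0 x
      rw [h.E_zero] at this
      simp [← this]

theorem StepData.step : RRep (LinearMap.range (stepRho E T X)) (stepE E) (stepT T X) (stepG G) where
  E_rel := by rintro a _ ⟨c, rfl⟩; exact ⟨_, (h.stepE_rho a c).symm⟩
  T_rel := by rintro i _ ⟨c, rfl⟩; exact ⟨_, h.rho_eps i c⟩
  G_rel := by rintro j _ ⟨c, rfl⟩; exact h.G_rel j c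
  E_zero x := by
    refine ⟨Pi.single ∅ x.2, ?_⟩
    rw [stepRho_apply, cmap_single, mu_single_empty]
    simp [h.E_zero]
  E_gt a ha x := by
    have h1 : ∀ b, m < b → ∀ y, E b y = 0 := fun b hb y => by simpa using h.rr.E_gt b hb y
    rw [stepE_apply, h1 a ha, h1 (a + 1) (by omega)]
    exact Submodule.zero_mem _
  E_mul := h.E_mul
  sum_E x := by
    have h1 : ∀ y, ∑ a ∈ Finset.range (m + 1), E a y = y := fun y => by
      simpa [sub_eq_zero] using h.rr.sum_E y
    have h2 : ∀ y, ∑ a ∈ Finset.range (m + 1), E (a + 1) y = y := fun y => by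
      have h3 := Finset.sum_range_succ' (fun a => E a y) (m + 1)
      rw [Finset.sum_range_succ, h1, h.E_zero, add_zero] at h3
      rw [← h3]
      simpa using h.rr.E_gt (m + 1) (by omega) y
    have : ∑ a ∈ Finset.range (m + 1), stepE E a x = x := by
      refine Prod.ext ?_ ?_
      · rw [Prod.fst_sum]; exact h1 x.1
      · rw [Prod.snd_sum]; exact h2 x.2
    rw [this, sub_self]
    exact Submodule.zero_mem _
  T_E := h.T_E
  G_E j a x := by
    refine Fin.cases ?_ (fun j => ?_) j
    · simp
    · simp [h.rr.G_E]
  antiT := h.antiT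
  antiG := by
    constructor
    · intro j
      refine LinearMap.ext fun x => ?_
      refine Fin.cases ?_ (fun j => ?_) j
      · simp
      · simp [h.rr.antiG.sq_apply]
    · intro i j
      refine LinearMap.ext fun x => ?_
      refine Fin.cases ?_ (fun j => ?_) j
      · refine Fin.cases ?_ (fun i => ?_) i
        · simp
        · simp
      · refine Fin.cases ?_ (fun i => ?_) i
        · simp
        · simp [h.rr.antiG.swap_apply i j]
  x_T k i j x := by
    refine Fin.cases ?_ (fun j => ?_) j
    · rw [stepTG_zero, stepTG_zero]
      simp [h.X_T, h.X_X]
    · rw [h.TG_succ, h.TG_succ]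
      simp only [stepT_apply, h.rr.x_T, map_add, h.X_T, h.X_G, map_neg]
      refine Prod.ext ?_ ?_
      · simp only; abel
      · simp only [← neg_add]
  x_G k i j x := by
    refine Fin.cases ?_ (fun j => ?_) j
    · rw [stepTG_zero, stepTG_zero]
      refine Fin.cases ?_ (fun k => ?_) k
      · simp
      · simp [h.X_G]
    · rw [h.TG_succ, h.TG_succ]
      refine Fin.cases ?_ (fun k => ?_) k
      · simp
      · simp only [stepG_succ, h.rr.x_G, map_neg, neg_add]

end Step

section StepGood

variable {K : Type} [Field K] {m n : ℕ} {N : Type} [AddCommGroup N] [Module K N]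
variable {E : ℕ → Module.End K N} {T : Fin m → Module.End K N} {G : Fin n → Module.End K N}

lemma dif_neg_op (T : Fin m → Module.End K N) (z : Pol m N) :
    dif (fun i => -T i) z = - dif T z := by
  ext ν
  simp only [dif_apply, Finsupp.neg_apply, ← Finset.sum_neg_distrib]
  refine Finset.sum_congr rfl fun i _ => ?_
  split_ifs <;> simp

lemma Good.neg (h : Good T E) : Good (fun i => -T i) E := by
  intro a ha z hz hd
  rw [dif_neg_op, neg_eq_zero] at hd
  obtain ⟨w, hw⟩ := h a ha z hz hd
  exact ⟨-w, by rw [dif_neg_op, map_neg, neg_neg, hw]⟩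

lemma IsSys.neg (h : IsSys T E) : IsSys (fun i => -T i) E where
  anti := ⟨fun i => by simpa using h.anti.1 i, fun i j => by simpa using h.anti.2 i j⟩
  idem := h.idem
  shift a i x := by simp [h.shift]
  zero := h.zero

lemma RRep.stepData (h : RRep (⊥ : Submodule K N) E T G) :
    StepData (fun a => (pw (E a) : Module.End K (Pol m N))) (fun i => pw (T i))
      (fun j => pw (G j)) (yv K) where
  rr :=
    { E_rel := by simp
      T_rel := by simp
      G_rel := by simp
      E_zero := fun x => by
        rw [Submodule.mem_bot]; ext ν; simpa using h.E_zero (x ν)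
      E_gt := fun a ha x => by
        rw [Submodule.mem_bot]; ext ν; simpa using h.E_gt a ha (x ν)
      E_mul := fun a b x => by
        ext ν
        have := h.E_mul a b (x ν)
        split_ifs at this ⊢ <;> simpa using this
      sum_E := fun x => by
        rw [Submodule.mem_bot]; ext ν
        simpa [Finsupp.finsetSum_apply] using h.sum_E (x ν)
      T_E := fun i a x => by ext ν; simpa using h.T_E i a (x ν)
      G_E := fun i a x => by ext ν; simpa using h.G_E i a (x ν)
      antiT := by
        refine ⟨fun i => LinearMap.ext fun x => ?_, fun i j => LinearMap.ext fun x => ?_⟩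
        · ext ν; simpa using h.antiT.sq_apply i (x ν)
        · ext ν; simp [h.antiT.swap_apply i j (x ν)]
      antiG := by
        refine ⟨fun i => LinearMap.ext fun x => ?_, fun i j => LinearMap.ext fun x => ?_⟩
        · ext ν; simpa using h.antiG.sq_apply i (x ν)
        · ext ν; simp [h.antiG.swap_apply i j (x ν)]
      x_T := fun k i j x => by ext ν; simpa using h.x_T k i j (x ν)
      x_G := fun k i j x => by ext ν; simpa using h.x_G k i j (x ν) }
  X_E i a x := (pw_yv _ _ _).symm
  X_T i a x := (pw_yv _ _ _).symm
  X_G i a x := (pw_yv _ _ _).symm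
  X_X := yv_comm

/-- The relation parametrization over `Pol m N`. -/
abbrev polRho (E : ℕ → Module.End K N) (T : Fin m → Module.End K N) :
    (Finset (Fin m) → Pol m N) →ₗ[K] Pol m N × Pol m N :=
  stepRho (fun a => (pw (E a) : Module.End K (Pol m N))) (fun i => pw (T i)) (yv K)

/-- Right multiplication by `l i` over `Pol m N`. -/
abbrev polT (T : Fin m → Module.End K N) (i : Fin m) : Module.End K (Pol m N × Pol m N) :=
  stepT (fun i => (pw (T i) : Module.End K (Pol m N))) (yv K) i

/-- Right multiplication by the idempotents over `Pol m N`. -/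
abbrev polE (E : ℕ → Module.End K N) (a : ℕ) : Module.End K (Pol m N × Pol m N) :=
  stepE (fun a => (pw (E a) : Module.End K (Pol m N))) a

variable (K) in
lemma eps_iot_iot_top (i j k : Fin m) (u : N) :
    eps K k (iot K j (iot K i (sng K Finset.univ u)))
      = (if k = j then iot K i (sng K Finset.univ u) else 0)
        - (if k = i then iot K j (sng K Finset.univ u) else 0) := by
  have h1 : ∀ (a b : Fin m) (c : Finset (Fin m) → N), eps K a (iot K b c)
      = (if a = b then c else 0) - iot K b (eps K a c) := by
    intro a b c
    split_ifs with hab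
    · subst hab
      have := LinearMap.congr_fun (eps_iot_self (R := K) (X := N) a) c
      simp only [LinearMap.add_apply, Module.End.mul_apply, Module.End.one_apply] at this
      exact eq_sub_of_add_eq this
    · have := LinearMap.congr_fun (eps_iot_ne (R := K) (X := N) hab) c
      simp only [LinearMap.add_apply, Module.End.mul_apply, LinearMap.zero_apply] at this
      rw [zero_sub]
      exact eq_neg_of_add_eq_zero_left this
  have h2 : eps K k (sng K Finset.univ u) = 0 := by
    simp [eps_single]
  rw [h1, h1 k i, h2]
  split_ifs <;> simp

lemma polRho_top (hN : RRep (⊥ : Submodule K N) E T G) (hg : Good T E) (hm : m ≠ 0)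
    (u : Pol m N) (hu : pw (E 1) u = u) (h0 : polRho E T (sng K Finset.univ u) = 0) : u = 0 := by
  have hS := hN.stepData
  have hs : IsSys (fun i => -T i) E :=
    IsSys.neg ⟨hN.antiT, fun a x => by rw [hN.E_mul, if_pos rfl], fun a i x => hN.T_E i a x,
      fun x => by simpa using hN.E_zero x⟩
  have hg' := hg.neg
  let M : Fin m → N →ₗ[K] N := fun i => mu (fun i => -T i) ∘ₗ iot K i ∘ₗ sng K Finset.univ
  have hsum : ∑ i, yv K i (pw (M i) u) = 0 := by
    have h1 := hS.antiT.derivation_mu (stepG (fun j => (pw (G j) : Module.End K (Pol m N))) 0)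
      (fun i => LinearMap.prodMap (yv K i) (yv K i))
      (fun i x => by rw [add_comm, stepTG_zero]; rfl)
      (fun i k x => by simp [hS.X_T, yv_comm i])
      (cmap (LinearMap.inr K _ _ ∘ₗ pw (E 1)) (sng K Finset.univ u)) (fun Q => by simp)
    have h0' := h0
    rw [polRho, stepRho_apply] at h0'
    rw [h0', map_zero] at h1
    have h2 := congrArg (LinearMap.snd K (Pol m N) (Pol m N)) h1
    rw [map_zero, map_sum] at h2
    rw [h2]
    refine Finset.sum_congr rfl fun i _ => ?_
    rw [LinearMap.prodMap_apply, LinearMap.snd_apply]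
    congr 1
    ext ν
    have h3 := mu_natural (T := polT T) (T' := fun i => -T i)
      ((Finsupp.lapply ν : Pol m N →ₗ[K] N) ∘ₗ LinearMap.snd K (Pol m N) (Pol m N))
      (fun i x => by simp) (iot K i (cmap (LinearMap.inr K (Pol m N) (Pol m N) ∘ₗ pw (E 1))
        (sng K Finset.univ u)))
    refine Eq.trans ?_ h3.symm
    simp only [pw_apply, M, LinearMap.comp_apply]
    congr 1
    have h4 := cmap_iot (((Finsupp.lapply ν : Pol m N →ₗ[K] N) ∘ₗ
      LinearMap.snd K (Pol m N) (Pol m N)) ∘ₗ LinearMap.inr K (Pol m N) (Pol m N) ∘ₗ pw (E 1)) i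
      (sng K Finset.univ u)
    rw [cmap_sng] at h4
    simp only [LinearMap.comp_apply, hu, LinearMap.inr_apply, LinearMap.snd_apply,
      Finsupp.lapply_apply] at h4
    rw [← h4, ← cmap_iot]
    rfl
  have hτ : ∀ i j v, yv K j (Finsupp.single 0 (M i v)) - yv K i (Finsupp.single 0 (M j v))
      ∈ bdry (fun i => -T i) E := by
    intro i j v
    have h1 := hs.dif_mem_bdry hm
      (Finsupp.single 0 (mu (fun i => -T i) (iot K j (iot K i (sng K Finset.univ v)))))
    have h2 : dif (fun i => -T i) (Finsupp.single 0
        (mu (fun i => -T i) (iot K j (iot K i (sng K Finset.univ v)))))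
        = yv K j (Finsupp.single 0 (M i v)) - yv K i (Finsupp.single 0 (M j v)) := by
      rw [dif_eq]
      simp only [pw_single, ← hs.anti.mu_eps]
      simp only [eps_iot_iot_top K, map_sub, Finsupp.single_sub, Finset.sum_sub_distrib,
        apply_ite (mu fun i => -T i), apply_ite (Finsupp.single (0 : Fin m →₀ ℕ)), map_zero,
        Finsupp.single_zero]
      rw [Finset.sum_eq_single j (fun b _ hb => by rw [if_neg hb, map_zero]) (by simp),
        Finset.sum_eq_single i (fun b _ hb => by rw [if_neg hb, map_zero]) (by simp)]
      simp [M]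
    rwa [h2] at h1
  have key := mccoy (bdry (fun i => -T i) E) (yv K) yv_comm yv_mem_bdry (hg'.sf hs)
    (fun i => Finsupp.lsingle 0 ∘ₗ M i) hτ u (by
      intro μ
      have h1 : (∑ i, if μ i = 0 then 0 else M i (u (μ - ex i))) = 0 := by
        have := DFunLike.congr_fun hsum μ
        rw [Finsupp.finsetSum_apply] at this
        simpa [yv_apply] using this
      have h2 := congrArg (Finsupp.lsingle (R := K) (0 : Fin m →₀ ℕ)) h1
      rw [map_sum, map_zero] at h2
      simp only [apply_ite (Finsupp.lsingle (R := K) (0 : Fin m →₀ ℕ)), map_zero] at h2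
      simp only [LinearMap.comp_apply]
      rw [h2]
      exact Submodule.zero_mem _)
  ext ν
  have hν : E 1 (u ν) = u ν := DFunLike.congr_fun hu ν
  refine hg'.eq_zero_of_ordProd hs hν (m - 1) (by omega) fun Q hQ => ?_
  obtain ⟨i, hi⟩ : ∃ i, Qᶜ = {i} := by
    rw [← Finset.card_eq_one, Finset.card_compl, Fintype.card_fin, hQ]; omega
  have hQi : Q = Finset.univ.erase i := by
    rw [← compl_compl Q, hi]; ext; simp
  obtain ⟨w, hw⟩ := key i ν
  have h1 := DFunLike.congr_fun hw 0
  rw [dif_zero_apply] at h1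
  have h2 := hs.ordProd_shift Q 1 (u ν)
  rw [hQ, show 1 + (m - 1) = m by omega, hν] at h2
  rw [← h2]
  have h3 : M i (u ν) = sg i Finset.univ • ordProd (fun i => -T i) Q (u ν) := by
    simp only [M, LinearMap.comp_apply, LinearMap.coe_single, sng]
    rw [iot_single, if_pos (Finset.mem_univ _), map_zsmul, mu_single, hQi]
  have h4 : E m (M i (u ν)) = 0 := by simpa using h1.symm
  rw [h3, map_zsmul] at h4
  have h5 := congrArg (fun x => sg i Finset.univ • x) h4
  simpa [smul_smul, sg_mul_self] using h5

lemma polRho_injective (hN : RRep (⊥ : Submodule K N) E T G) (hg : Good T E) (hm : m ≠ 0)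
    (c : Finset (Fin m) → Pol m N) (hc : cmap (pw (E 1)) c = c) (h0 : polRho E T c = 0) :
    c = 0 := by
  suffices H : ∀ k ≤ m, ∀ c : Finset (Fin m) → Pol m N, cmap (pw (E 1)) c = c →
      polRho E T c = 0 → (∀ I, I.card < m - k → c I = 0) → c = 0 from
    H m le_rfl c hc h0 (by simp)
  intro k
  induction k with
  | zero =>
    intro _ c hc h0 hI
    have : c = sng K Finset.univ (c Finset.univ) := by
      funext I
      rw [sng_apply]
      split_ifs with h
      · rw [h]
      · refine hI I ?_
        have := (Finset.card_lt_iff_ne_univ I).2 h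
        simpa using this
    rw [this] at h0
    have h1 : c Finset.univ = 0 := polRho_top hN hg hm _ (congrFun hc Finset.univ) h0
    exact this.trans (by rw [h1, map_zero])
  | succ k ih =>
    intro hk c hc h0 hI
    refine ih (by omega) c hc h0 fun I hIk => ?_
    by_cases hlt : I.card < m - (k + 1)
    · exact hI I hlt
    · obtain ⟨i, hi⟩ : ∃ i, i ∉ I := by
        by_contra hh
        push Not at hh
        rw [Finset.eq_univ_iff_forall.2 hh, Finset.card_univ, Fintype.card_fin] at hIk
        omega
      have h1 : eps K i c = 0 := by
        refine ih (by omega) _ (by rw [cmap_eps, hc]) ?_ fun J hJ => ?_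
        · exact (hN.stepData.rho_eps i c).trans (by rw [h0, map_zero])
        · rw [eps_apply]
          split_ifs with hiJ
          · rw [hI, smul_zero]
            have := Finset.card_erase_add_one hiJ
            omega
          · rfl
      have h2 := congrFun h1 (insert i I)
      rw [eps_apply, if_pos (Finset.mem_insert_self _ _), Finset.erase_insert hi] at h2
      have h5 := congrArg (fun x => sg i (insert i I) • x) h2
      simpa [smul_smul, sg_mul_self] using h5

end StepGood

section GoodStep

variable {K : Type} [Field K] {m n : ℕ} {N : Type} [AddCommGroup N] [Module K N]
variable {E : ℕ → Module.End K N} {T : Fin m → Module.End K N} {G : Fin n → Module.End K N}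

lemma RRep.isSys (h : RRep (⊥ : Submodule K N) E T G) : IsSys T E where
  anti := h.antiT
  idem a x := by rw [h.E_mul, if_pos rfl]
  shift a i x := h.T_E i a x
  zero x := by simpa using h.E_zero x

/-- Exactness of multiplication by the coordinates over polynomials. -/
lemma Good.mem_range_top (hs : IsSys T E) (hg : Good T E) (hm : m ≠ 0) (u v : Pol m (Pol m N))
    (hv : pw (pw (E m)) v = v)
    (huv : dif (fun i => pw (T i)) u + dif (yv K) v = 0) :
    ∃ w, dif (fun i => (pw (T i) : Module.End K (Pol m N))) w = v := by
  refine mem_range_of_slices (T := T) (fun s => Finsupp.lapply (R := K) s)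
    (fun s => Finsupp.lsingle (R := K) s) (by simp) (pol_slices v) fun s => ?_
  have hmem : ∀ s, pw (Finsupp.lapply (R := K) s) v ∈ bdry T E := by
    intro s
    refine hg.sf hs _ fun i => ?_
    refine mccoy (bdry T E) (yv K) yv_comm yv_mem_bdry (hg.sf hs) (fun i => yv K i) ?_
      (fun s => pw (Finsupp.lapply (R := K) s) v) ?_ i s
    · intro i j u
      rw [yv_comm, sub_self]; exact Submodule.zero_mem _
    · intro μ
      have h1 := congrArg (pw (Finsupp.lapply (R := K) μ)) huv
      rw [map_add, map_zero, pw_dif _ T _ (fun i x => by simp)] at h1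
      have h2 : pw (Finsupp.lapply (R := K) μ) (dif (yv K) v)
          = ∑ i, if μ i = 0 then 0 else yv K i (pw (Finsupp.lapply (R := K) (μ - ex i)) v) := by
        ext κ
        rw [pw_apply, dif_apply, map_sum, Finsupp.finsetSum_apply]
        refine Finset.sum_congr rfl fun i _ => ?_
        simp only [apply_ite (Finsupp.lapply (R := K) μ), map_zero, Finsupp.lapply_apply, yv_apply]
        split_ifs with h3 h4 h4
        · rfl
        · simp [yv_apply, h3]
        · rfl
        · simp [yv_apply, h3]
      rw [← h2, eq_neg_of_add_eq_zero_right h1]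
      exact Submodule.neg_mem _ (hs.dif_mem_bdry hm _)
  obtain ⟨w, hw⟩ := hmem s
  refine ⟨w, hw.trans ?_⟩
  conv_rhs => rw [← hv]
  ext κ; simp

lemma Good.stepT (hs : IsSys T E) (hg : Good T E) :
    Good (fun i => polT T i) (fun a => polE E a) := by
  intro a ha s hs1 hd
  set u := pw (LinearMap.fst K _ _) s with hu
  set v := pw (LinearMap.snd K _ _) s with hv
  have hu1 : pw (pw (E a)) u = u := by
    rw [hu]; conv_rhs => rw [← hs1]
    ext ν; simp
  have hv1 : pw (pw (E (a + 1))) v = v := by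
    rw [hv]; conv_rhs => rw [← hs1]
    ext ν; simp
  have hpair : ∀ t : Pol m (Pol m N × Pol m N), dif (fun i => polT T i) t = 
      pw (LinearMap.inl K _ _) (dif (fun i => pw (T i)) (pw (LinearMap.fst K _ _) t)
        + dif (yv K) (pw (LinearMap.snd K _ _) t))
      - pw (LinearMap.inr K _ _) (dif (fun i => pw (T i)) (pw (LinearMap.snd K _ _) t)) := by
    intro t
    simp only [dif_eq, map_add, map_sum, pw_yv, pw_comp, ← Finset.sum_add_distrib,
      ← Finset.sum_sub_distrib]
    refine Finset.sum_congr rfl fun i _ => ?_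
    rw [← map_add, ← map_sub]
    congr 1
    refine Finsupp.ext fun ν => ?_
    simp
  rw [hpair, ← hu, ← hv] at hd
  have hd1 : dif (fun i => pw (T i)) u + dif (yv K) v = 0 := by
    refine Finsupp.ext fun ν => ?_
    simpa using congrArg Prod.fst (DFunLike.congr_fun hd ν)
  have hd2 : dif (fun i => pw (T i)) v = 0 := by
    refine Finsupp.ext fun ν => ?_
    simpa using congrArg Prod.snd (DFunLike.congr_fun hd ν)
  obtain ⟨v₁, hv₁⟩ : ∃ w, dif (fun i => (pw (T i) : Module.End K (Pol m N))) w = v := by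
    by_cases h : a + 1 < m
    · exact hg.pol (a + 1) h v hv1 hd2
    · obtain rfl : m = a + 1 := by omega
      exact hg.mem_range_top hs (by omega) u v hv1 hd1
  set v₂ := pw (pw (E a)) v₁ with hv₂
  have hv₂' : dif (fun i => pw (T i)) v₂ = v := by
    rw [← hv1, ← hv₁, hv₂]
    exact (pw_dif₂ _ _ _ _ (fun i x => by ext; simp [hs.shift]) _).symm
  have hcomm : ∀ z : Pol m (Pol m N), dif (fun i => pw (T i)) (dif (yv K) z)
      = dif (yv K) (dif (fun i => pw (T i)) z) :=
    dif_comm fun i j x => pw_yv _ _ _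
  obtain ⟨u₁, hu₁⟩ := hg.pol a ha (u + dif (yv K) v₂) (by
      rw [map_add, hu1, pw_dif (yv K) (yv K) _ (fun i x => pw_yv _ _ _), hv₂]
      congr 2
      ext ν κ; simp [hs.idem]) (by rw [map_add, hcomm, hv₂', hd1])
  refine ⟨pw (LinearMap.inl K _ _) u₁ - pw (LinearMap.inr K _ _) v₂, ?_⟩
  rw [hpair]
  have e1 : pw (LinearMap.fst K (Pol m N) (Pol m N))
      (pw (LinearMap.inl K _ _) u₁ - pw (LinearMap.inr K _ _) v₂) = u₁ := by
    refine Finsupp.ext fun ν => ?_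
    simp
  have e2 : pw (LinearMap.snd K (Pol m N) (Pol m N))
      (pw (LinearMap.inl K _ _) u₁ - pw (LinearMap.inr K _ _) v₂) = -v₂ := by
    refine Finsupp.ext fun ν => ?_
    simp
  rw [e1, e2, hu₁, map_neg, map_neg, hv₂']
  refine Finsupp.ext fun ν => ?_
  simp [hu, hv]

lemma exists_pw_eq {X Y : Type*} [AddCommGroup X] [Module K X] [AddCommGroup Y] [Module K Y]
    (f : X →ₗ[K] Y) (z : Pol m Y) (hz : ∀ ν, z ν ∈ LinearMap.range f) : ∃ c, pw f c = z := by
  choose c hc using hz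
  refine ⟨∑ ν ∈ z.support, Finsupp.single ν (c ν), ?_⟩
  rw [map_sum]
  conv_rhs => rw [← Finsupp.sum_single z]
  exact Finset.sum_congr rfl fun ν _ => by rw [pw_single, hc]

variable {A' : Type} [AddCommGroup A'] [Module K A'] {T' : Fin m → Module.End K A'}
  {E' : ℕ → Module.End K A'}

theorem Good.step (hN : RRep (⊥ : Submodule K N) E T G) (hg : Good T E)
    (q : Pol m N × Pol m N →ₗ[K] A') (hq : Function.Surjective q)
    (hker : ∀ x, q x = 0 → x ∈ LinearMap.range (polRho E T)) (hρ : ∀ c, q (polRho E T c) = 0)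
    (hT : ∀ i x, q (polT T i x) = T' i (q x)) (hE : ∀ a x, q (polE E a x) = E' a (q x)) :
    Good T' E' := by
  intro a ha z hz hdz
  have hm : m ≠ 0 := by omega
  have hS := hN.stepData
  have hidem : ∀ x, polE E a (polE E a x) = polE E a x := fun x => by
    rw [hS.E_mul, if_pos rfl]
  obtain ⟨s, hs, hs1⟩ := exists_pol_lift q hq (polE E a) (E' a) hidem (hE a) z hz
  have hqT : ∀ t, pw q (dif (fun i => polT T i) t) = dif T' (pw q t) :=
    pw_dif _ _ _ hT
  obtain ⟨c₀, hc₀⟩ := exists_pw_eq (polRho E T) (dif (fun i => polT T i) s) fun ν => hker _ (by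
    have := DFunLike.congr_fun (hqT s) ν
    rwa [hs, hdz] at this)
  have hρE : ∀ c, polRho E T (DetPath.cmap (pw (E 1)) c) = polRho E T c := by
    intro c
    rw [polRho, stepRho_apply, stepRho_apply]
    congr 1
    funext I
    simp only [cmap_apply, LinearMap.comp_apply]
    congr 1
    ext ν; simp [hN.isSys.idem]
  set c := pw (DetPath.cmap (pw (E 1))) c₀ with hc_def
  have hc : pw (polRho E T) c = dif (fun i => polT T i) s := by
    rw [← hc₀, hc_def]; refine Finsupp.ext fun ν => ?_
    rw [pw_apply, pw_apply, hρE, pw_apply]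
  have hcE : pw (DetPath.cmap (pw (E 1))) c = c := by
    rw [hc_def]; refine Finsupp.ext fun ν => funext fun I => ?_
    ext κ
    simp [hN.isSys.idem]
  have hρd : ∀ c : Pol m (Finset (Fin m) → Pol m N), pw (polRho E T) (dif (eps K) c)
      = dif (fun i => polT T i) (pw (polRho E T) c) :=
    pw_dif _ _ _ fun i x => hS.rho_eps i x
  have hκ : dif (eps K) c = 0 := by
    refine Finsupp.ext fun ν => ?_
    refine polRho_injective hN hg hm _ ?_ ?_
    · have h1 := DFunLike.congr_fun (pw_dif (eps K) (eps K)
        (DetPath.cmap (pw (E 1) : Module.End K (Pol m N))) (fun i x => cmap_eps _ _ _) c) ν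
      rw [hcE] at h1
      exact h1
    · have h1 := DFunLike.congr_fun (hρd c) ν
      rw [hc, hS.antiT.dif_dif] at h1
      exact h1
  have hc0 : c 0 = 0 := by
    refine polRho_injective hN hg hm _ (DFunLike.congr_fun hcE 0) ?_
    have h1 := DFunLike.congr_fun hc 0
    rw [dif_zero_apply] at h1
    exact h1
  obtain ⟨c', hc'⟩ := koszul_exact c hκ (by rw [hc0]; rfl)
  have hqρ : pw q (pw (polRho E T) c') = 0 := by
    refine Finsupp.ext fun ν => ?_
    rw [pw_apply, pw_apply, hρ]; rfl
  have hd0 : dif (fun i => polT T i) (s - pw (polRho E T) c') = 0 := by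
    rw [map_sub, ← hρd, hc', hc, sub_self]
  have hd1 : dif (fun i => polT T i) (pw (polE E a) (s - pw (polRho E T) c')) = 0 := by
    rw [← pw_dif₂ _ _ (polE E (a + 1)) (polE E a) (fun i x => hS.T_E i a x), hd0, map_zero]
  obtain ⟨w, hw⟩ := hg.stepT hN.isSys a ha _ (by
    refine Finsupp.ext fun ν => ?_
    rw [pw_apply, pw_apply, hidem]) hd1
  refine ⟨pw q w, ?_⟩
  rw [← hqT, hw, map_sub, map_sub, hs1, hs]
  have h5 : pw q (pw (polE E a) (pw (polRho E T) c')) = 0 := by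
    refine Finsupp.ext fun ν => ?_
    rw [pw_apply, pw_apply, hE, pw_apply, hρ, map_zero]; rfl
  rw [h5, sub_zero]

end GoodStep

section GoodPath

variable {K : Type} [Field K] {m n : ℕ} {A : Type} [Ring A] [Algebra K A] {ev : ℕ → A}
  {l : Fin m → A}

lemma Rep.rrep {g : Fin n → A} (h : Rep ev l g) :
    RRep (⊥ : Submodule K A) (fun a => mr K (ev a)) (fun i => mr K (l i))
      (fun j => mr K (g j)) where
  E_rel := by simp
  T_rel := by simp
  G_rel := by simp
  E_zero := by simp [h.ev_zero]
  E_gt a ha x := by simp [h.ev_gt a ha]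
  E_mul a b x := by
    simp only [LinearMap.mulRight_apply, mul_assoc, h.ev_mul]
    by_cases hab : a = b
    · subst hab; simp
    · simp [hab, Ne.symm hab]
  sum_E x := by simp [h.sum_mul]
  T_E i a x := by simp [mul_assoc, h.l_ev]
  G_E i a x := by simp [mul_assoc, h.g_ev]
  antiT := h.isSys.anti
  antiG := by
    refine ⟨fun i => LinearMap.ext fun x => ?_, fun i j => LinearMap.ext fun x => ?_⟩
    · simp [mul_assoc, h.g_sq]
    · simp [mul_assoc, ← mul_add, h.g_anti]
  x_T k i j x := by
    have := congrArg (x * ·) (h.x_l k i j)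
    simp only [LinearMap.mulRight_apply, mul_add, add_mul, mul_assoc] at this ⊢
    rw [add_comm, ← this, add_comm]
  x_G k i j x := by
    have := congrArg (x * ·) (h.x_g k i j)
    simp only [LinearMap.mulRight_apply, mul_add, add_mul, mul_assoc] at this ⊢
    rw [add_comm, ← this, add_comm]

variable {g : Fin (n + 1) → A}

lemma Rep.tail (h : Rep ev l g) : Rep ev l (fun j : Fin n => g j.succ) where
  ev_zero := h.ev_zero
  ev_gt := h.ev_gt
  ev_mul := h.ev_mul
  sum_ev := h.sum_ev
  l_ev := h.l_ev
  g_ev j := h.g_ev j.succ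
  l_sq := h.l_sq
  l_anti := h.l_anti
  g_sq _ := h.g_sq _
  g_anti _ _ := h.g_anti _ _
  x_l _ _ _ := h.x_l _ _ _
  x_g _ _ _ := h.x_g _ _ _

/-- The central element attached to the first arrow of type `g`, as an element of the center. -/
def IsPA.xc (h : IsPA K ev l g) (i : Fin m) : Subalgebra.center K A :=
  ⟨l i * g 0 + g 0 * l i, Subalgebra.mem_center_iff.2 fun w => h.x_central i 0 w⟩

/-- Monomials in the central elements. -/
def IsPA.xpow (h : IsPA K ev l g) (ν : Fin m →₀ ℕ) : Subalgebra.center K A :=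
  ∏ i, h.xc i ^ ν i

lemma IsPA.xpow_add_ex (h : IsPA K ev l g) (ν : Fin m →₀ ℕ) (i : Fin m) :
    h.xpow (ν + ex i) = h.xpow ν * h.xc i := by
  simp only [IsPA.xpow, Finsupp.add_apply, pow_add, Finset.prod_mul_distrib]
  congr 1
  rw [Finset.prod_eq_single i]
  · simp [ex]
  · intro j _ hj; simp [ex, hj.symm]
  · simp

lemma IsPA.xpow_comm (h : IsPA K ev l g) (ν : Fin m →₀ ℕ) (w : A) :
    w * (h.xpow ν : A) = h.xpow ν * w :=
  Subalgebra.mem_center_iff.1 (h.xpow ν).2 w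

variable {A' : Type} [Ring A'] [Algebra K A'] {ev' : ℕ → A'} {l' : Fin m → A'} {g' : Fin n → A'}

/-- The extension of a map to polynomials in the central elements. -/
def IsPA.polMap (h : IsPA K ev l g) (j : A' →ₐ[K] A) : Pol m A' →ₗ[K] A :=
  Finsupp.lsum K fun ν => LinearMap.mulRight K (h.xpow ν : A) ∘ₗ j.toLinearMap

lemma IsPA.polMap_single (h : IsPA K ev l g) (j : A' →ₐ[K] A) (ν : Fin m →₀ ℕ) (w : A') :
    h.polMap j (Finsupp.single ν w) = j w * h.xpow ν := by
  simp [IsPA.polMap]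

lemma IsPA.polMap_yv (h : IsPA K ev l g) (j : A' →ₐ[K] A) (i : Fin m) (u : Pol m A') :
    h.polMap j (yv K i u) = h.polMap j u * (l i * g 0 + g 0 * l i) := by
  induction u using Finsupp.induction_linear with
  | zero => simp
  | add u v hu hv => simp only [map_add, add_mul, hu, hv]
  | single ν w =>
    rw [yv_single, h.polMap_single, h.polMap_single, h.xpow_add_ex, mul_assoc]
    rfl

lemma IsPA.polMap_pw (h : IsPA K ev l g) (j : A' →ₐ[K] A) (w : A') (u : Pol m A') :
    h.polMap j (pw (mr K w) u) = h.polMap j u * j w := by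
  induction u using Finsupp.induction_linear with
  | zero => simp
  | add u v hu hv => simp only [map_add, add_mul, hu, hv]
  | single ν x =>
    rw [pw_single, h.polMap_single, h.polMap_single, LinearMap.mulRight_apply, map_mul, mul_assoc,
      mul_assoc, h.xpow_comm]

/-- The presentation map of a path algebra over the path algebra with one arrow less. -/
def IsPA.pres (h : IsPA K ev l g) (j : A' →ₐ[K] A) : Pol m A' × Pol m A' →ₗ[K] A :=
  h.polMap j ∘ₗ LinearMap.fst K _ _ + mr K (g 0) ∘ₗ h.polMap j ∘ₗ LinearMap.snd K _ _

lemma IsPA.pres_apply (h : IsPA K ev l g) (j : A' →ₐ[K] A) (x : Pol m A' × Pol m A') :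
    h.pres j x = h.polMap j x.1 + h.polMap j x.2 * g 0 := rfl

lemma step_generation (h' : IsPA K ev' l' g') (P : Submodule K (Pol m A' × Pol m A'))
    (h1 : (Finsupp.single 0 1, 0) ∈ P)
    (hE : ∀ a, ∀ x ∈ P, polE (fun a => mr K (ev' a)) a x ∈ P)
    (hT : ∀ i, ∀ x ∈ P, polT (fun i => mr K (l' i)) i x ∈ P)
    (hG : ∀ j, ∀ x ∈ P, stepG (fun j => (pw (mr K (g' j)) : Module.End K (Pol m A'))) j x ∈ P) :
    P = ⊤ := by
  have hw : ∀ w : A', (Finsupp.single 0 w, 0) ∈ P := by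
    let P' : Submodule K A' := P.comap (LinearMap.inl K _ _ ∘ₗ Finsupp.lsingle 0)
    intro w
    refine h'.right_induction P' h1 ?_ ?_ ?_ w
    · intro a w hw
      simpa [P'] using hE a _ hw
    · intro a w hw
      simpa [P'] using hT a _ hw
    · intro a w hw
      simpa [P'] using hG a.succ _ hw
  have hX : ∀ i u, (u, 0) ∈ P → (yv K i u, 0) ∈ P := by
    intro i u hu
    have := P.add_mem (hT i _ (hG 0 _ hu)) (hG 0 _ (hT i _ hu))
    rw [stepTG_zero] at this
    simpa using this
  have hν : ∀ (μ ν : Fin m →₀ ℕ) (w : A'), (Finsupp.single ν w, 0) ∈ P →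
      (Finsupp.single (ν + μ) w, 0) ∈ P := by
    intro μ
    induction μ using Finsupp.induction_linear with
    | zero => intro ν w h; simpa using h
    | add a b ha hb => intro ν w h; rw [← add_assoc]; exact hb _ _ (ha _ _ h)
    | single i k =>
      induction k with
      | zero => intro ν w h; simpa using h
      | succ k ih =>
        intro ν w h
        have := hX i _ (ih ν w h)
        rw [yv_single] at this
        rwa [Finsupp.single_add, ← add_assoc]
  have hu : ∀ u : Pol m A', (u, 0) ∈ P := by
    intro u
    induction u using Finsupp.induction_linear with
    | zero => exact P.zero_mem
    | add u v hu hv => simpa using P.add_mem hu hv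
    | single ν w => simpa using hν ν 0 w (hw w)
  refine eq_top_iff.2 fun x _ => ?_
  have := P.add_mem (hu x.1) (hG 0 _ (hu x.2))
  simpa using this

theorem IsPA.good_succ (h : IsPA K ev l g) (h' : IsPA K ev' l' g')
    (hg : Good (fun i => mr K (l' i)) (fun a => mr K (ev' a))) :
    Good (fun i => mr K (l i)) (fun a => mr K (ev a)) := by
  obtain ⟨j, hje, hjl, hjg⟩ := h'.lift A ev l _ h.rep.tail
  have hN := h'.rep.rrep (K := K)
  have hqE : ∀ a x, h.pres j (polE (fun a => mr K (ev' a)) a x) = h.pres j x * ev a := by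
    intro a x
    simp only [h.pres_apply, stepE_apply, h.polMap_pw, hje, add_mul, mul_assoc, h.rep.g_ev]
  have hqT : ∀ i x, h.pres j (polT (fun i => mr K (l' i)) i x) = h.pres j x * l i := by
    intro i x
    simp only [h.pres_apply, stepT_apply, map_add, map_neg, h.polMap_pw, h.polMap_yv, hjl]
    noncomm_ring
  have hqG : ∀ k x, h.pres j (stepG (fun j => (pw (mr K (g' j)) : Module.End K (Pol m A'))) k x)
      = h.pres j x * g k := by
    intro k x
    refine Fin.cases ?_ (fun k => ?_) k
    · simp [h.pres_apply, add_mul, mul_assoc, h.rep.g_sq]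
    · simp only [h.pres_apply, stepG_succ, map_neg, h.polMap_pw, hjg, add_mul, mul_assoc]
      rw [eq_neg_of_add_eq_zero_left (h.rep.g_anti 0 k.succ), mul_neg, neg_mul, mul_assoc]
  have hρ : ∀ c, h.pres j (polRho (fun a => mr K (ev' a)) (fun i => mr K (l' i)) c) = 0 := by
    intro c
    rw [polRho, stepRho_apply, mu_natural (T' := fun i => mr K (l i)) (h.pres j) hqT]
    rw [mu_apply]
    refine Finset.sum_eq_zero fun Q _ => ?_
    simp only [cmap_apply, LinearMap.comp_apply, LinearMap.inr_apply, h.pres_apply, h.polMap_pw,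
      hje, mul_assoc, ← h.rep.g_ev 0 0, h.rep.ev_zero, mul_zero, map_zero, add_zero]
  obtain ⟨hker, hsurj⟩ := h.presentation hN.stepData.step (h.pres j) (Finsupp.single 0 1, 0) hqE hqT
    hqG (by rintro _ ⟨c, rfl⟩; exact hρ c) (by simp [h.pres_apply, h.polMap_single, IsPA.xpow])
    (fun P _ h1 h2 h3 h4 => step_generation h' P h1 h2 h3 h4)
  exact hg.step hN (h.pres j) hsurj hker hρ hqT hqE

end GoodPath

theorem good_path (K : Type) [Field K] (m n : ℕ) :
    Good (fun i => mr K (pgen K m n (PGen.lam i))) (fun a => mr K (pev K m n a)) := by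
  induction n with
  | zero => exact (isPA_path K m 0).good_base
  | succ n ih => exact (isPA_path K m (n + 1)).good_succ (isPA_path K m n) ih

/-! ### The cokernel of the map of exterior algebras -/

section Coker

variable {R : Type*} [CommRing R] {m n : ℕ} (x : Fin m → Fin n → R)

/-- Exterior multiplication by the image of a basis vector. -/
def gop (j : Fin n) : Module.End R (Finset (Fin m) → R) := ∑ i, x i j • eps R i

lemma gop_apply (j : Fin n) (c : Finset (Fin m) → R) : gop x j c = ∑ i, x i j • eps R i c := by
  simp [gop]

lemma gop_swap (j k : Fin n) (c : Finset (Fin m) → R) :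
    gop x j (gop x k c) = - gop x k (gop x j c) := by
  simp only [gop_apply, map_sum, map_smul, Finset.smul_sum]
  rw [Finset.sum_comm, ← Finset.sum_neg_distrib]
  refine Finset.sum_congr rfl fun i _ => ?_
  rw [← Finset.sum_neg_distrib]
  refine Finset.sum_congr rfl fun i' _ => ?_
  rw [antiSq_eps.swap_apply i' i, smul_neg, smul_neg, neg_neg, smul_comm]

lemma gop_sq (j : Fin n) (c : Finset (Fin m) → R) : gop x j (gop x j c) = 0 := by
  simp only [gop_apply, map_sum, map_smul, Finset.smul_sum]
  refine sum_sum_alt _ (fun i => ?_) fun i k => ?_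
  · rw [antiSq_eps.sq_apply, smul_zero, smul_zero]
  · rw [antiSq_eps.swap_apply i k, smul_neg, smul_neg, smul_comm, add_neg_cancel]

lemma antiSq_gop : AntiSq (gop x) := by
  refine ⟨fun i => LinearMap.ext fun c => gop_sq x i c, fun i j => LinearMap.ext fun c => ?_⟩
  rw [LinearMap.add_apply, Module.End.mul_apply, Module.End.mul_apply, gop_swap]
  exact neg_add_cancel _

lemma eps_add_iot (i k : Fin m) (c : Finset (Fin m) → R) :
    eps R i (iot R k c) + iot R k (eps R i c) = if i = k then c else 0 := by
  split_ifs with h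
  · subst h
    exact LinearMap.congr_fun (eps_iot_self (R := R) (X := R) i) c
  · exact LinearMap.congr_fun (eps_iot_ne (R := R) (X := R) h) c

lemma iot_add_gop (i : Fin m) (j : Fin n) (c : Finset (Fin m) → R) :
    iot R i (gop x j c) + gop x j (iot R i c) = x i j • c := by
  simp only [gop_apply, map_sum, map_smul, ← Finset.sum_add_distrib, ← smul_add]
  rw [Finset.sum_eq_single i]
  · rw [add_comm, eps_add_iot, if_pos rfl]
  · intro k _ hk
    rw [add_comm, eps_add_iot, if_neg hk, smul_zero]
  · simp

lemma degp_gop (r : ℕ) (j : Fin n) (c : Finset (Fin m) → R) :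
    degp (R := R) (r + 1) (gop x j c) = gop x j (degp (R := R) r c) := by
  simp only [gop_apply, map_sum, map_smul, degp_eps]

/-- The image of the map of exterior algebras, in coordinates. -/
def relMap : (Finset (Fin n) → R) →ₗ[R] (Finset (Fin m) → R) :=
  mu (gop x) ∘ₗ cmap (sng R ∅)

lemma relMap_apply (c : Finset (Fin n) → R) : relMap x c = mu (gop x) (cmap (sng R ∅) c) := rfl

/-- The submodule of relations. -/
def relJ : Submodule R (Finset (Fin m) → R) := LinearMap.range (relMap x)

lemma relMap_eps (j : Fin n) (c : Finset (Fin n) → R) :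
    relMap x (eps R j c) = gop x j (relMap x c) := by
  rw [relMap_apply, cmap_eps, (antiSq_gop x).mu_eps, relMap_apply]

lemma relMap_iot (i : Fin m) (c : Finset (Fin n) → R) :
    iot R i (relMap x c) = relMap x (∑ j, x i j • iot R j c) := by
  rw [relMap_apply, (antiSq_gop x).derivation_mu (iot R i)
    (fun j => (x i j • LinearMap.id : Module.End R (Finset (Fin m) → R)))
    (fun j c => iot_add_gop x i j c) (by simp) _ (fun Q => by simp [iot_single])]
  simp only [map_sum, map_smul, relMap_apply, cmap_iot]
  rfl

lemma relMap_degp (r : ℕ) (c : Finset (Fin n) → R) :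
    degp (R := R) r (relMap x c) = relMap x (degp (R := R) r c) := by
  simp only [relMap_apply, mu_apply, map_sum]
  refine Finset.sum_congr rfl fun Q _ => ?_
  simp only [cmap_apply, degp_apply]
  have h0 : ∀ s : R, degp (R := R) 0 (sng R (∅ : Finset (Fin m)) s) = sng R ∅ s := by
    intro s
    funext I
    rw [degp_apply, sng_apply]
    by_cases hI : I = ∅ <;> simp [hI]
  have h1 : ∀ s : R, degp (R := R) Q.card (ordProd (gop x) Q (sng R ∅ s))
      = ordProd (gop x) Q (sng R ∅ s) := by
    intro s
    have := ordProd_shift (E := fun a => (degp a : Module.End R (Finset (Fin m) → R)))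
      (T := gop x) (fun a i c => degp_gop x a i c) Q 0 (sng R ∅ s)
    rwa [h0, zero_add] at this
  split_ifs with h
  · rw [← h, h1]
  · rw [← h1]
    funext I
    simp only [degp_apply, map_zero, Pi.zero_apply]
    split_ifs <;> first | rfl | omega

lemma gop_mem (j : Fin n) (c : Finset (Fin m) → R) (hc : c ∈ relJ x) : gop x j c ∈ relJ x := by
  obtain ⟨c, rfl⟩ := hc; exact ⟨_, relMap_eps x j c⟩

lemma iot_mem (i : Fin m) (c : Finset (Fin m) → R) (hc : c ∈ relJ x) : iot R i c ∈ relJ x := by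
  obtain ⟨c, rfl⟩ := hc; exact ⟨_, (relMap_iot x i c).symm⟩

lemma degp_mem (r : ℕ) (c : Finset (Fin m) → R) (hc : c ∈ relJ x) :
    degp (R := R) r c ∈ relJ x := by
  obtain ⟨c, rfl⟩ := hc; exact ⟨_, (relMap_degp x r c).symm⟩

lemma sng_empty_mem (s : R) : sng R ∅ s ∈ relJ x :=
  ⟨sng R ∅ s, by rw [relMap_apply, cmap_sng]; exact mu_single_empty _ _⟩

lemma degp_zero_mem (c : Finset (Fin m) → R) : degp (R := R) 0 c ∈ relJ x := by
  have : degp (R := R) 0 c = sng R ∅ (c ∅) := by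
    funext I
    rw [degp_apply, sng_apply]
    by_cases hI : I = ∅ <;> simp [hI]
  rw [this]; exact sng_empty_mem x _

/-- A map compatible with the operators which kills the unit kills all relations. -/
lemma relJ_le_ker {N : Type*} [AddCommGroup N] [Module R N] (f : (Finset (Fin m) → R) →ₗ[R] N)
    (G : Fin n → Module.End R N) (hG : ∀ j c, f (gop x j c) = G j (f c))
    (h0 : f (sng R ∅ 1) = 0) : relJ x ≤ LinearMap.ker f := by
  rintro _ ⟨c, rfl⟩
  rw [LinearMap.mem_ker, relMap_apply, mu_natural f hG]
  have : (fun Q => f (cmap (sng R (∅ : Finset (Fin m))) c Q)) = 0 := by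
    funext Q
    have h1 : cmap (sng R (∅ : Finset (Fin m))) c Q = c Q • sng R ∅ 1 := by
      rw [cmap_apply, ← map_smul, smul_eq_mul, mul_one]
    rw [h1, map_smul, h0, smul_zero]; rfl
  rw [this, map_zero]

/-- The cokernel of the map of exterior algebras. -/
abbrev Cok : Type _ := (Finset (Fin m) → R) ⧸ relJ x

/-- The contraction operators on the cokernel. -/
def cokL (i : Fin m) : Module.End R (Cok x) := (relJ x).mapQ (relJ x) (iot R i) (iot_mem x i)

/-- The multiplication operators on the cokernel. -/
def cokG (j : Fin n) : Module.End R (Cok x) := (relJ x).mapQ (relJ x) (gop x j) (gop_mem x j)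

/-- The projections on the cokernel. -/
def cokE (a : ℕ) : Module.End R (Cok x) := (relJ x).mapQ (relJ x) (degp a) (degp_mem x a)

@[simp] lemma cokL_mk (i : Fin m) (c : Finset (Fin m) → R) :
    cokL x i ((relJ x).mkQ c) = (relJ x).mkQ (iot R i c) := rfl

@[simp] lemma cokG_mk (j : Fin n) (c : Finset (Fin m) → R) :
    cokG x j ((relJ x).mkQ c) = (relJ x).mkQ (gop x j c) := rfl

@[simp] lemma cokE_mk (a : ℕ) (c : Finset (Fin m) → R) :
    cokE x a ((relJ x).mkQ c) = (relJ x).mkQ (degp (R := R) a c) := rfl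

lemma cok_ext {N : Type*} [AddCommGroup N] [Module R N] {f g : Cok x →ₗ[R] N}
    (h : ∀ c, f ((relJ x).mkQ c) = g ((relJ x).mkQ c)) : f = g :=
  Submodule.linearMap_qext _ (LinearMap.ext h)

lemma cokL_add_cokG (i : Fin m) (j : Fin n) :
    cokL x i * cokG x j + cokG x j * cokL x i = algebraMap R _ (x i j) := by
  refine cok_ext x fun c => ?_
  simp only [LinearMap.add_apply, Module.End.mul_apply, cokL_mk, cokG_mk, ← map_add,
    iot_add_gop, Module.algebraMap_end_apply, map_smul]

lemma sum_degp {X : Type*} [AddCommGroup X] [Module R X] (c : Finset (Fin m) → X) :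
    ∑ a ∈ Finset.range (m + 1), degp (R := R) a c = c := by
  funext I
  rw [Finset.sum_apply]
  simp only [degp_apply]
  rw [Finset.sum_ite_eq, if_pos]
  have := Finset.card_le_univ I
  rw [Fintype.card_fin] at this
  exact Finset.mem_range.2 (by omega)

lemma cok_rep : Rep (cokE x) (cokL x) (cokG x) where
  ev_zero := cok_ext x fun c => (Submodule.Quotient.mk_eq_zero _).2 (degp_zero_mem x c)
  ev_gt a ha := cok_ext x fun c => by
    rw [cokE_mk]
    rw [LinearMap.zero_apply]
    convert map_zero (relJ x).mkQ
    funext I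
    have := Finset.card_le_univ I
    rw [Fintype.card_fin] at this
    rw [degp_apply, if_neg (by omega)]; rfl
  ev_mul a b := cok_ext x fun c => by
    split_ifs with h
    · subst h
      rw [Module.End.mul_apply, cokE_mk, cokE_mk, degp_idem]
    · rw [Module.End.mul_apply, cokE_mk, cokE_mk]
      have h0 : degp (R := R) a (degp (R := R) b c) = 0 := by
        funext I
        simp only [degp_apply, Pi.zero_apply]
        split_ifs <;> first | rfl | omega
      rw [h0, map_zero, LinearMap.zero_apply]
  sum_ev := cok_ext x fun c => by
    rw [LinearMap.sum_apply]
    simp only [cokE_mk, ← map_sum, sum_degp]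
    rfl
  l_ev i a := cok_ext x fun c => by
    simp [-Submodule.mkQ_apply, degp_iot]
  g_ev j a := cok_ext x fun c => by
    simp [-Submodule.mkQ_apply, degp_gop]
  l_sq i := cok_ext x fun c => by
    simp [-Submodule.mkQ_apply, antiSq_iot.sq_apply]
  l_anti i j := cok_ext x fun c => by
    simp [-Submodule.mkQ_apply, antiSq_iot.swap_apply i j]
  g_sq i := cok_ext x fun c => by
    simp [-Submodule.mkQ_apply, gop_sq]
  g_anti i j := cok_ext x fun c => by
    simp [-Submodule.mkQ_apply, gop_swap x i j]
  x_l k i j := by rw [cokL_add_cokG, Algebra.commutes]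
  x_g k i j := by rw [cokL_add_cokG, Algebra.commutes]

end Coker

/-! ### The cokernel as a cyclic module -/

section Theta

lemma mu_degp {R : Type*} [CommRing R] {N : Type*} [AddCommGroup N] [Module R N] {k : ℕ}
    {T : Fin k → Module.End R N} {E : ℕ → Module.End R N}
    (hs : ∀ a i x, E (a + 1) (T i x) = T i (E a x))
    (ho : ∀ a b x, E a (E b x) = if a = b then E a x else 0) (c : Finset (Fin k) → N)
    (hc : ∀ Q, E 0 (c Q) = c Q) (r : ℕ) : E r (mu T c) = mu T (degp (R := R) r c) := by
  simp only [mu_apply, map_sum]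
  refine Finset.sum_congr rfl fun Q _ => ?_
  have h1 : ordProd T Q (c Q) = E Q.card (ordProd T Q (c Q)) := by
    conv_lhs => rw [← hc, ← ordProd_shift hs, zero_add]
  rw [h1, ho, degp_apply]
  by_cases h : r = Q.card
  · rw [if_pos h, if_pos h.symm, h, ← h1]
  · rw [if_neg h, if_neg (fun h' => h h'.symm), map_zero]

variable (R : Type*) [CommRing R] {m : ℕ}

lemma exists_sign_ordProd_iot (Q : Finset (Fin m)) : ∀ P : Finset (Fin m), Disjoint Q P →
    ∃ e : ℤ, e * e = 1 ∧ ∀ s : R, ordProd (iot R) Q (sng R (Q ∪ P) s) = e • sng R P s := by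
  induction Q using Finset.induction_on_min with
  | empty => intro P _; exact ⟨1, rfl, fun s => by simp [ordProd_empty]⟩
  | insert q Q hq ih =>
    intro P hP
    rw [Finset.disjoint_insert_left] at hP
    have hqQ : q ∉ Q := fun hqQ => lt_irrefl _ (hq q hqQ)
    obtain ⟨e, he, h⟩ := ih (insert q P) (Finset.disjoint_insert_right.2 ⟨hqQ, hP.2⟩)
    refine ⟨e * sg q (insert q P), ?_, fun s => ?_⟩
    · rw [mul_mul_mul_comm, he, sg_mul_self, mul_one]
    · rw [ordProd_insert _ hq, Module.End.mul_apply, Finset.insert_union,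
        ← Finset.union_insert, h, map_zsmul, LinearMap.single_apply, iot_single,
        if_pos (Finset.mem_insert_self _ _), Finset.erase_insert hP.1, mul_smul]
      rfl

/-- The duality exchanging exterior multiplication and contraction. -/
def star : Module.End R (Finset (Fin m) → R) :=
  mu (iot R) ∘ₗ cmap (sng R (Finset.univ : Finset (Fin m)))

lemma star_eps (i : Fin m) (c : Finset (Fin m) → R) :
    star R (eps R i c) = iot R i (star R c) := by
  simp only [star, LinearMap.comp_apply]
  rw [cmap_eps, antiSq_iot.mu_eps]

lemma star_iot (i : Fin m) (c : Finset (Fin m) → R) :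
    star R (iot R i c) = eps R i (star R c) := by
  simp only [star, LinearMap.comp_apply]
  rw [antiSq_iot.derivation_mu (eps R i)
    (fun j => if i = j then LinearMap.id else 0)
    (fun j c => by rw [eps_add_iot]; split_ifs <;> rfl)
    (fun j k c => by split_ifs <;> simp) _ (fun Q => by simp [eps_single])]
  rw [Finset.sum_eq_single i]
  · rw [if_pos rfl, cmap_iot]; rfl
  · intro j _ hj; rw [if_neg (Ne.symm hj)]; rfl
  · simp

/-- The projections in the opposite degrees. -/
def codeg {N : Type*} [AddCommGroup N] [Module R N] (m : ℕ) (E : ℕ → Module.End R N) (a : ℕ) :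
    Module.End R N := if a ≤ m then E (m - a) else 0

variable {R} in
lemma codeg_shift {N : Type*} [AddCommGroup N] [Module R N] {E : ℕ → Module.End R N}
    {T : Fin m → Module.End R N} (hT : ∀ a i x, E a (T i x) = T i (E (a + 1) x))
    (h0 : ∀ i x, T i (E 0 x) = 0) (a : ℕ) (i : Fin m) (x : N) :
    codeg R m E (a + 1) (T i x) = T i (codeg R m E a x) := by
  unfold codeg
  by_cases h : a + 1 ≤ m
  · rw [if_pos h, if_pos (by omega), hT]
    congr 3; omega
  · rw [if_neg h]
    by_cases h' : a ≤ m
    · rw [if_pos h', show m - a = 0 by omega, h0]; rfl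
    · rw [if_neg h', LinearMap.zero_apply, LinearMap.zero_apply, map_zero]

variable {R} in
lemma codeg_orth {N : Type*} [AddCommGroup N] [Module R N] {E : ℕ → Module.End R N}
    (hE : ∀ a b x, E a (E b x) = if a = b then E a x else 0) (a b : ℕ) (x : N) :
    codeg R m E a (codeg R m E b x) = if a = b then codeg R m E a x else 0 := by
  unfold codeg
  by_cases h : a ≤ m <;> by_cases h' : b ≤ m
  · simp only [h, h', if_true, hE]
    by_cases hab : a = b
    · simp [hab]
    · rw [if_neg hab, if_neg (by omega)]
  · rw [if_neg h', LinearMap.zero_apply, map_zero, if_neg (by omega)]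
  · rw [if_neg h, LinearMap.zero_apply, if_neg (by omega)]
  · rw [if_neg h]
    simp

lemma degp_orth {X : Type*} [AddCommGroup X] [Module R X] {k : ℕ} (a b : ℕ)
    (c : Finset (Fin k) → X) :
    degp (R := R) a (degp (R := R) b c) = if a = b then degp (R := R) a c else 0 := by
  split_ifs with h
  · rw [h, degp_idem]
  · funext I
    simp only [degp_apply, Pi.zero_apply]
    split_ifs <;> first | rfl | omega

lemma iot_degp_zero (i : Fin m) (c : Finset (Fin m) → R) :
    iot R i (degp (R := R) 0 c) = 0 := by
  funext I
  rw [iot_apply]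
  split_ifs
  · rfl
  · rw [degp_apply, if_neg (by simp)]
    exact smul_zero _

lemma star_degp (r : ℕ) (c : Finset (Fin m) → R) :
    star R (degp (R := R) r c) = codeg R m (fun a => degp (R := R) a) r (star R c) := by
  simp only [star, LinearMap.comp_apply]
  rw [cmap_degp]
  refine (mu_degp (codeg_shift (fun a i x => degp_iot a i x) (fun i x => iot_degp_zero R i x))
    (codeg_orth (fun a b x => degp_orth R a b x)) _ (fun Q => ?_) r).symm
  unfold codeg
  rw [if_pos (Nat.zero_le _)]
  funext I
  rw [degp_apply]
  by_cases hI : I = Finset.univ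
  · rw [if_pos (by simp [hI])]
  · rw [cmap_apply, sng_apply, if_neg hI, ite_self]

lemma exists_star_top : ∃ e : ℤ, e * e = 1 ∧
    star R (sng R (Finset.univ : Finset (Fin m)) 1) = e • (sng R (∅ : Finset (Fin m)) 1 :
      Finset (Fin m) → R) := by
  obtain ⟨e, he, h⟩ := exists_sign_ordProd_iot R (Finset.univ : Finset (Fin m)) ∅
    (Finset.disjoint_empty_right _)
  refine ⟨e, he, ?_⟩
  rw [star, LinearMap.comp_apply, cmap_sng]
  refine (mu_single _ _ _).trans ?_
  rw [← h 1, Finset.union_empty]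

/-- Everything is generated from the top form by contraction. -/
lemma car_induction {P : Submodule R (Finset (Fin m) → R)}
    (h1 : sng R Finset.univ 1 ∈ P) (hi : ∀ i, ∀ c ∈ P, iot R i c ∈ P) : P = ⊤ := by
  have h2 : ∀ Q : Finset (Fin m), ∀ c ∈ P, ordProd (iot R) Q c ∈ P := by
    intro Q
    induction Q using Finset.induction_on_min with
    | empty => intro c hc; simpa [ordProd_empty] using hc
    | insert q Q hq ih =>
      intro c hc
      rw [ordProd_insert _ hq]
      exact hi _ _ (ih c hc)
  have h3 : ∀ I : Finset (Fin m), sng R I 1 ∈ P := by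
    intro I
    obtain ⟨e, he, h⟩ := exists_sign_ordProd_iot R Iᶜ I disjoint_compl_left
    have h4 := h2 Iᶜ _ h1
    have h5 : (Finset.univ : Finset (Fin m)) = Iᶜ ∪ I := by
      rw [Finset.union_comm, Finset.union_compl]
    rw [h5, h] at h4
    have h6 : sng R I 1 = e • (e • sng R I (1 : R)) := by rw [smul_smul, he, one_smul]
    rw [h6]
    exact zsmul_mem h4 e
  refine Submodule.eq_top_iff'.2 fun c => ?_
  have h7 : c = ∑ I, c I • sng R I (1 : R) := by
    funext J
    simp [Pi.single_apply]
  rw [h7]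
  exact P.sum_mem fun I _ => P.smul_mem _ (h3 I)

variable {R}
variable {n : ℕ} {A : Type*} [Ring A] [Algebra R A] {ev : ℕ → A} {l : Fin m → A} {g : Fin n → A}

variable (R) in
/-- The map from the exterior algebra to the left ideal generated by the last idempotent. -/
def theta (l : Fin m → A) (t : A) : (Finset (Fin m) → R) →ₗ[R] A :=
  mu (fun i => LinearMap.mulLeft R (l i)) ∘ₗ
    cmap (LinearMap.toSpanSingleton R A t) ∘ₗ star R

lemma Rep.antiSq_left (h : Rep ev l g) : AntiSq (fun i => LinearMap.mulLeft R (l i)) := by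
  refine ⟨fun i => LinearMap.ext fun c => ?_, fun i j => LinearMap.ext fun c => ?_⟩
  · simp [← mul_assoc, h.l_sq]
  · simp [← mul_assoc, ← add_mul, h.l_anti]

lemma Rep.theta_iot (h : Rep ev l g) (t : A) (i : Fin m) (c : Finset (Fin m) → R) :
    theta R l t (iot R i c) = l i * theta R l t c := by
  simp only [theta, LinearMap.comp_apply]
  rw [star_iot, cmap_eps, h.antiSq_left.mu_eps]
  rfl

lemma Rep.g_ev_top (h : Rep ev l g) (j : Fin n) : g j * ev m = 0 := by
  rw [h.g_ev, h.ev_gt _ (Nat.lt_succ_self m), zero_mul]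

variable {x : Fin m → Fin n → R}

lemma Rep.theta_gop (h : Rep ev l g) (hx : ∀ i j, algebraMap R A (x i j) = l i * g j + g j * l i)
    (j : Fin n) (c : Finset (Fin m) → R) :
    theta R l (ev m) (gop x j c) = g j * theta R l (ev m) c := by
  simp only [theta, LinearMap.comp_apply]
  have := h.antiSq_left.derivation_mu (R := R) (LinearMap.mulLeft R (g j))
    (fun i => x i j • LinearMap.id)
    (fun i w => by
      rw [LinearMap.mulLeft_apply, LinearMap.mulLeft_apply, LinearMap.mulLeft_apply,
        LinearMap.mulLeft_apply, LinearMap.smul_apply, LinearMap.id_apply, Algebra.smul_def, hx,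
        add_mul, mul_assoc, mul_assoc, add_comm]) (fun i k w => by simp)
    (cmap (LinearMap.toSpanSingleton R A (ev m)) (star R c)) (fun Q => by
      simp [h.g_ev_top])
  rw [LinearMap.mulLeft_apply] at this
  rw [this]
  simp only [gop_apply, map_sum, map_smul, star_eps, cmap_iot]
  rfl

lemma Rep.theta_degp (h : Rep ev l g) (r : ℕ) (c : Finset (Fin m) → R) :
    theta R l (ev m) (degp (R := R) r c) = ev r * theta R l (ev m) c := by
  have hE : ∀ k, codeg R m (fun a => LinearMap.mulLeft R (ev a)) k (theta R l (ev m) c)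
      = mu (fun i => LinearMap.mulLeft R (l i))
        (degp (R := R) k (cmap (LinearMap.toSpanSingleton R A (ev m)) (star R c))) := by
    refine mu_degp (codeg_shift (fun a i x => ?_) (fun i x => ?_)) (codeg_orth fun a b x => ?_) _
      (fun Q => ?_)
    · simp only [LinearMap.mulLeft_apply, ← mul_assoc, h.l_ev]
    · simp [h.ev_zero]
    · simp only [LinearMap.mulLeft_apply, ← mul_assoc, h.ev_mul]
      split_ifs <;> simp
    · simp [codeg, h.ev_mul]
  by_cases hr : r ≤ m
  · have h1 := hE (m - r)
    rw [codeg, if_pos (Nat.sub_le _ _), LinearMap.mulLeft_apply, Nat.sub_sub_self hr] at h1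
    rw [h1, theta, LinearMap.comp_apply, LinearMap.comp_apply, star_degp, codeg, if_pos hr,
      cmap_degp]
  · rw [h.ev_gt r (by omega), zero_mul, theta, LinearMap.comp_apply, LinearMap.comp_apply,
      star_degp, codeg, if_neg hr, LinearMap.zero_apply, map_zero, map_zero]

lemma Rep.exists_theta_swap (h : Rep ev l g) :
    ∃ f : (Finset (Fin m) → R) →ₗ[R] A, ∀ k c, f c * l k = l k * theta R l (ev m) c := by
  refine ⟨mu (fun i => LinearMap.mulLeft R (l i)) ∘ₗ LinearMap.pi
    (fun Q => (-1 : ℤ) ^ Q.card • LinearMap.toSpanSingleton R A (ev (m - 1)) ∘ₗ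
      LinearMap.proj Q) ∘ₗ star R, fun k c => ?_⟩
  have key : ∀ (Q : Finset (Fin m)) (v : A),
      l k * ordProd (fun i => LinearMap.mulLeft R (l i)) Q v
        = (-1 : ℤ) ^ Q.card • ordProd (fun i => LinearMap.mulLeft R (l i)) Q (l k * v) := by
    intro Q
    induction Q using Finset.induction_on_min with
    | empty => intro v; simp [ordProd_empty]
    | insert q Q hq ih =>
      intro v
      have hqQ : q ∉ Q := fun hqQ => lt_irrefl _ (hq q hqQ)
      have h2 : l k * l q = - (l q * l k) := eq_neg_of_add_eq_zero_left (h.l_anti k q)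
      rw [ordProd_insert _ hq, Module.End.mul_apply, Module.End.mul_apply,
        LinearMap.mulLeft_apply, LinearMap.mulLeft_apply, ← mul_assoc, h2, neg_mul, mul_assoc, ih,
        Finset.card_insert_of_notMem hqQ, pow_succ, mul_smul, neg_one_zsmul, mul_smul_comm,
        smul_neg]
  have key2 : ∀ (Q : Finset (Fin m)) (v : A),
      ordProd (fun i => LinearMap.mulLeft R (l i)) Q v * l k
        = ordProd (fun i => LinearMap.mulLeft R (l i)) Q (v * l k) := by
    intro Q
    induction Q using Finset.induction_on_min with
    | empty => intro v; simp [ordProd_empty]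
    | insert q Q hq ih =>
      intro v
      rw [ordProd_insert _ hq, Module.End.mul_apply, Module.End.mul_apply,
        LinearMap.mulLeft_apply, LinearMap.mulLeft_apply, mul_assoc, ih]
  have hm : m - 1 + 1 = m := by have := k.2; omega
  have h3 : l k * ev m = ev (m - 1) * l k := by rw [← h.l_ev, hm]
  simp only [theta, LinearMap.comp_apply, mu_apply, Finset.sum_mul, Finset.mul_sum]
  refine Finset.sum_congr rfl fun Q _ => ?_
  rw [key, key2]
  simp only [LinearMap.pi_apply, LinearMap.smul_apply, LinearMap.comp_apply, cmap_apply,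
    LinearMap.proj_apply, LinearMap.toSpanSingleton_apply, smul_mul_assoc, mul_smul_comm, h3,
    map_zsmul, map_smul]

lemma Rep.theta_unit (h : Rep ev l g) : theta R l (ev m) (sng R (∅ : Finset (Fin m)) 1) = 0 := by
  have h1 : (sng R (∅ : Finset (Fin m)) 1 : Finset (Fin m) → R)
      = degp (R := R) 0 (sng R (∅ : Finset (Fin m)) 1) := by
    funext I
    rw [degp_apply, sng_apply]
    by_cases hI : I = ∅ <;> simp [hI]
  rw [h1, h.theta_degp, h.ev_zero, zero_mul]

end Theta

section Model

variable {R : Type*} [CommRing R] {m n : ℕ} (x : Fin m → Fin n → R)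

/-- The class of the top form. -/
def top : Cok x := (relJ x).mkQ (sng R Finset.univ 1)

lemma cok_induction {P : Submodule R (Cok x)} (h1 : top x ∈ P)
    (hi : ∀ i, ∀ c ∈ P, cokL x i c ∈ P) (c : Cok x) : c ∈ P := by
  obtain ⟨c, rfl⟩ := (relJ x).mkQ_surjective c
  have h2 : P.comap (relJ x).mkQ = ⊤ := car_induction R h1 fun i c hc => hi i _ hc
  have h3 : c ∈ P.comap (relJ x).mkQ := by rw [h2]; trivial
  exact h3

/-- The action of an algebra on the cokernel, together with an identification of the cokernel
with the left ideal generated by the last idempotent. -/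
structure Model {A : Type*} [Ring A] [Algebra R A] (ev : ℕ → A) (l : Fin m → A)
    (g : Fin n → A) where
  act : A →ₐ[R] Module.End R (Cok x)
  th : Cok x →ₗ[R] A
  act_ev : ∀ a, act (ev a) = cokE x a
  act_l : ∀ i, act (l i) = cokL x i
  act_g : ∀ j, act (g j) = cokG x j
  th_act : ∀ w y, th (act w y) = w * th y
  th_top : th (top x) = ev m
  act_th : ∀ y, act (th y) (top x) = y
  thn : (Finset (Fin m) → R) →ₗ[R] A
  thn_l : ∀ k c, thn c * l k = l k * th ((relJ x).mkQ c)

end Model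

/-- The generic matrix over the polynomial ring. -/
abbrev gx (K : Type) [Field K] (m n : ℕ) (i : Fin m) (j : Fin n) :
    MvPolynomial (Fin m × Fin n) K := MvPolynomial.X (i, j)

theorem IsPA.exists_model {K : Type} [Field K] {m n : ℕ} {A : Type} [Ring A] [Algebra K A]
    [Algebra (MvPolynomial (Fin m × Fin n) K) A]
    [IsScalarTower K (MvPolynomial (Fin m × Fin n) K) A]
    {ev : ℕ → A} {l : Fin m → A} {g : Fin n → A} (h : IsPA K ev l g)
    (hx : ∀ i j, algebraMap (MvPolynomial (Fin m × Fin n) K) A (gx K m n i j)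
      = l i * g j + g j * l i) :
    Nonempty (Model (gx K m n) ev l g) := by
  obtain ⟨f, hev, hl, hg⟩ := h.lift (Module.End (MvPolynomial (Fin m × Fin n) K) (Cok (gx K m n)))
    _ _ _ (cok_rep (gx K m n))
  have hf : f.comp (IsScalarTower.toAlgHom K (MvPolynomial (Fin m × Fin n) K) A)
      = IsScalarTower.toAlgHom K (MvPolynomial (Fin m × Fin n) K) _ := by
    refine MvPolynomial.algHom_ext fun p => ?_
    obtain ⟨i, j⟩ := p
    rw [AlgHom.comp_apply, IsScalarTower.toAlgHom_apply, IsScalarTower.toAlgHom_apply,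
      ← cokL_add_cokG, hx i j, map_add, map_mul, map_mul, hl, hg]
  let act : A →ₐ[MvPolynomial (Fin m × Fin n) K] Module.End (MvPolynomial (Fin m × Fin n) K)
      (Cok (gx K m n)) := { f with commutes' := fun s => AlgHom.congr_fun hf s }
  have aev : ∀ a, act (ev a) = cokE _ a := hev
  have al : ∀ a, act (l a) = cokL _ a := hl
  have ag : ∀ a, act (g a) = cokG _ a := hg
  have hact : ∀ w, act w = f w := fun w => rfl
  let th0 : Cok (gx K m n) →ₗ[MvPolynomial (Fin m × Fin n) K] A :=
    (relJ (gx K m n)).liftQ (theta _ l (ev m))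
      (relJ_le_ker _ _ (fun j => LinearMap.mulLeft _ (g j))
        (fun j c => h.rep.theta_gop hx j c) h.rep.theta_unit)
  have hth0 : ∀ c, th0 ((relJ (gx K m n)).mkQ c) = theta _ l (ev m) c := fun c => rfl
  have hth : ∀ w y, th0 (act w y) = w * th0 y := by
    intro w
    refine h.left_induction
      { carrier := {w | ∀ y, th0 (act w y) = w * th0 y}
        zero_mem' := fun y => by simp
        add_mem' := fun {a b} ha hb y => by
          rw [map_add, LinearMap.add_apply, map_add, ha, hb, add_mul]
        smul_mem' := fun k a ha y => by
          rw [hact, map_smul, LinearMap.smul_apply, LinearMap.map_smul_of_tower, ← hact, ha,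
            smul_mul_assoc] } (fun y => by simp) ?_ ?_ ?_ w
    · intro a w hw y
      rw [map_mul, Module.End.mul_apply, mul_assoc, ← hw y, aev]
      obtain ⟨c, hc⟩ := (relJ (gx K m n)).mkQ_surjective (act w y)
      rw [← hc, cokE_mk, hth0, hth0, h.rep.theta_degp]
    · intro a w hw y
      rw [map_mul, Module.End.mul_apply, mul_assoc, ← hw y, al]
      obtain ⟨c, hc⟩ := (relJ (gx K m n)).mkQ_surjective (act w y)
      rw [← hc, cokL_mk, hth0, hth0, h.rep.theta_iot]
    · intro a w hw y
      rw [map_mul, Module.End.mul_apply, mul_assoc, ← hw y, ag]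
      obtain ⟨c, hc⟩ := (relJ (gx K m n)).mkQ_surjective (act w y)
      rw [← hc, cokG_mk, hth0, hth0, h.rep.theta_gop hx]
  obtain ⟨e, he, hst⟩ := exists_star_top (MvPolynomial (Fin m × Fin n) K) (m := m)
  have htop : th0 (top (gx K m n)) = e • ev m := by
    rw [top, hth0, theta, LinearMap.comp_apply, LinearMap.comp_apply, hst, map_zsmul, map_zsmul,
      cmap_sng]
    congr 1
    refine (mu_single_empty _ _).trans ?_
    simp
  obtain ⟨thn, hthn⟩ := h.rep.exists_theta_swap (R := MvPolynomial (Fin m × Fin n) K)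
  have hevtop : cokE (gx K m n) m (top (gx K m n)) = top (gx K m n) := by
    rw [top, cokE_mk]
    congr 1
    funext I
    rw [degp_apply]
    by_cases hI : I = Finset.univ
    · rw [if_pos (by simp [hI])]
    · rw [sng_apply, if_neg hI, ite_self]
  refine ⟨⟨act, e • th0, aev, al, ag, fun w y => ?_, ?_, fun y => ?_, e • thn, fun k c => ?_⟩⟩
  · rw [LinearMap.smul_apply, LinearMap.smul_apply, hth, mul_smul_comm]
  · rw [LinearMap.smul_apply, htop, smul_smul, he, one_smul]
  · refine cok_induction (gx K m n)
      (P := LinearMap.eqLocus (((LinearMap.applyₗ (top (gx K m n))) ∘ₗ act.toLinearMap) ∘ₗ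
        (e • th0)) LinearMap.id) ?_ ?_ y
    · rw [LinearMap.mem_eqLocus]
      simp only [LinearMap.comp_apply, LinearMap.smul_apply, htop, smul_smul, he, one_smul,
        AlgHom.toLinearMap_apply, LinearMap.applyₗ_apply_apply, aev, LinearMap.id_apply]
      exact hevtop
    · intro i c hc
      rw [LinearMap.mem_eqLocus] at hc ⊢
      simp only [LinearMap.comp_apply, LinearMap.smul_apply,
        AlgHom.toLinearMap_apply, LinearMap.applyₗ_apply_apply, LinearMap.id_apply] at hc ⊢
      rw [← al, hth, ← mul_smul_comm, map_mul, Module.End.mul_apply, hc]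
  · rw [LinearMap.smul_apply, LinearMap.smul_apply, smul_mul_assoc, hthn, hth0, mul_smul_comm]

/-! ### Comparison with the endomorphisms of the cokernel -/

section Compare

variable {R : Type*} [CommRing R] {m n : ℕ} {x : Fin m → Fin n → R} {A : Type*} [Ring A]
  [Algebra R A] {ev : ℕ → A} {l : Fin m → A} {g : Fin n → A}

lemma Model.th_ev (M : Model x ev l g) (y : Cok x) : M.th y * ev m = M.th y := by
  rw [← M.th_top, ← M.th_act, M.act_th]

theorem Model.injective (M : Model x ev l g) (h : Rep ev l g)
    (hg : Good (fun i => mr R (l i)) (fun a => mr R (ev a))) : Function.Injective M.act := by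
  have key : ∀ k a, a + k = m → ∀ w, M.act w = 0 → w * ev a = 0 := by
    intro k
    induction k with
    | zero =>
      intro a ha w hw
      obtain rfl : a = m := by omega
      rw [← M.th_top, ← M.th_act, hw, LinearMap.zero_apply, map_zero]
    | succ k ih =>
      intro a ha w hw
      refine hg.eq_zero (a := a) (by omega) ?_ fun i => ?_
      · rw [LinearMap.mulRight_apply, mul_assoc, h.ev_mul, if_pos rfl]
      · rw [LinearMap.mulRight_apply, mul_assoc, ← h.l_ev, ← mul_assoc]
        refine ih (a + 1) (by omega) _ ?_
        rw [map_mul, hw, zero_mul]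
  rw [injective_iff_map_eq_zero]
  intro w hw
  rw [← mul_one w, ← h.sum_ev, Finset.mul_sum]
  refine Finset.sum_eq_zero fun a ha => ?_
  rw [Finset.mem_range] at ha
  exact key (m - a) a (by omega) w hw

lemma cok_end_eq_zero {f : Module.End R (Cok x)} (h1 : f (top x) = 0)
    (h2 : ∀ i, f * cokL x i = 0) : f = 0 := by
  refine LinearMap.ext fun y => ?_
  refine cok_induction x (P := LinearMap.ker f) h1 (fun i c _ => ?_) y
  exact LinearMap.congr_fun (h2 i) c

lemma cokE_top : cokE x m (top x) = top x := by
  rw [top, cokE_mk]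
  congr 1
  funext I
  rw [degp_apply]
  by_cases hI : I = Finset.univ
  · rw [if_pos (by simp [hI])]
  · rw [sng_apply, if_neg hI, ite_self]

theorem Model.surjective (M : Model x ev l g) (h : Rep ev l g)
    (hg : Good (fun i => mr R (l i)) (fun a => mr R (ev a)))
    (htor : ∀ (f : Module.End R (Cok x)) (q : Fin m → A),
      (∀ i, M.act (q i) = f * cokL x i * cokE x m) → (∀ i, q i * ev m = q i) →
      ∃ w, dif (fun i => mr R (l i)) w = ∑ i, Finsupp.single (ex i) (q i)) :
    Function.Surjective M.act := by
  have hinj := M.injective h hg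
  have hY := cok_rep x
  have key : ∀ k a, a + k = m → ∀ f : Module.End R (Cok x), ∃ w, M.act w = f * cokE x a := by
    intro k
    induction k with
    | zero =>
      intro a ha f
      obtain rfl : a = m := by omega
      refine ⟨M.th (f (top x)), ?_⟩
      rw [← sub_eq_zero]
      refine cok_end_eq_zero ?_ fun i => ?_
      · rw [LinearMap.sub_apply, M.act_th, Module.End.mul_apply, cokE_top, sub_self]
      · have e1 : ev a * l i = 0 := by rw [← h.l_ev, h.ev_gt _ (Nat.lt_succ_self a), mul_zero]
        have e2 : cokE x a * cokL x i = 0 := by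
          rw [← hY.l_ev, hY.ev_gt _ (Nat.lt_succ_self a), mul_zero]
        rw [sub_mul, ← M.th_ev, map_mul, mul_assoc, ← M.act_l, ← map_mul, e1, mul_assoc, M.act_l,
          e2]
        simp
    | succ k ih =>
      intro a ha f
      choose q₀ hq₀ using fun i => ih (a + 1) (by omega) (f * cokL x i)
      obtain ⟨q, hq⟩ : ∃ q : Fin m → A, q = fun i => q₀ i * ev (a + 1) := ⟨_, rfl⟩
      have hq1 : ∀ i, M.act (q i) = f * cokL x i * cokE x (a + 1) := by
        intro i
        rw [hq, map_mul, hq₀, M.act_ev, mul_assoc, hY.ev_mul, if_pos rfl]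
      have hq2 : ∀ i, q i * ev (a + 1) = q i := by
        intro i
        rw [hq, mul_assoc, h.ev_mul, if_pos rfl]
      have hq3 : ∀ i j, M.act (q i * l j) = f * (cokL x i * cokL x j) * cokE x (a + 2) := by
        intro i j
        rw [map_mul, hq1, M.act_l, mul_assoc, ← hY.l_ev]
        simp only [mul_assoc]
      have hw : ∃ w, dif (fun i => mr R (l i)) w = ∑ i, Finsupp.single (ex i) (q i) := by
        by_cases hk : k = 0
        · obtain rfl : a + 1 = m := by omega
          exact htor f q hq1 hq2
        · refine hg (a + 1) (by omega) _ ?_ ?_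
          · simp only [map_sum, pw_single, LinearMap.mulRight_apply, hq2]
          · simp only [map_sum, dif_eq, pw_single, yv_single, LinearMap.mulRight_apply]
            refine sum_sum_alt _ (fun i => ?_) fun i j => ?_
            · rw [show q i * l i = 0 from hinj (by rw [hq3, hY.l_sq]; simp), Finsupp.single_zero]
            · rw [add_comm (ex j) (ex i), ← Finsupp.single_add,
                show q i * l j + q j * l i = 0 from hinj (by
                  rw [map_add, hq3, hq3, ← add_mul, ← mul_add, hY.l_anti]; simp),
                Finsupp.single_zero]
      obtain ⟨w, hw⟩ := hw
      have hw0 : ∀ i, w 0 * l i = q i := by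
        intro i
        have h1 := DFunLike.congr_fun hw (ex i)
        rw [dif_ex, LinearMap.mulRight_apply] at h1
        rw [h1, Finsupp.finsetSum_apply, Finset.sum_eq_single i]
        · simp
        · intro j _ hj
          rw [Finsupp.single_apply, if_neg]
          intro h2
          refine hj ?_
          have h3 := DFunLike.congr_fun h2 j
          by_contra hji
          simp [ex, Ne.symm hji] at h3
        · simp
      refine ⟨w 0 * ev a, ?_⟩
      rw [← sub_eq_zero]
      refine cok_end_eq_zero ?_ fun i => ?_
      · have e1 : cokE x a (top x) = 0 := by
          rw [← cokE_top, ← Module.End.mul_apply, hY.ev_mul, if_neg (by omega)]; rfl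
        rw [LinearMap.sub_apply, map_mul, Module.End.mul_apply, Module.End.mul_apply, M.act_ev, e1]
        simp
      · have e1 : M.act (w 0 * ev a) * cokL x i = M.act (q i) := by
          rw [← M.act_l, ← map_mul, mul_assoc, ← h.l_ev, ← mul_assoc, hw0, hq2]
        rw [sub_mul, e1, hq1, mul_assoc, mul_assoc, hY.l_ev, sub_self]
  intro f
  choose w hw using fun a : Fin (m + 1) => key (m - a) a (by omega) f
  refine ⟨∑ a, w a, ?_⟩
  rw [map_sum, Finset.sum_congr rfl fun a _ => hw a, ← Finset.mul_sum,
    Fin.sum_univ_eq_sum_range (fun a => cokE x a), hY.sum_ev, mul_one]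

end Compare

section Torsion

variable {R : Type*} [CommRing R] {m n : ℕ} {x : Fin m → Fin n → R} {A : Type*} [Ring A]
  [Algebra R A] {ev : ℕ → A} {l : Fin m → A} {g : Fin n → A}

lemma Rep.ev_l_top (h : Rep ev l g) (i : Fin m) : ev m * l i = 0 := by
  rw [← h.l_ev, h.ev_gt _ (Nat.lt_succ_self m), mul_zero]

/-- Multiplying an annihilated element by the relations between the variables gives a boundary. -/
lemma Rep.dif_mul_g (h : Rep ev l g) (hx : ∀ i j, algebraMap R A (x i j) = l i * g j + g j * l i)
    (j : Fin n) (z : Pol m A) (hz : ∀ ν, z ν * ev m = z ν) :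
    dif (fun i => mr R (l i)) (pw (mr R (g j)) z) = ∑ i, yv R i (x i j • z) := by
  rw [dif_eq]
  refine Finset.sum_congr rfl fun i _ => ?_
  congr 1
  refine Finsupp.ext fun ν => ?_
  have h1 : z ν * l i = 0 := by rw [← hz, mul_assoc, h.ev_l_top, mul_zero]
  rw [pw_apply, pw_apply, LinearMap.mulRight_apply, LinearMap.mulRight_apply, Finsupp.smul_apply,
    Algebra.smul_def, Algebra.commutes, hx, mul_add, ← mul_assoc, h1, zero_mul, zero_add, mul_assoc]

theorem Model.contract_mem (M : Model x ev l g) (h : Rep ev l g)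
    (hx : ∀ i j, algebraMap R A (x i j) = l i * g j + g j * l i) {u : Cok x}
    (hu : ∀ i, cokL x i u = 0) (J : List (Fin n)) (F : Module.End R (Cok x)) :
    (∑ i, Finsupp.single (ex i) (M.th (F (cokL x i ((J.map (cokG x)).prod u)))) : Pol m A)
      ∈ LinearMap.range (dif (fun i => mr R (l i))) := by
  induction J generalizing F with
  | nil => simp [hu]
  | cons j J ih =>
    have h1 : ∀ i (v : Cok x), cokL x i (cokG x j v) = x i j • v - cokG x j (cokL x i v) := by
      intro i v
      rw [eq_sub_iff_add_eq]
      exact LinearMap.congr_fun (cokL_add_cokG x i j) v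
    simp only [List.map_cons, List.prod_cons, Module.End.mul_apply, h1, map_sub,
      Finsupp.single_sub, Finset.sum_sub_distrib, map_smul]
    refine Submodule.sub_mem _ ?_ (ih (F * cokG x j))
    refine ⟨pw (mr R (g j)) (Finsupp.single 0 (M.th (F ((J.map (cokG x)).prod u)))), ?_⟩
    rw [h.dif_mul_g hx]
    · refine Finset.sum_congr rfl fun i _ => ?_
      rw [Finsupp.smul_single, yv_single, zero_add]
    · intro ν
      rw [Finsupp.single_apply]
      split_ifs
      · exact M.th_ev _
      · exact zero_mul _

variable {L : Type*} [CommRing L] (ρ : R →+* L) (y : Fin m → L)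

/-- Scalar extension of coefficients. -/
def ext (c : Finset (Fin m) → R) : Finset (Fin m) → L := fun I => ρ (c I)

lemma ext_eps (i : Fin m) (c : Finset (Fin m) → R) : ext ρ (eps R i c) = eps L i (ext ρ c) := by
  funext I
  simp only [ext, eps_apply]
  split_ifs <;> simp

lemma ext_iot (i : Fin m) (c : Finset (Fin m) → R) : ext ρ (iot R i c) = iot L i (ext ρ c) := by
  funext I
  simp only [ext, iot_apply]
  split_ifs <;> simp

lemma ext_degp (r : ℕ) (c : Finset (Fin m) → R) :
    ext ρ (degp (R := R) r c) = degp (R := L) r (ext ρ c) := by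
  funext I
  simp only [ext, degp_apply]
  split_ifs <;> simp

lemma ext_add (c d : Finset (Fin m) → R) : ext ρ (c + d) = ext ρ c + ext ρ d :=
  funext fun _ => map_add _ _ _

lemma ext_smul (s : R) (c : Finset (Fin m) → R) : ext ρ (s • c) = ρ s • ext ρ c :=
  funext fun _ => map_mul _ _ _

lemma ext_sum {ι : Type*} (s : Finset ι) (c : ι → Finset (Fin m) → R) :
    ext ρ (∑ i ∈ s, c i) = ∑ i ∈ s, ext ρ (c i) := by
  funext I
  simp [ext]

/-- Contraction by a vector. -/
def con (c : Finset (Fin m) → L) : Finset (Fin m) → L := ∑ k, y k • iot L k c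

lemma con_gop (hy : ∀ j, ∑ i, y i * ρ (x i j) = 0) (j : Fin n) (c : Finset (Fin m) → R) :
    con y (ext ρ (gop x j c)) = - gop (fun i j => ρ (x i j)) j (con y (ext ρ c)) := by
  have e1 : ext ρ (gop x j c) = gop (fun i j => ρ (x i j)) j (ext ρ c) := by
    simp only [gop_apply, ext_sum, ext_smul, ext_eps]
  have e2 : ∀ k, iot L k (gop (fun i j => ρ (x i j)) j (ext ρ c))
      = ρ (x k j) • ext ρ c - gop (fun i j => ρ (x i j)) j (iot L k (ext ρ c)) :=
    fun k => eq_sub_of_add_eq (iot_add_gop (fun i j => ρ (x i j)) k j (ext ρ c))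
  rw [e1]
  simp only [con, e2, smul_sub, smul_smul, Finset.sum_sub_distrib, ← Finset.sum_smul, hy,
    map_sum, map_smul]
  rw [zero_smul, zero_sub]

lemma con_iot (k : Fin m) (c : Finset (Fin m) → L) : con y (iot L k c) = - iot L k (con y c) := by
  simp only [con, map_sum, map_smul, ← Finset.sum_neg_distrib, ← smul_neg]
  exact Finset.sum_congr rfl fun i _ => by rw [antiSq_iot.swap_apply i k]

lemma con_degp_succ (a : ℕ) (c : Finset (Fin m) → L) :
    con y (degp (R := L) (a + 1) c) = degp (R := L) a (con y c) := by
  simp only [con, map_sum, map_smul, degp_iot]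

lemma con_degp_zero (c : Finset (Fin m) → L) : con y (degp (R := L) 0 c) = 0 :=
  Finset.sum_eq_zero fun k _ => by rw [iot_degp_zero, smul_zero]

lemma con_smul (s : L) (c : Finset (Fin m) → L) : con y (s • c) = s • con y c := by
  simp only [con, map_smul, Finset.smul_sum]
  exact Finset.sum_congr rfl fun k _ => smul_comm _ _ _

lemma con_sum {ι : Type*} (s : Finset ι) (c : ι → Finset (Fin m) → L) :
    con y (∑ i ∈ s, c i) = ∑ i ∈ s, con y (c i) := by
  simp only [con, map_sum, Finset.smul_sum]
  exact Finset.sum_comm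

lemma con_eps (t : Fin m) (c : Finset (Fin m) → L) :
    con y (eps L t c) + eps L t (con y c) = y t • c := by
  simp only [con, map_sum, map_smul, ← Finset.sum_add_distrib, ← smul_add]
  rw [Finset.sum_eq_single t]
  · rw [add_comm, eps_add_iot, if_pos rfl]
  · intro k _ hk
    rw [add_comm, eps_add_iot, if_neg (Ne.symm hk), smul_zero]
  · simp

/-- Extension of scalars followed by contraction, as a map on the cokernel. -/
theorem exists_contract (hy : ∀ j, ∑ i, y i * ρ (x i j) = 0) :
    ∃ β : Cok x → (Finset (Fin m) → L), (∀ c, β ((relJ x).mkQ c) = con y (ext ρ c)) ∧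
      (∀ u v, β (u + v) = β u + β v) ∧ (∀ (s : R) v, β (s • v) = ρ s • β v) := by
  let _ : Algebra R L := ρ.toAlgebra
  have hsm : ∀ (s : R) (d : Finset (Fin m) → L), s • d = ρ s • d := by
    intro s d; funext I; exact Algebra.smul_def s (d I)
  let f : (Finset (Fin m) → R) →ₗ[R] (Finset (Fin m) → L) :=
    { toFun := fun c => con y (ext ρ c)
      map_add' := fun c d => by
        simp only [con, ext_add, map_add, smul_add, Finset.sum_add_distrib]
      map_smul' := fun s c => by
        simp only [con, ext_smul, map_smul, RingHom.id_apply, hsm, Finset.smul_sum]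
        exact Finset.sum_congr rfl fun k _ => smul_comm _ _ _ }
  let G : Fin n → Module.End R (Finset (Fin m) → L) := fun j =>
    { toFun := fun c => - gop (fun i j => ρ (x i j)) j c
      map_add' := fun c d => by rw [map_add, neg_add]
      map_smul' := fun s c => by rw [RingHom.id_apply, hsm, hsm, map_smul, smul_neg] }
  have hf : relJ x ≤ LinearMap.ker f := by
    refine relJ_le_ker x f G (fun j c => ?_) ?_
    · exact con_gop ρ y hy j c
    · change con y (ext ρ (sng R ∅ 1)) = 0
      have e1 : ext ρ (sng R (∅ : Finset (Fin m)) 1) = Pi.single ∅ 1 := by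
        funext I
        simp only [ext, sng_apply, Pi.single_apply]
        split_ifs <;> simp
      rw [e1, con]
      exact Finset.sum_eq_zero fun k _ => by simp [iot_single]
  refine ⟨(relJ x).liftQ f hf, fun c => rfl, fun u v => map_add _ _ _, fun s v => ?_⟩
  rw [map_smul, hsm]

theorem con_con (c : Finset (Fin m) → L) : con y (con y c) = 0 := by
  simp only [con, map_sum, map_smul, Finset.smul_sum]
  refine sum_sum_alt _ (fun i => ?_) fun i j => ?_
  · rw [antiSq_iot.sq_apply, smul_zero, smul_zero]
  · rw [antiSq_iot.swap_apply i j, smul_neg, smul_neg, smul_comm, neg_add_cancel]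

theorem Model.contract_left_mul {K : Type} [Field K] [Algebra K R] {A : Type} [Ring A]
    [Algebra K A] [Algebra R A] [IsScalarTower K R A] {ev : ℕ → A} {l : Fin m → A} {g : Fin n → A}
    (M : Model x ev l g) (h : IsPA K ev l g) (hy : ∀ j, ∑ i, y i * ρ (x i j) = 0)
    {β : Cok x → (Finset (Fin m) → L)} (hβ : ∀ c, β ((relJ x).mkQ c) = con y (ext ρ c))
    (hadd : ∀ u v, β (u + v) = β u + β v) (hsmul : ∀ (s : R) v, β (s • v) = ρ s • β v) (w : A) :
    ∑ i, y i • β (M.act (w * l i) (top x)) = 0 := by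
  have h0 : β 0 = 0 := by simpa using hadd 0 0
  have hE0 : ∀ v, β (cokE x 0 v) = 0 := by
    intro v
    obtain ⟨c, rfl⟩ := (relJ x).mkQ_surjective v
    rw [cokE_mk, hβ, ext_degp, con_degp_zero]
  have hE : ∀ a v, β (cokE x (a + 1) v) = degp (R := L) a (β v) := by
    intro a v
    obtain ⟨c, rfl⟩ := (relJ x).mkQ_surjective v
    rw [cokE_mk, hβ, ext_degp, con_degp_succ, hβ]
  have hL : ∀ k v, β (cokL x k v) = - iot L k (β v) := by
    intro k v
    obtain ⟨c, rfl⟩ := (relJ x).mkQ_surjective v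
    rw [cokL_mk, hβ, ext_iot, con_iot, hβ]
  have hG : ∀ j v, β (cokG x j v) = - gop (fun i j => ρ (x i j)) j (β v) := by
    intro j v
    obtain ⟨c, rfl⟩ := (relJ x).mkQ_surjective v
    rw [cokG_mk, hβ, con_gop ρ y hy, hβ]
  refine h.left_induction
    { carrier := {w | ∑ i, y i • β (M.act (w * l i) (top x)) = 0}
      zero_mem' := by simp [h0]
      add_mem' := fun {a b} ha hb => by
        simp only [Set.mem_ofPred_eq] at ha hb ⊢
        simp only [add_mul, map_add, LinearMap.add_apply, hadd, smul_add, Finset.sum_add_distrib,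
          ha, hb, add_zero]
      smul_mem' := fun k a ha => by
        simp only [Set.mem_ofPred_eq] at ha ⊢
        simp only [← algebraMap_smul R k a, smul_mul_assoc, map_smul, LinearMap.smul_apply, hsmul,
          smul_comm (y _) (ρ _), ← Finset.smul_sum, ha, smul_zero] } ?_ ?_ ?_ ?_ w
  · change ∑ i, y i • β (M.act (1 * l i) (top x)) = 0
    simp only [one_mul, M.act_l, top, cokL_mk, hβ, ext_iot, con_iot, smul_neg,
      Finset.sum_neg_distrib]
    rw [neg_eq_zero]
    exact con_con y _
  · rintro (_ | a) w hw
    · change ∑ i, y i • β (M.act (ev 0 * w * l i) (top x)) = 0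
      simp only [mul_assoc, map_mul M.act (ev 0), M.act_ev, Module.End.mul_apply, hE0, smul_zero,
        Finset.sum_const_zero]
    · change ∑ i, y i • β (M.act (ev (a + 1) * w * l i) (top x)) = 0
      change ∑ i, y i • β (M.act (w * l i) (top x)) = 0 at hw
      simp only [mul_assoc, map_mul M.act (ev (a + 1)), M.act_ev, Module.End.mul_apply, hE,
        ← map_smul, ← map_sum, hw, map_zero]
  · intro k w hw
    change ∑ i, y i • β (M.act (l k * w * l i) (top x)) = 0
    change ∑ i, y i • β (M.act (w * l i) (top x)) = 0 at hw
    simp only [mul_assoc, map_mul M.act (l k), M.act_l, Module.End.mul_apply, hL, smul_neg,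
      Finset.sum_neg_distrib, ← map_smul, ← map_sum, hw, map_zero, neg_zero]
  · intro k w hw
    change ∑ i, y i • β (M.act (g k * w * l i) (top x)) = 0
    change ∑ i, y i • β (M.act (w * l i) (top x)) = 0 at hw
    simp only [mul_assoc, map_mul M.act (g k), M.act_g, Module.End.mul_apply, hG, smul_neg,
      Finset.sum_neg_distrib, ← map_smul, ← map_sum, hw, map_zero, neg_zero]

end Torsion

section Chart
open MvPolynomial

variable (K : Type) [Field K] (m n : ℕ)

/-- Polynomials in additional variables indexed by the rows. -/
abbrev RowPol : Type := MvPolynomial (Fin m) (MvPolynomial (Fin m × Fin n) K)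

/-- The ideal generated by the products of the row of new variables with the columns. -/
def rowIdeal : Ideal (RowPol K m n) :=
  Ideal.span (Set.range fun j : Fin n => ∑ i : Fin m, X i * C (gx K m n i j))

/-- The field of fractions of `RowPol`. -/
abbrev RowFrac : Type := FractionRing (RowPol K m n)

/-- The new variables in the field of fractions. -/
def rowVar (i : Fin m) : RowFrac K m n := algebraMap (RowPol K m n) (RowFrac K m n) (X i)

/-- Solving for the entries of the row `t`. -/
def chartS (t : Fin m) : MvPolynomial (Fin m × Fin n) K →+* RowFrac K m n :=
  eval₂Hom ((algebraMap (RowPol K m n) (RowFrac K m n)).comp (C.comp C)) fun p =>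
    if p.1 = t then
      -(∑ i ∈ Finset.univ.erase t,
        rowVar K m n i * algebraMap (RowPol K m n) (RowFrac K m n) (C (X (i, p.2)))) /
        rowVar K m n t
    else algebraMap (RowPol K m n) (RowFrac K m n) (C (X p))

/-- The extension of `chartS` to `RowPol`. -/
def chart (t : Fin m) : RowPol K m n →+* RowFrac K m n :=
  eval₂Hom (chartS K m n t) (rowVar K m n)

variable {K m n}

lemma chart_C (t : Fin m) (s : MvPolynomial (Fin m × Fin n) K) :
    chart K m n t (C s) = chartS K m n t s := by simp [chart]

lemma chart_X (t i : Fin m) : chart K m n t (X i) = rowVar K m n i := by simp [chart]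

lemma rowVar_ne_zero (t : Fin m) : rowVar K m n t ≠ 0 := by
  rw [rowVar, Ne, FaithfulSMul.algebraMap_eq_zero_iff]
  exact X_ne_zero t

lemma chartS_row (t : Fin m) (j : Fin n) : rowVar K m n t * chartS K m n t (gx K m n t j) =
    -(∑ i ∈ Finset.univ.erase t,
        rowVar K m n i * algebraMap (RowPol K m n) (RowFrac K m n) (C (X (i, j)))) := by
  rw [chartS, gx, eval₂Hom_X', if_pos rfl, mul_div_cancel₀ _ (rowVar_ne_zero t)]

lemma chartS_of_ne {t i : Fin m} (h : i ≠ t) (j : Fin n) : chartS K m n t (gx K m n i j) =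
    algebraMap (RowPol K m n) (RowFrac K m n) (C (X (i, j))) := by
  rw [chartS, gx, eval₂Hom_X', if_neg h]

lemma sum_rowVar_mul_chartS (t : Fin m) (j : Fin n) :
    ∑ i, rowVar K m n i * chartS K m n t (gx K m n i j) = 0 := by
  rw [← Finset.add_sum_erase _ _ (Finset.mem_univ t), chartS_row, neg_add_eq_zero]
  exact Finset.sum_congr rfl fun i hi => by rw [chartS_of_ne (Finset.ne_of_mem_erase hi)]

lemma chart_eq_zero_of_mem (t : Fin m) {r : RowPol K m n} (h : r ∈ rowIdeal K m n) :
    chart K m n t r = 0 := by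
  have : rowIdeal K m n ≤ RingHom.ker (chart K m n t) := by
    rw [rowIdeal, Ideal.span_le]
    rintro _ ⟨j, rfl⟩
    simp only [SetLike.mem_coe, RingHom.mem_ker, map_sum, map_mul, chart_C, chart_X]
    exact sum_rowVar_mul_chartS t j
  exact this h

/-- Up to a power of the variable `X t`, every polynomial is congruent to one which is
unchanged by the chart. -/
lemma exists_reduced (t : Fin m) (r : RowPol K m n) :
    ∃ (N : ℕ) (r' : RowPol K m n), X t ^ N * r - r' ∈ rowIdeal K m n ∧
      chart K m n t r' = algebraMap _ _ r' := by
  have hadd : ∀ a b : RowPol K m n,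
      (∃ (N : ℕ) (r' : RowPol K m n), X t ^ N * a - r' ∈ rowIdeal K m n ∧
        chart K m n t r' = algebraMap _ _ r') →
      (∃ (N : ℕ) (r' : RowPol K m n), X t ^ N * b - r' ∈ rowIdeal K m n ∧
        chart K m n t r' = algebraMap _ _ r') →
      ∃ (N : ℕ) (r' : RowPol K m n), X t ^ N * (a + b) - r' ∈ rowIdeal K m n ∧
        chart K m n t r' = algebraMap _ _ r' := by
    rintro a b ⟨N, a', ha, ha'⟩ ⟨M, b', hb, hb'⟩
    refine ⟨N + M, X t ^ M * a' + X t ^ N * b', ?_, ?_⟩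
    · have := add_mem (Ideal.mul_mem_left _ (X t ^ M) ha) (Ideal.mul_mem_left _ (X t ^ N) hb)
      convert this using 1
      ring
    · simp only [map_add, map_mul, map_pow, ha', hb', chart_X, rowVar]
  have hmul : ∀ a b : RowPol K m n,
      (∃ (N : ℕ) (r' : RowPol K m n), X t ^ N * a - r' ∈ rowIdeal K m n ∧
        chart K m n t r' = algebraMap _ _ r') →
      (∃ (N : ℕ) (r' : RowPol K m n), X t ^ N * b - r' ∈ rowIdeal K m n ∧
        chart K m n t r' = algebraMap _ _ r') →
      ∃ (N : ℕ) (r' : RowPol K m n), X t ^ N * (a * b) - r' ∈ rowIdeal K m n ∧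
        chart K m n t r' = algebraMap _ _ r' := by
    rintro a b ⟨N, a', ha, ha'⟩ ⟨M, b', hb, hb'⟩
    refine ⟨N + M, a' * b', ?_, ?_⟩
    · have := add_mem (Ideal.mul_mem_left _ (X t ^ M * b) ha) (Ideal.mul_mem_left _ a' hb)
      convert this using 1
      ring
    · simp only [map_mul, ha', hb']
  have hself : ∀ a : RowPol K m n, chart K m n t a = algebraMap _ _ a →
      ∃ (N : ℕ) (r' : RowPol K m n), X t ^ N * a - r' ∈ rowIdeal K m n ∧
        chart K m n t r' = algebraMap _ _ r' :=
    fun a ha => ⟨0, a, by simp, ha⟩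
  refine MvPolynomial.induction_on r (fun s => ?_) hadd fun p i hp => ?_
  · refine MvPolynomial.induction_on (motive := fun s => ∃ (N : ℕ) (r' : RowPol K m n),
      X t ^ N * C s - r' ∈ rowIdeal K m n ∧ chart K m n t r' = algebraMap _ _ r') s
      (fun k => ?_) (fun p q hp hq => ?_) fun p i hp => ?_
    · exact hself _ (by rw [chart_C, chartS, eval₂Hom_C]; rfl)
    · rw [C_add]; exact hadd _ _ hp hq
    · rw [C_mul]
      refine hmul _ _ hp ?_
      by_cases hi : i.1 = t
      · refine ⟨1, -∑ k ∈ Finset.univ.erase t, X k * C (X (k, i.2)), ?_, ?_⟩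
        · refine Ideal.subset_span ⟨i.2, ?_⟩
          dsimp only
          rw [← Finset.add_sum_erase _ _ (Finset.mem_univ t), pow_one, sub_neg_eq_add]
          have : i = (t, i.2) := Prod.ext hi rfl
          rw [this]
        · simp only [map_neg, map_sum, map_mul, chart_X, chart_C]
          refine congrArg _ (Finset.sum_congr rfl fun k hk => ?_)
          exact congrArg _ (chartS_of_ne (Finset.ne_of_mem_erase hk) i.2)
      · exact hself _ (by rw [chart_C]; exact chartS_of_ne hi i.2)
  · exact hmul _ _ hp (hself _ (chart_X t i))

lemma exists_pow_mul_mem (t : Fin m) {r : RowPol K m n} (h : chart K m n t r = 0) :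
    ∃ N : ℕ, X t ^ N * r ∈ rowIdeal K m n := by
  obtain ⟨N, r', hr, hr'⟩ := exists_reduced t r
  refine ⟨N, ?_⟩
  have h0 := chart_eq_zero_of_mem t hr
  rw [map_sub, map_mul, h, mul_zero, zero_sub, neg_eq_zero, hr',
    FaithfulSMul.algebraMap_eq_zero_iff] at h0
  rwa [h0, sub_zero] at hr

/-- The minor on the rows other than `t` is not killed in the chart. -/
lemma chartS_ne_zero (t : Fin m) (s : MvPolynomial (Fin m × Fin n) K)
    (e : MvPolynomial (Fin m × Fin n) K →+* K) (he : ∀ j, e (gx K m n t j) = 0) (hs : e s ≠ 0) :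
    chartS K m n t s ≠ 0 := by
  intro h0
  obtain ⟨N, hN⟩ := exists_pow_mul_mem (r := C s) t (by rw [chart_C, h0])
  let q : RowPol K m n →+* K := eval₂Hom e fun i => if i = t then 1 else 0
  have hle : rowIdeal K m n ≤ RingHom.ker q := by
    rw [rowIdeal, Ideal.span_le]
    rintro _ ⟨j, rfl⟩
    simp [q, he]
  have := hle hN
  rw [RingHom.mem_ker, map_mul, map_pow] at this
  simp [q, hs] at this

end Chart

section Minor
open MvPolynomial

variable {K : Type} [Field K] {m n : ℕ}

/-- Specialisation to the unit matrix with the row `t` replaced by zero. -/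
def unitEval (K : Type) [Field K] (hmn : m ≤ n) (t : Fin m) :
    MvPolynomial (Fin m × Fin n) K →+* K :=
  eval₂Hom (RingHom.id K) fun p =>
    if p.1 = t then 0 else if p.2 = Fin.castLE hmn p.1 then 1 else 0

lemma unitEval_gx (hmn : m ≤ n) (t i : Fin m) (j : Fin n) :
    unitEval K hmn t (gx K m n i j) =
      if i = t then 0 else if j = Fin.castLE hmn i then 1 else 0 := by
  rw [unitEval, gx, eval₂Hom_X']

lemma ext_unitEval_ordProd (hmn : m ≤ n) (t : Fin m) (Q : Finset (Fin m)) (hQ : t ∉ Q) :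
    ∃ e : ℤ, e * e = 1 ∧
      ext (unitEval K hmn t) (ordProd (fun q => gop (gx K m n) (Fin.castLE hmn q)) Q
        (sng (MvPolynomial (Fin m × Fin n) K) {t} 1)) = e • Pi.single (insert t Q) 1 := by
  induction Q using Finset.induction_on_min with
  | empty =>
    refine ⟨1, one_mul _, ?_⟩
    rw [ordProd_empty]
    funext I
    simp only [ext, Module.End.one_apply, sng_apply, one_smul, Pi.single_apply, insert_empty_eq]
    split_ifs <;> simp
  | insert q Q hq ih =>
    obtain ⟨e, he, h⟩ := ih fun hh => hQ (Finset.mem_insert_of_mem hh)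
    have hqt : q ≠ t := fun hh => hQ (hh ▸ Finset.mem_insert_self _ _)
    have hqQ : q ∉ insert t Q := by
      rw [Finset.mem_insert, not_or]
      exact ⟨hqt, fun hh => lt_irrefl _ (hq q hh)⟩
    refine ⟨e * sg q (insert t Q), ?_, ?_⟩
    · rw [mul_mul_mul_comm, he, sg_mul_self, one_mul]
    · rw [ordProd_insert _ hq, Module.End.mul_apply, gop_apply, ext_sum]
      simp only [ext_smul, ext_eps, h, unitEval_gx]
      rw [Finset.sum_eq_single q]
      · rw [if_neg hqt, if_pos rfl, one_smul, map_zsmul, eps_single, if_neg hqQ, smul_smul,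
          Finset.insert_comm]
      · intro i _ hi
        by_cases hit : i = t
        · rw [if_pos hit, zero_smul]
        · rw [if_neg hit, if_neg fun hh => hi (Fin.castLE_injective hmn hh).symm, zero_smul]
      · simp

/-- Multiplying the basis vector `t` by columns one reaches a multiple of the top element which
is nonzero in the chart `t`. -/
lemma exists_minor (hmn : m ≤ n) (t : Fin m) :
    ∃ (J : List (Fin n)) (s : MvPolynomial (Fin m × Fin n) K), chartS K m n t s ≠ 0 ∧
      (J.map (cokG (gx K m n))).prod
          ((relJ (gx K m n)).mkQ (sng (MvPolynomial (Fin m × Fin n) K) {t} 1)) = s • top (gx K m n) := by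
  set T : Fin m → Module.End (MvPolynomial (Fin m × Fin n) K) _ :=
    fun q => gop (gx K m n) (Fin.castLE hmn q) with hT
  set c := ordProd T (Finset.univ.erase t) (sng (MvPolynomial (Fin m × Fin n) K) {t} 1) with hc
  have hm : 1 + (Finset.univ.erase t).card = m := by
    rw [Finset.card_erase_of_mem (Finset.mem_univ t), Finset.card_univ, Fintype.card_fin]
    have := t.pos
    omega
  have hdeg : degp (R := MvPolynomial (Fin m × Fin n) K) m c = c := by
    have := ordProd_shift (T := T) (E := fun a => degp (R := MvPolynomial (Fin m × Fin n) K) a)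
      (fun a i v => degp_gop _ a _ v) (Finset.univ.erase t) 1
      (sng (MvPolynomial (Fin m × Fin n) K) {t} 1)
    rw [hm] at this
    rw [hc, this]
    congr 1
    funext I
    rw [degp_apply, sng_apply]
    by_cases hI : I = {t} <;> simp [hI]
  have hc' : c = sng (MvPolynomial (Fin m × Fin n) K) Finset.univ (c Finset.univ) := by
    funext I
    rw [sng_apply]
    split_ifs with hI
    · rw [hI]
    · rw [← hdeg, degp_apply, if_neg]
      intro hh
      exact hI ((Finset.card_eq_iff_eq_univ I).1 (by rw [hh, Fintype.card_fin]))
  refine ⟨((Finset.univ.erase t).sort (· ≤ ·)).map (Fin.castLE hmn), c Finset.univ,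
    chartS_ne_zero t _ (unitEval K hmn t) (fun j => by rw [unitEval_gx, if_pos rfl]) ?_, ?_⟩
  · obtain ⟨e, he, h⟩ := ext_unitEval_ordProd (K := K) hmn t (Finset.univ.erase t)
      (Finset.notMem_erase _ _)
    have h1 := congrFun h Finset.univ
    rw [Finset.insert_erase (Finset.mem_univ t)] at h1
    change unitEval K hmn t (c Finset.univ) = _ at h1
    rw [h1, Pi.smul_apply, Pi.single_eq_same, zsmul_eq_mul, mul_one]
    intro h0
    have h2 : ((e * e : ℤ) : K) = 1 := by rw [he, Int.cast_one]
    rw [Int.cast_mul, h0, zero_mul] at h2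
    exact zero_ne_one h2
  · have hl : ∀ (L : List (Fin m)) v, ((L.map (Fin.castLE hmn)).map (cokG (gx K m n))).prod
        ((relJ (gx K m n)).mkQ v) = (relJ (gx K m n)).mkQ ((L.map T).prod v) := by
      intro L
      induction L with
      | nil => intro v; rfl
      | cons a L ih =>
        intro v
        simp only [List.map_cons, List.prod_cons, Module.End.mul_apply, ih]
        rw [cokG_mk]
    rw [hl]
    change (relJ (gx K m n)).mkQ c = _
    rw [top, ← map_smul]
    refine congrArg _ (hc'.trans ?_)
    rw [← map_smul, smul_eq_mul, mul_one]

lemma cokL_sng_singleton (i t : Fin m) :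
    cokL (gx K m n) i ((relJ (gx K m n)).mkQ (sng (MvPolynomial (Fin m × Fin n) K) {t} 1)) = 0 := by
  rw [cokL_mk, Submodule.mkQ_apply, Submodule.Quotient.mk_eq_zero]
  change iot _ i (Pi.single {t} 1) ∈ _
  rw [iot_single]
  split_ifs with h
  · rw [Finset.mem_singleton] at h
    subst h
    rw [Finset.erase_singleton]
    exact zsmul_mem (sng_empty_mem _ _) _
  · exact zero_mem _

end Minor

section CoeffMap
open MvPolynomial

variable {S : Type*} [CommRing S] {m k : ℕ} {N : Type*} [AddCommGroup N] [Module S N]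

/-- Apply a map from the exterior algebra to the coefficients of a polynomial family. -/
def cfm (F : (Finset (Fin k) → S) →ₗ[S] N) :
    (Finset (Fin k) → MvPolynomial (Fin m) S) →ₗ[S] Pol m N where
  toFun c := Finsupp.onFinset (Finset.univ.biUnion fun I => (c I).support)
    (fun ν => F fun I => coeff ν (c I)) fun ν hν => by
      by_contra hh
      refine hν ?_
      have : (fun I => coeff ν (c I)) = 0 := by
        funext I
        by_contra h0
        exact hh (Finset.mem_biUnion.2 ⟨I, Finset.mem_univ _, mem_support_iff.2 h0⟩)
      rw [this, map_zero]
  map_add' c d := Finsupp.ext fun ν => by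
    rw [Finsupp.add_apply]
    simp only [Finsupp.onFinset_apply, ← map_add]
    exact congrArg _ (funext fun I => by simp)
  map_smul' s c := Finsupp.ext fun ν => by
    rw [Finsupp.smul_apply]
    simp only [Finsupp.onFinset_apply, ← map_smul, RingHom.id_apply]
    exact congrArg _ (funext fun I => by simp)

variable (F : (Finset (Fin k) → S) →ₗ[S] N)

lemma cfm_apply (c : Finset (Fin k) → MvPolynomial (Fin m) S) (ν : Fin m →₀ ℕ) :
    cfm F c ν = F fun I => coeff ν (c I) := rfl

lemma cfm_X (i : Fin m) (c : Finset (Fin k) → MvPolynomial (Fin m) S) :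
    cfm F ((X i : MvPolynomial (Fin m) S) • c) = yv S i (cfm F c) := by
  refine Finsupp.ext fun ν => ?_
  rw [yv_apply, cfm_apply, cfm_apply]
  simp only [Pi.smul_apply, smul_eq_mul, coeff_X_mul', Finsupp.mem_support_iff]
  by_cases h : ν i = 0
  · simp only [h, ne_eq, not_true_eq_false, if_false, if_true]
    exact map_zero F
  · simp only [h, ne_eq, not_false_eq_true, if_false, if_true]

lemma cfm_X_pow (i : Fin m) (r : ℕ) (c : Finset (Fin k) → MvPolynomial (Fin m) S) :
    cfm F ((X i : MvPolynomial (Fin m) S) ^ r • c) = (yv S i ^ r) (cfm F c) := by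
  induction r with
  | zero => simp
  | succ r ih => rw [pow_succ', mul_smul, cfm_X, ih, pow_succ', Module.End.mul_apply]

lemma cfm_C (c : Finset (Fin k) → S) :
    cfm F (fun I => (C (c I) : MvPolynomial (Fin m) S)) = Finsupp.single 0 (F c) := by
  refine Finsupp.ext fun ν => ?_
  rw [cfm_apply, Finsupp.single_apply]
  simp only [coeff_C]
  split_ifs with h
  · rfl
  · exact map_zero F

end CoeffMap

section Tor
open MvPolynomial

variable {K : Type} [Field K] {m n : ℕ} {A : Type} [Ring A]
  [Algebra (MvPolynomial (Fin m × Fin n) K) A]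
  {ev : ℕ → A} {l : Fin m → A} {g : Fin n → A}

/-- The structure map on the polynomials of a model. -/
abbrev Model.cf (M : Model (gx K m n) ev l g) :
    (Finset (Fin m) → RowPol K m n) →ₗ[MvPolynomial (Fin m × Fin n) K] Pol m A :=
  cfm (M.th ∘ₗ (relJ (gx K m n)).mkQ)

lemma Model.cf_mem (M : Model (gx K m n) ev l g) (h : Rep ev l g)
    (hx : ∀ i j, algebraMap (MvPolynomial (Fin m × Fin n) K) A (gx K m n i j)
      = l i * g j + g j * l i)
    (d : Finset (Fin m) → RowPol K m n) (hd : ∀ I, d I ∈ rowIdeal K m n) :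
    M.cf d ∈ LinearMap.range (dif fun i => mr (MvPolynomial (Fin m × Fin n) K) (l i)) := by
  have key : ∀ p ∈ rowIdeal K m n, ∀ I (r : RowPol K m n), M.cf (Pi.single I (r * p)) ∈
      LinearMap.range (dif fun i => mr (MvPolynomial (Fin m × Fin n) K) (l i)) := by
    intro p hp
    refine Submodule.span_induction ?_ ?_ ?_ ?_ hp
    · rintro _ ⟨j, rfl⟩ I r
      refine ⟨pw (mr (MvPolynomial (Fin m × Fin n) K) (g j)) (M.cf (Pi.single I r)), ?_⟩
      rw [h.dif_mul_g hx j _ fun ν => M.th_ev _]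
      have : (Pi.single I (r * ∑ i : Fin m, X i * C (gx K m n i j)) :
          Finset (Fin m) → RowPol K m n) =
          ∑ i : Fin m, (X i : RowPol K m n) • gx K m n i j • Pi.single I r := by
        change sng (RowPol K m n) I _ = _
        rw [Finset.mul_sum, map_sum]
        refine Finset.sum_congr rfl fun i _ => ?_
        rw [← Pi.single_smul, ← Pi.single_smul, smul_eq_C_mul, smul_eq_mul]
        refine congrArg (Pi.single I) ?_
        ring
      rw [this, map_sum]
      exact Finset.sum_congr rfl fun i _ => by
        rw [cfm_X]; exact congrArg _ (map_smul _ _ _).symm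
    · intro I r; rw [mul_zero, Pi.single_zero, map_zero]; exact zero_mem _
    · intro p q _ _ hp hq I r
      rw [mul_add, Pi.single_add, map_add]
      exact add_mem (hp I r) (hq I r)
    · intro a p _ hp I r
      rw [smul_eq_mul, ← mul_assoc]
      exact hp I _
  have : d = ∑ I, Pi.single I (1 * d I) := by
    simp only [one_mul, Finset.univ_sum_single]
  rw [this, map_sum]
  exact Submodule.sum_mem _ fun I _ => key _ (hd I) I 1

lemma Model.cf_con (M : Model (gx K m n) ev l g) (c : Finset (Fin m) → RowPol K m n) :
    M.cf (con (fun i => X i) c) = dif (fun i => mr (MvPolynomial (Fin m × Fin n) K) (l i))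
      (cfm M.thn c) := by
  rw [con, map_sum, dif_eq]
  refine Finset.sum_congr rfl fun k _ => ?_
  rw [cfm_X]
  congr 1
  refine Finsupp.ext fun ν => ?_
  rw [pw_apply, cfm_apply, cfm_apply, LinearMap.mulRight_apply, M.thn_l, ← M.th_act, M.act_l,
    cokL_mk, LinearMap.comp_apply]
  refine congrArg _ (congrArg _ (funext fun I => ?_))
  simp only [iot_apply]
  split_ifs
  · exact map_zero (coeffAddMonoidHom (R := MvPolynomial (Fin m × Fin n) K) ν)
  · exact (map_zsmul
      (coeffAddMonoidHom (R := MvPolynomial (Fin m × Fin n) K) ν) _ _).symm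

lemma ext_con {R L : Type*} [CommRing R] [CommRing L] (ρ : R →+* L) (y : Fin m → R)
    (c : Finset (Fin m) → R) : ext ρ (con y c) = con (fun i => ρ (y i)) (ext ρ c) := by
  simp only [con, ext_sum, ext_smul, ext_iot]

variable [Algebra K A] [IsScalarTower K (MvPolynomial (Fin m × Fin n) K) A]

theorem Model.chart_con (M : Model (gx K m n) ev l g) (h : IsPA K ev l g)
    (hx : ∀ i j, algebraMap (MvPolynomial (Fin m × Fin n) K) A (gx K m n i j)
      = l i * g j + g j * l i) (hmn : m ≤ n)
    (f : Module.End (MvPolynomial (Fin m × Fin n) K) (Cok (gx K m n))) (q : Fin m → A)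
    (hqf : ∀ i, M.act (q i) (top (gx K m n)) = f (cokL (gx K m n) i (top (gx K m n))))
    (ω : Fin m → Finset (Fin m) → MvPolynomial (Fin m × Fin n) K)
    (hω : ∀ i, (relJ (gx K m n)).mkQ (ω i) = M.act (q i) (top (gx K m n)))
    (t : Fin m) (I : Finset (Fin m)) :
    chart K m n t (con (fun i => X i) (∑ i, (X i : RowPol K m n) • fun I => C (ω i I)) I) = 0 := by
  obtain ⟨J, s, hs0, hJ⟩ := exists_minor (K := K) hmn t
  obtain ⟨w, hw⟩ := M.contract_mem h.rep hx (fun i => cokL_sng_singleton i t) J f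
  rw [hJ] at hw
  have hw' : ∀ i, s • M.act (q i) (top (gx K m n)) = M.act (w 0 * l i) (top (gx K m n)) := by
    intro i
    have h1 := DFunLike.congr_fun hw (ex i)
    rw [dif_ex, Finsupp.finsetSum_apply, Finset.sum_eq_single i, Finsupp.single_eq_same,
      LinearMap.mulRight_apply] at h1
    · rw [h1, M.act_th, hqf, map_smul, map_smul]
    · intro j _ hj
      rw [Finsupp.single_apply, if_neg]
      intro hh
      have := DFunLike.congr_fun hh j
      simp [ex, hj] at this
    · simp
  obtain ⟨β, hβ, hadd, hsm⟩ := exists_contract (x := gx K m n) (chartS K m n t) (rowVar K m n)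
    (sum_rowVar_mul_chartS t)
  have h2 := M.contract_left_mul (chartS K m n t) (rowVar K m n) h (sum_rowVar_mul_chartS t) hβ
    hadd hsm (w 0)
  simp only [← hw', hsm, smul_comm (rowVar K m n _) (chartS K m n t s), ← Finset.smul_sum,
    ← hω, hβ] at h2
  rw [smul_eq_zero_iff_right hs0] at h2
  have h3 : ext (chart K m n t) (con (fun i => X i)
      (∑ i, (X i : RowPol K m n) • fun I => C (ω i I))) = 0 := by
    have h4 : ∀ i, ext (chart K m n t) (fun I => C (ω i I)) = ext (chartS K m n t) (ω i) :=
      fun i => by funext I; simp only [ext, chart_C]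
    rw [ext_con, ext_sum]
    simp only [ext_smul, chart_X, h4, con_sum, con_smul]
    exact h2
  exact congrFun h3 I

theorem Model.exists_dif (M : Model (gx K m n) ev l g) (h : IsPA K ev l g)
    (hx : ∀ i j, algebraMap (MvPolynomial (Fin m × Fin n) K) A (gx K m n i j)
      = l i * g j + g j * l i)
    (hg : Good (fun i => mr (MvPolynomial (Fin m × Fin n) K) (l i))
      (fun a => mr (MvPolynomial (Fin m × Fin n) K) (ev a))) (hmn : m ≤ n)
    (f : Module.End (MvPolynomial (Fin m × Fin n) K) (Cok (gx K m n))) (q : Fin m → A)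
    (hq : ∀ i, M.act (q i) = f * cokL (gx K m n) i * cokE (gx K m n) m)
    (hqe : ∀ i, q i * ev m = q i) :
    ∃ w, dif (fun i => mr (MvPolynomial (Fin m × Fin n) K) (l i)) w
      = ∑ i, Finsupp.single (ex i) (q i) := by
  rcases eq_or_ne m 0 with rfl | hm
  · exact ⟨0, by simp⟩
  have hqt : ∀ i, M.th (M.act (q i) (top (gx K m n))) = q i := by
    intro i; rw [M.th_act, M.th_top, hqe]
  have hqf : ∀ i, M.act (q i) (top (gx K m n)) = f (cokL (gx K m n) i (top (gx K m n))) := by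
    intro i
    rw [hq, Module.End.mul_apply, Module.End.mul_apply, cokE_top]
  choose ω hω using fun i => (relJ (gx K m n)).mkQ_surjective (M.act (q i) (top (gx K m n)))
  set Ω : Finset (Fin m) → RowPol K m n :=
    ∑ i, (X i : RowPol K m n) • fun I => C (ω i I) with hΩ
  have hcf : M.cf Ω = ∑ i, Finsupp.single (ex i) (q i) := by
    rw [hΩ, map_sum]
    refine Finset.sum_congr rfl fun i _ => ?_
    rw [cfm_X, cfm_C, yv_single, zero_add, LinearMap.comp_apply, hω, hqt]
  have hs := h.rep.isSys (R := MvPolynomial (Fin m × Fin n) K)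
  have hchart := M.chart_con h hx hmn f q hqf ω hω
  have hmem : M.cf Ω ∈ bdry (fun i => mr (MvPolynomial (Fin m × Fin n) K) (l i))
      (fun a => mr (MvPolynomial (Fin m × Fin n) K) (ev a)) := by
    refine mem_of_pow_mem _ (yv _) yv_comm yv_mem_bdry (fun v hv => hg.sf hs v hv) _ fun t => ?_
    choose N hN using fun I => exists_pow_mul_mem t (hchart t I)
    have hN' : ∀ I, ((X t : RowPol K m n) ^ (∑ I, N I) • con (fun i => X i) Ω) I
        ∈ rowIdeal K m n := by
      intro I
      rw [Pi.smul_apply, smul_eq_mul, ← Finset.add_sum_erase _ _ (Finset.mem_univ I), pow_add,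
        mul_comm (X t ^ N I), mul_assoc]
      exact Ideal.mul_mem_left _ _ (hN I)
    refine ⟨(∑ I, N I) + 1, ?_⟩
    rw [← cfm_X_pow, pow_succ', mul_smul, ← con_eps (fun i => X i) t, map_add, con_smul]
    refine add_mem ?_ ?_
    · rw [M.cf_con]; exact hs.dif_mem_bdry hm _
    · obtain ⟨v, hv⟩ := M.cf_mem h.rep hx (eps (RowPol K m n) t
        ((X t : RowPol K m n) ^ (∑ I, N I) • con (fun i => X i) Ω)) (fun I => by
          rw [eps_apply]
          split_ifs
          · exact zsmul_mem (hN' _) _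
          · exact zero_mem _)
      rw [← hv]; exact hs.dif_mem_bdry hm _
  obtain ⟨w, hw⟩ := mem_bdry.1 hmem
  refine ⟨w, hw.trans ?_⟩
  rw [hcf, map_sum]
  exact Finset.sum_congr rfl fun i _ => by rw [pw_single, LinearMap.mulRight_apply, hqe]

end Tor

section Iso
open MvPolynomial

variable {K : Type} [Field K] {m n : ℕ} {A : Type} [Ring A] [Algebra K A]
  {ev : ℕ → A} {l : Fin m → A} {g : Fin n → A}

/-- The action of the polynomial ring through the central elements `l i * g j + g j * l i`. -/
def IsPA.polyHom (h : IsPA K ev l g) : MvPolynomial (Fin m × Fin n) K →ₐ[K] A :=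
  (Subalgebra.center K A).val.comp (aeval fun p => ⟨l p.1 * g p.2 + g p.2 * l p.1,
    Subalgebra.mem_center_iff.2 fun w => h.x_central p.1 p.2 w⟩)

lemma IsPA.polyHom_gx (h : IsPA K ev l g) (i : Fin m) (j : Fin n) :
    h.polyHom (gx K m n i j) = l i * g j + g j * l i := by
  simp [IsPA.polyHom]

lemma IsPA.polyHom_comm (h : IsPA K ev l g) (s : MvPolynomial (Fin m × Fin n) K) (w : A) :
    h.polyHom s * w = w * h.polyHom s :=
  (Subalgebra.mem_center_iff.1 (aeval (fun p : Fin m × Fin n =>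
    (⟨l p.1 * g p.2 + g p.2 * l p.1, Subalgebra.mem_center_iff.2 fun w => h.x_central p.1 p.2 w⟩ :
      Subalgebra.center K A)) s).2 w).symm

lemma good_mr {S S' : Type*} [CommRing S] [CommRing S'] [Algebra S A] [Algebra S' A]
    (h : Good (fun i => mr S (l i)) (fun a => mr S (ev a))) :
    Good (fun i => mr S' (l i)) (fun a => mr S' (ev a)) := by
  have hd : ∀ w : Pol m A, dif (fun i => mr S (l i)) w = dif (fun i => mr S' (l i)) w := by
    intro w
    refine Finsupp.ext fun ν => ?_
    rw [dif_apply, dif_apply]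
    rfl
  intro a ha z hz h0
  obtain ⟨w, hw⟩ := h a ha z (by rw [← hz]; rw [hz]; refine Eq.trans ?_ hz; rfl) (by rw [hd, h0])
  exact ⟨w, by rw [← hd, hw]⟩

/-- The path algebra acts by all endomorphisms of the cokernel. -/
theorem IsPA.exists_equiv (h : IsPA K ev l g)
    (hg : Good (fun i => mr K (l i)) (fun a => mr K (ev a))) (hmn : m ≤ n) :
    ∃ Φ : A ≃ₐ[K] Module.End (MvPolynomial (Fin m × Fin n) K) (Cok (gx K m n)),
      ∀ a, Φ (ev a) = cokE (gx K m n) a := by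
  let _ : Algebra (MvPolynomial (Fin m × Fin n) K) A :=
    (h.polyHom : MvPolynomial (Fin m × Fin n) K →+* A).toAlgebra' h.polyHom_comm
  have _ : IsScalarTower K (MvPolynomial (Fin m × Fin n) K) A :=
    IsScalarTower.of_algebraMap_eq fun k => (h.polyHom.commutes k).symm
  obtain ⟨M⟩ := h.exists_model h.polyHom_gx
  have hg' := good_mr (S' := MvPolynomial (Fin m × Fin n) K) hg
  refine ⟨AlgEquiv.ofBijective (M.act.restrictScalars K) ⟨M.injective h.rep hg',
    M.surjective h.rep hg' fun f q hq hqe => M.exists_dif h h.polyHom_gx hg' hmn f q hq hqe⟩,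
    fun a => M.act_ev a⟩

end Iso

section Exterior

variable (R : Type*) [CommRing R] (k : ℕ)

/-- Exterior multiplication by a vector, in coordinates. -/
def epsV : (Fin k → R) →ₗ[R] Module.End R (Finset (Fin k) → R) :=
  ∑ i, (LinearMap.toSpanSingleton R _ (eps R i)) ∘ₗ LinearMap.proj i

variable {R k}

lemma epsV_apply (v : Fin k → R) : epsV R k v = ∑ i, v i • eps R i := by
  simp [epsV]

lemma epsV_mul_self (v : Fin k → R) : epsV R k v * epsV R k v = 0 := by
  rw [epsV_apply, Finset.sum_mul_sum]
  refine sum_sum_alt _ (fun i => ?_) fun i j => ?_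
  · rw [smul_mul_smul_comm, eps_sq, smul_zero]
  · rw [smul_mul_smul_comm, smul_mul_smul_comm, mul_comm (v j), ← smul_add, eps_anticomm, smul_zero]

/-- The coordinates of an element of the exterior algebra. -/
def extTo : ExteriorAlgebra R (Fin k → R) →ₗ[R] (Finset (Fin k) → R) :=
  LinearMap.applyₗ (sng R ∅ 1) ∘ₗ
    (ExteriorAlgebra.lift R ⟨epsV R k, epsV_mul_self⟩).toLinearMap

lemma extTo_one : extTo (1 : ExteriorAlgebra R (Fin k → R)) = sng R ∅ 1 := by
  simp [extTo]

lemma extTo_algebraMap (r : R) :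
    extTo (algebraMap R (ExteriorAlgebra R (Fin k → R)) r) = sng R ∅ r := by
  rw [Algebra.algebraMap_eq_smul_one, map_smul, extTo_one, ← map_smul, smul_eq_mul, mul_one]

lemma extTo_ι_mul (v : Fin k → R) (η : ExteriorAlgebra R (Fin k → R)) :
    extTo (ExteriorAlgebra.ι R v * η) = ∑ i, v i • eps R i (extTo η) := by
  simp [extTo, epsV_apply, LinearMap.sum_apply]

/-- Left multiplication by a basis vector. -/
def basMul (i : Fin k) : Module.End R (ExteriorAlgebra R (Fin k → R)) :=
  LinearMap.mulLeft R (ExteriorAlgebra.ι R (Pi.single i 1))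

lemma basMul_apply (i : Fin k) (η : ExteriorAlgebra R (Fin k → R)) :
    basMul i η = ExteriorAlgebra.ι R (Pi.single i 1) * η := rfl

lemma antiSq_basMul : AntiSq (basMul (R := R) (k := k)) := by
  refine ⟨fun i => LinearMap.ext fun η => ?_, fun i j => LinearMap.ext fun η => ?_⟩
  · rw [Module.End.mul_apply, basMul_apply, basMul_apply, ← mul_assoc,
      ExteriorAlgebra.ι_sq_zero, zero_mul, LinearMap.zero_apply]
  · rw [LinearMap.add_apply, Module.End.mul_apply, Module.End.mul_apply, basMul_apply,
      basMul_apply, basMul_apply, basMul_apply, ← mul_assoc, ← mul_assoc, ← add_mul,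
      ExteriorAlgebra.ι_add_mul_swap, zero_mul, LinearMap.zero_apply]

/-- The element of the exterior algebra with given coordinates. -/
def extOf : (Finset (Fin k) → R) →ₗ[R] ExteriorAlgebra R (Fin k → R) :=
  mu basMul ∘ₗ cmap (Algebra.linearMap R (ExteriorAlgebra R (Fin k → R)))

lemma extOf_sng (Q : Finset (Fin k)) (s : R) :
    extOf (sng R Q s) = ordProd basMul Q (algebraMap R _ s) := by
  rw [extOf, LinearMap.comp_apply, cmap_sng]
  exact mu_single _ _ _

lemma extOf_eps (i : Fin k) (c : Finset (Fin k) → R) :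
    extOf (eps R i c) = ExteriorAlgebra.ι R (Pi.single i 1) * extOf c := by
  rw [extOf, LinearMap.comp_apply, cmap_eps, antiSq_basMul.mu_eps]
  rfl

lemma ι_eq_sum (v : Fin k → R) :
    ExteriorAlgebra.ι R v = ∑ i, v i • ExteriorAlgebra.ι R (Pi.single i 1 : Fin k → R) := by
  conv_lhs => rw [← Finset.univ_sum_single v, map_sum]
  refine Finset.sum_congr rfl fun i _ => ?_
  rw [← map_smul, ← Pi.single_smul, smul_eq_mul, mul_one]

lemma extOf_extTo (η : ExteriorAlgebra R (Fin k → R)) : extOf (extTo η) = η := by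
  refine CliffordAlgebra.left_induction (P := fun η => extOf (extTo (k := k) (R := R) η) = η)
    _ (fun r => ?_) (fun a b ha hb => ?_) (fun η v ih => ?_) η
  · refine (congrArg _ (extTo_algebraMap r)).trans ?_
    rw [extOf_sng, ordProd_empty]; rfl
  · rw [map_add, map_add, ha, hb]
  · change extOf (extTo (ExteriorAlgebra.ι R v * η)) = ExteriorAlgebra.ι R v * η
    rw [extTo_ι_mul, map_sum, ι_eq_sum, Finset.sum_mul]
    refine Finset.sum_congr rfl fun i _ => ?_
    rw [map_smul, extOf_eps, ih, smul_mul_assoc]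

lemma extTo_ordProd (Q : Finset (Fin k)) (s : R) :
    extTo (ordProd basMul Q (algebraMap R (ExteriorAlgebra R (Fin k → R)) s)) = sng R Q s := by
  induction Q using Finset.induction_on_min with
  | empty => rw [ordProd_empty, Module.End.one_apply, extTo_algebraMap]
  | insert q Q hq ih =>
    rw [ordProd_insert _ hq, Module.End.mul_apply, basMul_apply, extTo_ι_mul, ih,
      Finset.sum_eq_single q]
    · rw [Pi.single_eq_same, one_smul]
      refine (eps_single q Q s).trans ?_
      rw [if_neg fun hh => lt_irrefl _ (hq q hh), sg_eq_one fun j hj => (hq j hj).le, one_smul]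
      rfl
    · intro i _ hi
      rw [Pi.single_eq_of_ne hi, zero_smul]
    · simp

lemma extTo_extOf (c : Finset (Fin k) → R) : extTo (extOf c) = c := by
  suffices extTo ∘ₗ extOf = (LinearMap.id : Module.End R (Finset (Fin k) → R)) from
    LinearMap.congr_fun this c
  refine LinearMap.pi_ext fun Q s => ?_
  rw [LinearMap.comp_apply, LinearMap.id_apply]
  exact (congrArg _ (extOf_sng Q s)).trans (extTo_ordProd Q s)

lemma degp_extTo (a : ℕ) (η : ExteriorAlgebra R (Fin k → R)) (h : η ∈ ⋀[R]^a (Fin k → R)) :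
    degp (R := R) a (extTo η) = extTo η := by
  induction a generalizing η with
  | zero =>
    rw [ExteriorAlgebra.exteriorPower, pow_zero, Submodule.mem_one] at h
    obtain ⟨r, rfl⟩ := h
    rw [extTo_algebraMap]
    funext I
    rw [degp_apply, sng_apply]
    by_cases hI : I = ∅ <;> simp [hI]
  | succ a ih =>
    rw [ExteriorAlgebra.exteriorPower, pow_succ'] at h
    refine Submodule.mul_induction_on h ?_ ?_
    · rintro _ ⟨v, rfl⟩ η hη
      rw [extTo_ι_mul, map_sum]
      exact Finset.sum_congr rfl fun i _ => by rw [map_smul, degp_eps, ih η hη]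
    · intro x y hx hy
      rw [map_add, map_add, hx, hy]

lemma extOf_mem (a : ℕ) (c : Finset (Fin k) → R) (h : degp (R := R) a c = c) :
    extOf c ∈ ⋀[R]^a (Fin k → R) := by
  have key : ∀ (Q : Finset (Fin k)) (s : R), ordProd basMul Q
      (algebraMap R (ExteriorAlgebra R (Fin k → R)) s) ∈ ⋀[R]^(Q.card) (Fin k → R) := by
    intro Q s
    induction Q using Finset.induction_on_min with
    | empty =>
      rw [ordProd_empty, Finset.card_empty, ExteriorAlgebra.exteriorPower, pow_zero]
      exact Submodule.algebraMap_mem s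
    | insert q Q hq ih =>
      rw [ordProd_insert _ hq, Finset.card_insert_of_notMem fun hh => lt_irrefl _ (hq q hh),
        ExteriorAlgebra.exteriorPower, pow_succ']
      exact Submodule.mul_mem_mul (LinearMap.mem_range_self _ _) ih
  rw [extOf, LinearMap.comp_apply, mu_apply]
  refine Submodule.sum_mem _ fun Q _ => ?_
  rw [cmap_apply, ← h, degp_apply]
  split_ifs with hQ
  · rw [← hQ]; exact key Q _
  · rw [map_zero, map_zero]; exact zero_mem _

variable {m n : ℕ} (x : Fin m → Fin n → R) (f : (Fin n → R) →ₗ[R] (Fin m → R))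
  (hf : ∀ v i, f v i = ∑ j, x i j * v j)

include hf

lemma extTo_map (η : ExteriorAlgebra R (Fin n → R)) :
    extTo (ExteriorAlgebra.map f η) = relMap x (extTo η) := by
  refine CliffordAlgebra.left_induction
    (P := fun η => extTo (ExteriorAlgebra.map f η) = relMap x (extTo η))
    _ (fun r => ?_) (fun a b ha hb => ?_) (fun η v ih => ?_) η
  · change extTo (ExteriorAlgebra.map f (algebraMap R _ r)) = relMap x (extTo (algebraMap R _ r))
    rw [AlgHom.commutes, extTo_algebraMap, extTo_algebraMap, relMap_apply, cmap_sng]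
    exact (mu_single_empty _ _).symm
  · rw [map_add, map_add, map_add, map_add, ha, hb]
  · change extTo (ExteriorAlgebra.map f (ExteriorAlgebra.ι R v * η))
      = relMap x (extTo (ExteriorAlgebra.ι R v * η))
    rw [map_mul, ExteriorAlgebra.map_apply_ι, extTo_ι_mul, extTo_ι_mul, ih, map_sum]
    simp only [map_smul, relMap_eps, gop_apply, hf, Finset.sum_smul, Finset.smul_sum, smul_smul]
    rw [Finset.sum_comm]
    simp only [mul_comm]

end Exterior

section Cokernel

variable {R : Type*} [CommRing R] {m n : ℕ} (x : Fin m → Fin n → R)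
  (f : (Fin n → R) →ₗ[R] (Fin m → R))

/-- The elements of the exterior power in the image of the map of exterior powers. -/
abbrev powRel (a : ℕ) : Submodule R (⋀[R]^a (Fin m → R)) :=
  Submodule.comap (⋀[R]^a (Fin m → R)).subtype
    (Submodule.map (ExteriorAlgebra.map f).toLinearMap (⋀[R]^a (Fin n → R)))

variable {f} (hf : ∀ v i, f v i = ∑ j, x i j * v j)

include hf

lemma mem_powRel (a : ℕ) (η : ⋀[R]^a (Fin m → R)) :
    η ∈ powRel f a ↔ extTo (η : ExteriorAlgebra R (Fin m → R)) ∈ relJ x := by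
  constructor
  · rintro ⟨ζ, _, hζ⟩
    refine ⟨extTo ζ, ?_⟩
    rw [← extTo_map x f hf]
    exact congrArg _ hζ
  · rintro ⟨c, hc⟩
    refine ⟨extOf (degp (R := R) a c), extOf_mem a _ (degp_idem _ _), ?_⟩
    have h1 : extTo (ExteriorAlgebra.map f (extOf (degp (R := R) a c)))
        = extTo (η : ExteriorAlgebra R (Fin m → R)) := by
      rw [extTo_map x f hf, extTo_extOf, ← relMap_degp, hc, degp_extTo a _ η.2]
    have h2 := congrArg extOf h1
    rw [extOf_extTo, extOf_extTo] at h2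
    exact h2

/-- The cokernel in one degree, inside the total cokernel. -/
def powCok (a : ℕ) : (⋀[R]^a (Fin m → R) ⧸ powRel f a) →ₗ[R] Cok x :=
  (powRel f a).liftQ ((relJ x).mkQ ∘ₗ extTo ∘ₗ (⋀[R]^a (Fin m → R)).subtype) fun η hη => by
    rw [LinearMap.mem_ker]
    exact (Submodule.Quotient.mk_eq_zero _).2 ((mem_powRel x hf a η).1 hη)

lemma powCok_mkQ (a : ℕ) (η : ⋀[R]^a (Fin m → R)) :
    powCok x hf a ((powRel f a).mkQ η)
      = (relJ x).mkQ (extTo (η : ExteriorAlgebra R (Fin m → R))) := rfl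

lemma powCok_injective (a : ℕ) : Function.Injective (powCok x hf a) := by
  refine (injective_iff_map_eq_zero _).2 fun v hv => ?_
  obtain ⟨η, rfl⟩ := (powRel f a).mkQ_surjective v
  rw [powCok_mkQ] at hv
  exact (Submodule.Quotient.mk_eq_zero _).2
    ((mem_powRel x hf a η).2 ((Submodule.Quotient.mk_eq_zero _).1 hv))

lemma cokE_powCok (a : ℕ) (v : ⋀[R]^a (Fin m → R) ⧸ powRel f a) :
    cokE x a (powCok x hf a v) = powCok x hf a v := by
  obtain ⟨η, rfl⟩ := (powRel f a).mkQ_surjective v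
  rw [powCok_mkQ, cokE_mk, degp_extTo a _ η.2]

lemma exists_powCok (a : ℕ) (v : Cok x) : ∃ w, powCok x hf a w = cokE x a v := by
  obtain ⟨c, rfl⟩ := (relJ x).mkQ_surjective v
  refine ⟨(powRel f a).mkQ ⟨extOf (degp (R := R) a c), extOf_mem a _ (degp_idem _ _)⟩, ?_⟩
  rw [powCok_mkQ, extTo_extOf, cokE_mk]

/-- The sum of the cokernels in all positive degrees, mapped to the total cokernel. -/
def sumCok : (⨁ v : Fin m, ⋀[R]^(v.1 + 1) (Fin m → R) ⧸ powRel f (v.1 + 1)) →ₗ[R] Cok x :=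
  DirectSum.toModule R (Fin m) _ fun v => powCok x hf (v.1 + 1)

lemma sumCok_lof (v : Fin m) (z : ⋀[R]^(v.1 + 1) (Fin m → R) ⧸ powRel f (v.1 + 1)) :
    sumCok x hf (DirectSum.lof R (Fin m) (fun v : Fin m =>
      ⋀[R]^(v.1 + 1) (Fin m → R) ⧸ powRel f (v.1 + 1)) v z) = powCok x hf (v.1 + 1) z := by
  rw [sumCok, DirectSum.toModule_lof]

lemma cokE_sumCok (w : Fin m)
    (z : ⨁ v : Fin m, ⋀[R]^(v.1 + 1) (Fin m → R) ⧸ powRel f (v.1 + 1)) :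
    cokE x (w.1 + 1) (sumCok x hf z) = powCok x hf (w.1 + 1) (DirectSum.component R (Fin m)
      (fun v : Fin m => ⋀[R]^(v.1 + 1) (Fin m → R) ⧸ powRel f (v.1 + 1)) w z) := by
  suffices cokE x (w.1 + 1) ∘ₗ sumCok x hf = powCok x hf (w.1 + 1) ∘ₗ DirectSum.component R (Fin m)
      (fun v : Fin m => ⋀[R]^(v.1 + 1) (Fin m → R) ⧸ powRel f (v.1 + 1)) w from
    LinearMap.congr_fun this z
  refine DirectSum.linearMap_ext R fun v => LinearMap.ext fun y => ?_
  simp only [LinearMap.comp_apply]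
  rw [sumCok_lof, ← cokE_powCok, ← Module.End.mul_apply, (cok_rep x).ev_mul]
  by_cases h : v = w
  · subst h
    rw [if_pos rfl, DirectSum.component.lof_self, cokE_powCok]
  · rw [if_neg fun hh => h (Fin.ext (by omega)), DirectSum.component.of, dif_neg h, map_zero,
      LinearMap.zero_apply]

lemma sumCok_bijective : Function.Bijective (sumCok x hf) := by
  constructor
  · intro z z' hz
    refine DirectSum.ext_component R fun w => powCok_injective x hf _ ?_
    rw [← cokE_sumCok, ← cokE_sumCok, hz]
  · intro v
    have h := LinearMap.congr_fun (cok_rep x).sum_ev v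
    rw [LinearMap.sum_apply, Module.End.one_apply, Finset.sum_range_succ', (cok_rep x).ev_zero,
      LinearMap.zero_apply, add_zero, ← Fin.sum_univ_eq_sum_range (fun a => cokE x (a + 1) v)] at h
    choose w hw using fun a => exists_powCok x hf a v
    refine ⟨∑ a : Fin m, DirectSum.lof R (Fin m) (fun v : Fin m =>
      ⋀[R]^(v.1 + 1) (Fin m → R) ⧸ powRel f (v.1 + 1)) a (w (a.1 + 1)), ?_⟩
    rw [map_sum, ← h]
    exact Finset.sum_congr rfl fun a _ => by rw [sumCok_lof, hw]

end Cokernel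

section Final

variable (K : Type) [Field K] (m n : ℕ)

lemma genφ_apply (v : Fin n → detS K m n) (i : Fin m) :
    genφ K m n v i = ∑ j, gx K m n i j * v j := by
  rw [genφ, Matrix.toLin'_apply]
  rfl

/-- The direct sum of the modules, as the total cokernel. -/
def detMEquiv : detM K m n ≃ₗ[detS K m n] Cok (gx K m n) :=
  LinearEquiv.ofBijective (sumCok (gx K m n) (genφ_apply K m n))
    (sumCok_bijective (gx K m n) (genφ_apply K m n))

lemma detMEquiv_proj (v : Fin m) (z : detM K m n) :
    (detMEquiv K m n).symm (cokE (gx K m n) (v.1 + 1) (detMEquiv K m n z)) =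
      DirectSum.lof (detS K m n) (Fin m) (fun v => detMa K m n (v.1 + 1)) v
        (DirectSum.component (detS K m n) (Fin m) (fun v => detMa K m n (v.1 + 1)) v z) := by
  rw [LinearEquiv.symm_apply_eq]
  exact (cokE_sumCok (gx K m n) (genφ_apply K m n) v z).trans
    (sumCok_lof (gx K m n) (genφ_apply K m n) v _).symm

end Final

section Iso

variable {K : Type} [Field K] {m n : ℕ}
  (Φ : PathAlg K m n ≃ₐ[K] Module.End (MvPolynomial (Fin m × Fin n) K) (Cok (gx K m n)))

/-- An isomorphism onto the endomorphisms of the total cokernel, transported to the direct sum. -/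
def detEIso : PathAlg K m n ≃+* detE K m n :=
  Φ.toRingEquiv.trans (detMEquiv K m n).symm.conjRingEquiv

lemma detEIso_apply (x : PathAlg K m n) (z : detM K m n) :
    detEIso Φ x z = (detMEquiv K m n).symm (Φ x (detMEquiv K m n z)) := rfl

lemma detEIso_algebraMap (k : K) :
    detEIso Φ (algebraMap K (PathAlg K m n) k) =
      algebraMap (detS K m n) (detE K m n) (algebraMap K (detS K m n) k) := by
  refine LinearMap.ext fun z => ?_
  rw [detEIso_apply, Φ.commutes, LinearEquiv.symm_apply_eq, Module.algebraMap_end_apply]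
  exact (algebraMap_smul (detS K m n) k _).symm.trans
    ((detMEquiv K m n).map_smul (algebraMap K (detS K m n) k) z).symm

lemma detEIso_pathE (hΦ : ∀ a, Φ (pev K m n a) = cokE (gx K m n) a) (v : Fin m)
    (z : detM K m n) :
    detEIso Φ (pathE K m n v) z =
      DirectSum.lof (detS K m n) (Fin m) (fun v => detMa K m n (v.1 + 1)) v
        (DirectSum.component (detS K m n) (Fin m) (fun v => detMa K m n (v.1 + 1)) v z) := by
  rw [detEIso_apply, ← pev_succ_eq_pathE, hΦ, detMEquiv_proj]

lemma detEIso_corner (hΦ : ∀ a, Φ (pev K m n a) = cokE (gx K m n) a) (a b : Fin m)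
    (x : PathAlg K m n) (z : detM K m n) :
    detEIso Φ (pathE K m n b * x * pathE K m n a) z =
      DirectSum.lof (detS K m n) (Fin m) (fun v => detMa K m n (v.1 + 1)) b
        (DirectSum.component (detS K m n) (Fin m) (fun v => detMa K m n (v.1 + 1)) b
          (detEIso Φ x
            (DirectSum.lof (detS K m n) (Fin m) (fun v => detMa K m n (v.1 + 1)) a
              (DirectSum.component (detS K m n) (Fin m)
                (fun v => detMa K m n (v.1 + 1)) a z)))) := by
  have h : detEIso Φ (pathE K m n b * x * pathE K m n a) z =
      detEIso Φ (pathE K m n b) (detEIso Φ x (detEIso Φ (pathE K m n a) z)) := by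
    rw [map_mul (detEIso Φ), map_mul (detEIso Φ)]
    rfl
  rw [h, ← detEIso_pathE Φ hΦ a z]
  exact detEIso_pathE Φ hΦ b _

end Iso

end DetPath

set_option synthInstance.maxHeartbeats 1000000 in
set_option maxHeartbeats 2000000 in
theorem detE_iso_path_algebra (K : Type) [Field K] (m n : ℕ) (hm : 0 < m) (hmn : m ≤ n) :
    ∃ ψ : PathAlg K m n ≃+* detE K m n,
      -- `ψ` is `K`-linear, i.e. an isomorphism of `K`-algebras:
      (∀ k : K, ψ (algebraMap K (PathAlg K m n) k)
          = algebraMap (detS K m n) (detE K m n) (algebraMap K (detS K m n) k)) ∧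
      -- classes of paths from vertex `a` to vertex `b` (i.e. elements `e_b x e_a`) are sent to
      -- homomorphisms `M_{a+1} → M_{b+1}`, and they span all of them:
      (∀ a b : Fin m,
        (∀ x : PathAlg K m n,
          ∃ h : detMa K m n (a.1 + 1) →ₗ[detS K m n] detMa K m n (b.1 + 1),
            ψ (pathE K m n b * x * pathE K m n a)
              = (DirectSum.lof (detS K m n) (Fin m) (fun v => detMa K m n (v.1 + 1)) b) ∘ₗ
                  h ∘ₗ (DirectSum.component (detS K m n) (Fin m)
                    (fun v => detMa K m n (v.1 + 1)) a)) ∧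
        (∀ h : detMa K m n (a.1 + 1) →ₗ[detS K m n] detMa K m n (b.1 + 1),
          ∃ x : PathAlg K m n,
            ψ (pathE K m n b * x * pathE K m n a)
              = (DirectSum.lof (detS K m n) (Fin m) (fun v => detMa K m n (v.1 + 1)) b) ∘ₗ
                  h ∘ₗ (DirectSum.component (detS K m n) (Fin m)
                    (fun v => detMa K m n (v.1 + 1)) a))) := by
  obtain ⟨Φ, hΦ⟩ := (DetPath.isPA_path K m n).exists_equiv (DetPath.good_path K m n) hmn
  refine ⟨DetPath.detEIso Φ, DetPath.detEIso_algebraMap Φ, fun a b => ⟨fun x => ?_, fun h => ?_⟩⟩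
  · refine ⟨(DirectSum.component (detS K m n) (Fin m) (fun v => detMa K m n (v.1 + 1)) b) ∘ₗ
      DetPath.detEIso Φ x ∘ₗ
        (DirectSum.lof (detS K m n) (Fin m) (fun v => detMa K m n (v.1 + 1)) a),
      LinearMap.ext fun z => ?_⟩
    rw [DetPath.detEIso_corner Φ hΦ]
    rfl
  · refine ⟨(DetPath.detEIso Φ).symm
      ((DirectSum.lof (detS K m n) (Fin m) (fun v => detMa K m n (v.1 + 1)) b) ∘ₗ h ∘ₗ
        (DirectSum.component (detS K m n) (Fin m) (fun v => detMa K m n (v.1 + 1)) a)),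
      LinearMap.ext fun z => ?_⟩
    rw [DetPath.detEIso_corner Φ hΦ, RingEquiv.apply_symm_apply]
    simp only [LinearMap.comp_apply, DirectSum.component.lof_self]

end
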